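/- arXiv:math/0411124 — 5 statements merged into one kernel-verified Lean document; each statement's English description precedes it below -/
import Mathlib

section
/- Let A be a commutative Noetherian ring of Krull dimension d. Then any finitely generated projective A-module P of constant rank > d has a unimodular element. In particular, if dim A = 1, then any finitely generated projective A-module of trivial determinant is free. -/
/-- An element `m` of an `R`-module `M` is *unimodular* if some linear functional maps it to `1`. -/
def IsUnimodular (R : Type*) {M : Type*} [CommRing R] [AddCommGroup M] [Module R M]
    (m : M) : Prop :=
  ∃ ψ : M →ₗ[R] R, ψ m = 1

/-- The (finite) rank of the `R`-module `M` at a prime `𝔭` of `R`, i.e. the rank of the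
localization of `M` at `𝔭` over the local ring `R_𝔭`. -/
noncomputable def rankAt (R M : Type*) [CommRing R] [AddCommGroup M] [Module R M]
    (𝔭 : PrimeSpectrum R) : ℕ :=
  Module.finrank (Localization.AtPrime 𝔭.asIdeal) (LocalizedModule 𝔭.asIdeal.primeCompl M)



namespace SerreAux

open Module

universe v

section field
variable {K V : Type*} [Field K] [AddCommGroup V] [Module K V]

lemma span_eq_sup {n : ℕ} (p : Fin (n+1) → V) (a : Fin n → K) :
    Submodule.span K (Set.range p) =
      Submodule.span K (Set.range fun i : Fin n => p i.succ + a i • p 0) ⊔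
        Submodule.span K {p 0} := by
  apply le_antisymm
  · rw [Submodule.span_le]
    rintro _ ⟨i, rfl⟩
    have h0 : p 0 ∈ Submodule.span K (Set.range fun i : Fin n => p i.succ + a i • p 0) ⊔
        Submodule.span K {p 0} :=
      (le_sup_right : Submodule.span K {p 0} ≤ _) (Submodule.mem_span_singleton_self _)
    refine Fin.cases h0 (fun j => ?_) i
    have h1 : p j.succ + a j • p 0 ∈
        Submodule.span K (Set.range fun i : Fin n => p i.succ + a i • p 0) ⊔
        Submodule.span K {p 0} :=
      (le_sup_left : Submodule.span K (Set.range fun i : Fin n => p i.succ + a i • p 0) ≤ _)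
        (Submodule.subset_span ⟨j, rfl⟩)
    have := Submodule.sub_mem _ h1 (Submodule.smul_mem _ (a j) h0)
    simpa using this
  · refine sup_le ?_ ?_
    · rw [Submodule.span_le]
      rintro _ ⟨i, rfl⟩
      exact Submodule.add_mem _ (Submodule.subset_span ⟨_, rfl⟩)
        (Submodule.smul_mem _ _ (Submodule.subset_span ⟨_, rfl⟩))
    · rw [Submodule.span_singleton_le_iff_mem]
      exact Submodule.subset_span ⟨_, rfl⟩

lemma finrank_drop [FiniteDimensional K V] {n : ℕ} (p : Fin (n+1) → V) (a : Fin n → K) :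
    finrank K (Submodule.span K (Set.range p)) ≤
      finrank K (Submodule.span K (Set.range fun i : Fin n => p i.succ + a i • p 0)) + 1 := by
  rw [span_eq_sup p a]
  refine (Submodule.finrank_add_le_finrank_add_finrank _ _).trans ?_
  gcongr
  simpa using finrank_span_le_card (R := K) ({p 0} : Set V)

lemma good_or {n : ℕ} (p : Fin (n+1) → V) (h : ¬ LinearIndependent K p) (a : Fin n → K) :
    (p 0 ∈ Submodule.span K (Set.range fun i : Fin n => p i.succ + a i • p 0)) ∨
    ∃ i₀ : Fin n, ∀ l : K, l ≠ 0 → p 0 ∈ Submodule.span K (Set.range fun i : Fin n =>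
      p i.succ + (a i + if i = i₀ then l else 0) • p 0) := by
  obtain ⟨c, hc, j, hj⟩ := Fintype.not_linearIndependent_iff.mp h
  rw [Fin.sum_univ_succ] at hc
  have key : ∀ b : Fin n → K, (∑ i, c i.succ * b i) - c 0 ≠ 0 →
      p 0 ∈ Submodule.span K (Set.range fun i : Fin n => p i.succ + b i • p 0) := by
    intro b hb
    have h1 : ∑ i : Fin n, c i.succ • (p i.succ + b i • p 0) =
        ((∑ i, c i.succ * b i) - c 0) • p 0 := by
      simp only [smul_add, Finset.sum_add_distrib, sub_smul, Finset.sum_smul, smul_smul]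
      rw [eq_sub_iff_add_eq, ← sub_eq_zero, ← hc]
      abel
    rw [← Submodule.smul_mem_iff _ hb, ← h1]
    exact Submodule.sum_mem _ fun i _ => Submodule.smul_mem _ _ (Submodule.subset_span ⟨i, rfl⟩)
  by_cases h0 : (∑ i, c i.succ * a i) - c 0 = 0
  · by_cases hi : ∃ i : Fin n, c i.succ ≠ 0
    · obtain ⟨i, hi⟩ := hi
      right
      refine ⟨i, fun l hl => key _ ?_⟩
      have : (∑ x : Fin n, c x.succ * (a x + if x = i then l else 0)) - c 0 = c i.succ * l := by
        simp only [mul_add, Finset.sum_add_distrib, mul_ite, mul_zero, Finset.sum_ite_eq',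
          Finset.mem_univ, if_true]
        linear_combination h0
      rw [this]
      exact mul_ne_zero hi hl
    · push Not at hi
      exfalso
      have : c 0 = 0 := by simpa [hi] using h0
      apply hj
      exact Fin.cases this hi j
  · exact Or.inl (key a h0)

end field

variable {A : Type*} [CommRing A] {ι : Type*} [Fintype ι]

/-- reduction of a vector modulo a prime -/
noncomputable def red (𝔭 : PrimeSpectrum A) (x : ι → A) : ι → 𝔭.asIdeal.ResidueField :=
  fun j => algebraMap A _ (x j)

/-- rank modulo a prime -/
noncomputable def rho {n : ℕ} (𝔭 : PrimeSpectrum A) (p : Fin n → ι → A) : ℕ :=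
  finrank 𝔭.asIdeal.ResidueField
    (Submodule.span 𝔭.asIdeal.ResidueField (Set.range fun i => red 𝔭 (p i)))

lemma exists_open [DecidableEq ι] {n : ℕ} (𝔭 : PrimeSpectrum A) (p : Fin n → ι → A) :
    ∃ δ : A, δ ∉ 𝔭.asIdeal ∧ ∀ 𝔮 : PrimeSpectrum A, δ ∉ 𝔮.asIdeal → rho 𝔭 p ≤ rho 𝔮 p := by
  obtain ⟨f, hf, hli⟩ : ∃ f : Fin (rho 𝔭 p) → ι → 𝔭.asIdeal.ResidueField,
      (∀ i, f i ∈ Set.range fun i => red 𝔭 (p i)) ∧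
        LinearIndependent 𝔭.asIdeal.ResidueField f := by
    obtain ⟨f, hf, -, hli⟩ := Submodule.exists_fun_fin_finrank_span_eq 𝔭.asIdeal.ResidueField
      (Set.range fun i => red 𝔭 (p i))
    exact ⟨f, hf, hli⟩
  choose g hg using hf
  simp only at hg
  let K := 𝔭.asIdeal.ResidueField
  obtain ⟨B, hB⟩ := (Fintype.linearCombination K f).exists_leftInverse_of_injective
    (by rw [LinearMap.ker_eq_bot]; exact linearIndependent_iff_injective_fintypeLinearCombination.mp hli)
  obtain ⟨⟨s, hs⟩, hsb⟩ := IsLocalization.exist_integer_multiples_of_finite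
    (nonZeroDivisors (A ⧸ 𝔭.asIdeal)) (fun x : ι × Fin (rho 𝔭 p) => B (Pi.single x.1 1) x.2)
  choose c' hc' using hsb
  choose c hc using fun x => Ideal.Quotient.mk_surjective (c' x)
  obtain ⟨s, rfl⟩ := Ideal.Quotient.mk_surjective s
  have hs0 : algebraMap A K s ≠ 0 := by
    intro h
    rw [Ideal.algebraMap_residueField_eq_zero] at h
    exact nonZeroDivisors.ne_zero hs (Ideal.Quotient.eq_zero_iff_mem.mpr h)
  have hcs : ∀ j k, algebraMap A K (c (j, k)) = algebraMap A K s * B (Pi.single j 1) k := by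
    intro j k
    have := hc' (j, k)
    rw [← hc, Ideal.algebraMap_quotient_residueField_mk] at this
    rw [this, Algebra.smul_def, Ideal.algebraMap_quotient_residueField_mk]
  let G : Matrix (Fin (rho 𝔭 p)) ι A := Matrix.of fun i j => p (g i) j
  let C : Matrix ι (Fin (rho 𝔭 p)) A := Matrix.of fun j k => c (j, k)
  refine ⟨(G * C).det, ?_, ?_⟩
  · rw [← Ideal.algebraMap_residueField_eq_zero, RingHom.map_det]
    have : (algebraMap A 𝔭.asIdeal.ResidueField).mapMatrix (G * C) =
        Matrix.scalar _ (algebraMap A K s) := by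
      ext i k
      have h1 := congrFun (congrFun (congrArg DFunLike.coe hB) (Pi.single i 1)) k
      simp only [LinearMap.comp_apply, Fintype.linearCombination_apply_single, one_smul,
        LinearMap.id_apply] at h1
      rw [← hg, pi_eq_sum_univ (red 𝔭 (p (g i)))] at h1
      simp only [map_sum, map_smul, Finset.sum_apply, Pi.smul_apply, smul_eq_mul] at h1
      have h2 : ((algebraMap A 𝔭.asIdeal.ResidueField).mapMatrix (G * C)) i k =
          ∑ j, algebraMap A K (p (g i) j) * (algebraMap A K s * B (Pi.single j 1) k) := by
        simp [Matrix.mul_apply, G, C, ← hcs, K]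
      rw [h2]
      have h3 : Matrix.scalar (Fin (rho 𝔭 p)) (algebraMap A K s) i k =
          algebraMap A K s * (Pi.single i 1 : Fin (rho 𝔭 p) → K) k := by
        simp [Matrix.scalar_apply, Matrix.diagonal_apply, Pi.single_apply, eq_comm]
      rw [h3, ← h1, Finset.mul_sum]
      refine Finset.sum_congr rfl fun j _ => ?_
      have : (fun j_1 => if j = j_1 then (1:K) else 0) = Pi.single j 1 := by
        ext; simp [Pi.single_apply, eq_comm]
      rw [this]
      simp only [red]
      ring
    rw [this]
    simp [hs0]
  · intro 𝔮 h𝔮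
    let L := 𝔮.asIdeal.ResidueField
    rw [← Ideal.algebraMap_residueField_eq_zero, RingHom.map_det] at h𝔮
    have h1 : (((algebraMap A L).mapMatrix (G * C))).rank = rho 𝔭 p := by
      rw [Matrix.rank_of_isUnit _ ((Matrix.isUnit_iff_isUnit_det _).mpr (isUnit_iff_ne_zero.mpr h𝔮))]
      simp
    have h2 : ((algebraMap A L).mapMatrix (G * C)) = G.map (algebraMap A L) * C.map (algebraMap A L) := by
      simp [Matrix.map_mul]
    have h3 := Matrix.rank_mul_le_left (G.map (algebraMap A L)) (C.map (algebraMap A L))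
    rw [← h2, h1, Matrix.rank_eq_finrank_span_row] at h3
    refine h3.trans ?_
    apply Submodule.finrank_mono
    apply Submodule.span_mono
    rintro _ ⟨i, rfl⟩
    exact ⟨g i, rfl⟩

lemma avoid {n : ℕ} (G : PrimeSpectrum A → (Fin n → A) → Prop)
    (h2 : ∀ 𝔭 a i₀ l, l ∈ 𝔭.asIdeal → G 𝔭 a → G 𝔭 (fun i => a i + if i = i₀ then l else 0))
    (T : Finset (PrimeSpectrum A))
    (h1 : ∀ 𝔭 ∈ T, ∀ a, G 𝔭 a ∨ ∃ i₀, ∀ l, l ∉ 𝔭.asIdeal →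
      G 𝔭 (fun i => a i + if i = i₀ then l else 0)) :
    ∃ a, ∀ 𝔭 ∈ T, G 𝔭 a := by
  classical
  induction T using Finset.strongInduction with
  | H T ih =>
    rcases T.eq_empty_or_nonempty with rfl | hT
    · exact ⟨0, by simp⟩
    obtain ⟨𝔭, h𝔭, hmin⟩ := T.exists_minimal hT
    obtain ⟨a, ha⟩ := ih (T.erase 𝔭) (Finset.erase_ssubset h𝔭)
      (fun 𝔮 h𝔮 => h1 𝔮 (Finset.mem_of_mem_erase h𝔮))
    rcases h1 𝔭 h𝔭 a with hg | ⟨i₀, hg⟩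
    · refine ⟨a, fun 𝔮 h𝔮 => ?_⟩
      by_cases h : 𝔮 = 𝔭
      · exact h ▸ hg
      · exact ha 𝔮 (Finset.mem_erase.mpr ⟨h, h𝔮⟩)
    · have hne : ¬ ((T.erase 𝔭).inf fun 𝔮 => 𝔮.asIdeal) ≤ 𝔭.asIdeal := by
        rw [Ideal.IsPrime.inf_le' 𝔭.isPrime]
        rintro ⟨𝔮, h𝔮, hle⟩
        rw [Finset.mem_erase] at h𝔮
        exact h𝔮.1 (le_antisymm hle (hmin h𝔮.2 hle))
      obtain ⟨l, hl, hl'⟩ := SetLike.not_le_iff_exists.mp hne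
      refine ⟨fun i => a i + if i = i₀ then l else 0, fun 𝔮 h𝔮 => ?_⟩
      by_cases h : 𝔮 = 𝔭
      · subst h; exact hg l hl'
      · refine h2 𝔮 a i₀ l ?_ (ha 𝔮 (Finset.mem_erase.mpr ⟨h, h𝔮⟩))
        exact (Finset.inf_le (f := fun 𝔮 : PrimeSpectrum A => 𝔮.asIdeal)
          (Finset.mem_erase.mpr ⟨h, h𝔮⟩)) hl

lemma tight_finite [IsNoetherianRing A] (h : PrimeSpectrum A → ℕ) (hmono : StrictMono h) {n : ℕ}
    (p : Fin (n+1) → ι → A) (r : ℕ) (hc : ∀ 𝔭, n + 1 ≤ rho 𝔭 p ∨ r ≤ rho 𝔭 p + h 𝔭) :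
    {𝔭 | rho 𝔭 p ≤ n ∧ rho 𝔭 p + h 𝔭 = r}.Finite := by
  classical
  let I : ℕ → Ideal A := fun t =>
    Ideal.span {δ | ∀ 𝔮 : PrimeSpectrum A, δ ∉ 𝔮.asIdeal → t + 1 ≤ rho 𝔮 p}
  have hI : ∀ t (𝔭 : PrimeSpectrum A), I t ≤ 𝔭.asIdeal ↔ rho 𝔭 p ≤ t := by
    intro t 𝔭
    constructor
    · intro hle
      by_contra hlt
      obtain ⟨δ, hδ, H⟩ := exists_open 𝔭 p
      exact hδ (hle (Ideal.subset_span fun 𝔮 h𝔮 => by have := H 𝔮 h𝔮; omega))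
    · intro hle
      rw [Ideal.span_le]
      intro δ hδ
      by_contra hn
      have := hδ 𝔭 hn
      omega
  have hfin : (⋃ t ∈ Set.Iic n, {𝔭 : PrimeSpectrum A | 𝔭.asIdeal ∈ (I t).minimalPrimes}).Finite := by
    refine Set.Finite.biUnion (Set.finite_Iic n) fun t _ => ?_
    refine Set.Finite.preimage ?_ ((I t).finite_minimalPrimes_of_isNoetherianRing A)
    intro x _ y _ hxy
    exact PrimeSpectrum.ext hxy
  refine hfin.subset ?_
  rintro 𝔭 ⟨h1, h2⟩
  simp only [Set.mem_iUnion, Set.mem_Iic, Set.mem_ofPred_eq]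
  refine ⟨rho 𝔭 p, h1, ⟨𝔭.isPrime, (hI _ _).mpr le_rfl⟩, ?_⟩
  rintro q ⟨hq, hIq⟩ hle
  by_contra hnle
  have hlt : (⟨q, hq⟩ : PrimeSpectrum A) < 𝔭 := lt_of_le_not_ge hle hnle
  have h3 := (hI _ ⟨q, hq⟩).mp hIq
  have h4 := hmono hlt
  have h5 := hc ⟨q, hq⟩
  omega

lemma red_add_smul (𝔭 : PrimeSpectrum A) (x y : ι → A) (a : A) :
    red 𝔭 (x + a • y) = red 𝔭 x + algebraMap A 𝔭.asIdeal.ResidueField a • red 𝔭 y := by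
  ext j
  simp [red, Algebra.smul_def]

lemma step [IsNoetherianRing A] (h : PrimeSpectrum A → ℕ) (hmono : StrictMono h) {n : ℕ}
    (p : Fin (n+1) → ι → A) (r : ℕ) (hc : ∀ 𝔭, n + 1 ≤ rho 𝔭 p ∨ r ≤ rho 𝔭 p + h 𝔭) :
    ∃ a : Fin n → A, ∀ 𝔭, n ≤ rho 𝔭 (fun i : Fin n => p i.succ + a i • p 0) ∨
      r ≤ rho 𝔭 (fun i : Fin n => p i.succ + a i • p 0) + h 𝔭 := by
  classical
  have hT := tight_finite h hmono p r hc
  let G : PrimeSpectrum A → (Fin n → A) → Prop := fun 𝔭 a =>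
    red 𝔭 (p 0) ∈ Submodule.span 𝔭.asIdeal.ResidueField
      (Set.range fun i : Fin n => red 𝔭 (p i.succ) + algebraMap A 𝔭.asIdeal.ResidueField (a i) • red 𝔭 (p 0))
  obtain ⟨a, ha⟩ : ∃ a, ∀ 𝔭 ∈ hT.toFinset, G 𝔭 a := by
    apply avoid G
    · intro 𝔭 a i₀ l hl hG
      have : algebraMap A 𝔭.asIdeal.ResidueField l = 0 := Ideal.algebraMap_residueField_eq_zero.mpr hl
      simp only [G, map_add, apply_ite (algebraMap A 𝔭.asIdeal.ResidueField), this, map_zero, ite_self, add_zero]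
      exact hG
    · intro 𝔭 h𝔭 a
      have ht : rho 𝔭 p ≤ n ∧ rho 𝔭 p + h 𝔭 = r := by simpa using h𝔭
      have hli : ¬ LinearIndependent 𝔭.asIdeal.ResidueField (fun i => red 𝔭 (p i)) := by
        intro hli
        have := finrank_span_eq_card hli
        rw [Fintype.card_fin] at this
        change rho 𝔭 p = _ at this
        omega
      rcases good_or _ hli (fun i => algebraMap A 𝔭.asIdeal.ResidueField (a i)) with hg | ⟨i₀, hg⟩
      · exact Or.inl hg
      · refine Or.inr ⟨i₀, fun l hl => ?_⟩
        have := hg (algebraMap A 𝔭.asIdeal.ResidueField l)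
          (fun h0 => hl (Ideal.algebraMap_residueField_eq_zero.mp h0))
        simpa only [G, map_add, apply_ite (algebraMap A 𝔭.asIdeal.ResidueField), map_zero] using this
  · refine ⟨a, fun 𝔭 => ?_⟩
    have hdrop := finrank_drop (fun i => red 𝔭 (p i))
      (fun i => algebraMap A 𝔭.asIdeal.ResidueField (a i))
    have e1 : rho 𝔭 (fun i : Fin n => p i.succ + a i • p 0) =
      finrank 𝔭.asIdeal.ResidueField (Submodule.span 𝔭.asIdeal.ResidueField
      (Set.range fun i : Fin n => red 𝔭 (p i.succ) + algebraMap A 𝔭.asIdeal.ResidueField (a i) • red 𝔭 (p 0))) := by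
      have e : (fun i : Fin n => red 𝔭 (p i.succ + a i • p 0)) = fun i : Fin n =>
          red 𝔭 (p i.succ) + algebraMap A 𝔭.asIdeal.ResidueField (a i) • red 𝔭 (p 0) :=
        funext fun i => red_add_smul _ _ _ _
      rw [rho, e]
    rw [← e1] at hdrop
    change rho 𝔭 p ≤ _ at hdrop
    by_cases ht : rho 𝔭 p ≤ n ∧ rho 𝔭 p + h 𝔭 = r
    · have hG := ha 𝔭 (by simpa using ht)
      have : rho 𝔭 (fun i : Fin n => p i.succ + a i • p 0) = rho 𝔭 p := by
        rw [e1, rho, span_eq_sup (fun i => red 𝔭 (p i))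
          (fun i => algebraMap A 𝔭.asIdeal.ResidueField (a i)), sup_eq_left.mpr]
        rw [Submodule.span_singleton_le_iff_mem]
        exact hG
      omega
    · have := hc 𝔭
      omega

lemma exists_vec [IsNoetherianRing A] (h : PrimeSpectrum A → ℕ) (hmono : StrictMono h)
    (r : ℕ) (hr : ∀ 𝔭, h 𝔭 < r) (N : Submodule A (ι → A)) (n : ℕ)
    (p : Fin (n+1) → ι → A) (hp : ∀ i, p i ∈ N)
    (hc : ∀ 𝔭, n + 1 ≤ rho 𝔭 p ∨ r ≤ rho 𝔭 p + h 𝔭) :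
    ∃ v ∈ N, ∀ 𝔭 : PrimeSpectrum A, ∃ j, v j ∉ 𝔭.asIdeal := by
  induction n with
  | zero =>
    refine ⟨p 0, hp 0, fun 𝔭 => ?_⟩
    by_contra! hj
    have : rho 𝔭 p = 0 := by
      have h0 : (fun i => red 𝔭 (p i)) = 0 := by
        ext i j
        rw [Fin.fin_one_eq_zero i]
        exact Ideal.algebraMap_residueField_eq_zero.mpr (hj j)
      rw [rho, h0]
      rw [Submodule.finrank_eq_zero, Submodule.span_eq_bot]
      rintro _ ⟨i, rfl⟩
      rfl
    have := hc 𝔭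
    have := hr 𝔭
    omega
  | succ n ih =>
    obtain ⟨a, ha⟩ := step h hmono p r hc
    exact ih _ (fun i => N.add_mem (hp _) (N.smul_mem _ (hp _))) ha

lemma exists_functional (v : ι → A) (hv : ∀ 𝔭 : PrimeSpectrum A, ∃ j, v j ∉ 𝔭.asIdeal) :
    ∃ ψ : (ι → A) →ₗ[A] A, ψ v = 1 := by
  classical
  have : Ideal.span (Set.range v) = ⊤ := by
    by_contra hne
    obtain ⟨m, hm, hle⟩ := Ideal.exists_le_maximal _ hne
    obtain ⟨j, hj⟩ := hv ⟨m, hm.isPrime⟩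
    exact hj (hle (Ideal.subset_span ⟨j, rfl⟩))
  rw [Ideal.eq_top_iff_one, Ideal.mem_span_range_iff_exists_fun] at this
  obtain ⟨c, hc⟩ := this
  refine ⟨∑ i, c i • LinearMap.proj i, ?_⟩
  simpa using hc

lemma exists_height (d : ℕ) (hdim : ringKrullDim A = d) :
    ∃ h : PrimeSpectrum A → ℕ, StrictMono h ∧ ∀ 𝔭, h 𝔭 ≤ d := by
  have hle : ∀ 𝔭 : PrimeSpectrum A, Order.height 𝔭 ≤ (d : ℕ∞) := by
    intro 𝔭
    have := Order.height_le_krullDim 𝔭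
    rw [← ringKrullDim, hdim] at this
    exact_mod_cast this
  have hlt : ∀ 𝔭 : PrimeSpectrum A, Order.height 𝔭 < ⊤ := fun 𝔭 =>
    (hle 𝔭).trans_lt (ENat.natCast_lt_top d)
  refine ⟨fun 𝔭 => (Order.height 𝔭).toNat, fun 𝔭 𝔮 hpq => ?_, fun 𝔭 => ?_⟩
  · have := Order.height_strictMono hpq (hlt 𝔭)
    rw [← ENat.natCast_toNat (hlt 𝔭).ne, ← ENat.natCast_toNat (hlt 𝔮).ne] at this
    exact_mod_cast this
  · exact ENat.toNat_le_of_le_natCast (hle 𝔭)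

open TensorProduct in
lemma rank_le_rho {P : Type*} [AddCommGroup P] [Module A P] [Module.Finite A P]
    [Module.Projective A P] {n : ℕ}
    (π : (Fin n → A) →ₗ[A] P) (s : P →ₗ[A] (Fin n → A)) (hs : π ∘ₗ s = LinearMap.id)
    (𝔭 : PrimeSpectrum A) :
    rankAtStalk P 𝔭 ≤ rho 𝔭 (fun i : Fin (n+1) =>
      (Fin.cons 0 (fun i => s (π (Pi.single i 1))) : Fin (n+1) → Fin n → A) i) := by
  rw [rankAtStalk_eq]
  let K := 𝔭.asIdeal.ResidueField
  let t : K ⊗[A] P →ₗ[K] (Fin n → K) :=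
    (TensorProduct.piScalarRight A K K (Fin n)).toLinearMap ∘ₗ s.baseChange K
  have hinj : Function.Injective t := by
    refine (TensorProduct.piScalarRight A K K (Fin n)).injective.comp ?_
    refine Function.LeftInverse.injective (g := π.baseChange K) fun x => ?_
    rw [← LinearMap.comp_apply, ← LinearMap.baseChange_comp, hs, LinearMap.baseChange_id]
    rfl
  have hrange : LinearMap.range t ≤ Submodule.span K (Set.range fun i : Fin (n+1) =>
      red 𝔭 ((Fin.cons 0 (fun i => s (π (Pi.single i 1))) : Fin (n+1) → Fin n → A) i)) := by
    rintro _ ⟨x, rfl⟩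
    induction x with
    | zero => simp
    | add x y hx hy => rw [map_add]; exact Submodule.add_mem _ hx hy
    | tmul c y =>
      obtain ⟨z, rfl⟩ : ∃ z, π z = y := ⟨s y, by rw [← LinearMap.comp_apply, hs]; rfl⟩
      have : t (c ⊗ₜ π z) = ∑ i, (c * algebraMap A K (z i)) • red 𝔭 (s (π (Pi.single i 1))) := by
        have hz : s (π z) = ∑ i, z i • s (π (Pi.single i 1)) := by
          conv_lhs => rw [pi_eq_sum_univ' z]
          simp only [map_sum, map_smul]
        ext j
        have h1 : t (c ⊗ₜ π z) j = s (π z) j • c := by simp [t]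
        rw [h1, hz]
        simp only [Finset.sum_apply, Pi.smul_apply, smul_eq_mul]
        rw [Algebra.smul_def]
        simp only [map_sum, map_mul, Finset.sum_mul, red]
        refine Finset.sum_congr rfl fun i _ => ?_
        ring
      rw [this]
      refine Submodule.sum_mem _ fun i _ => Submodule.smul_mem _ _ (Submodule.subset_span ⟨i.succ, ?_⟩)
      simp
  rw [← LinearMap.finrank_range_of_inj hinj]
  exact Submodule.finrank_mono hrange

lemma part1 [IsNoetherianRing A] (d : ℕ) (hdim : ringKrullDim A = d)
    {P : Type*} [AddCommGroup P] [Module A P] [Module.Finite A P] [Module.Projective A P]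
    (r : ℕ) (hrank : ∀ 𝔭 : PrimeSpectrum A, rankAtStalk P 𝔭 = r) (hr : d < r) :
    ∃ (p : P) (ψ : P →ₗ[A] A), ψ p = 1 := by
  obtain ⟨n, π, hπ⟩ := Module.Finite.exists_fin' A P
  obtain ⟨s, hs⟩ := Module.projective_lifting_property π LinearMap.id hπ
  obtain ⟨h, hmono, hh⟩ := exists_height d hdim
  obtain ⟨v, ⟨p, rfl⟩, hv⟩ := exists_vec h hmono r (fun 𝔭 => (hh 𝔭).trans_lt hr)
    (LinearMap.range s) n
    (fun i => (Fin.cons 0 (fun i => s (π (Pi.single i 1))) : Fin (n+1) → Fin n → A) i)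
    (fun i => by
      refine Fin.cases ?_ (fun j => ?_) i
      · exact zero_mem _
      · exact ⟨_, rfl⟩)
    (fun 𝔭 => Or.inr (((hrank 𝔭).ge.trans (rank_le_rho π s hs 𝔭)).trans (Nat.le_add_right _ _)))
  obtain ⟨ψ, hψ⟩ := exists_functional _ hv
  exact ⟨p, ψ ∘ₗ s, hψ⟩

lemma split_one {P : Type*} [AddCommGroup P] [Module A P] (p : P) (ψ : P →ₗ[A] A) (h : ψ p = 1) :
    Nonempty (P ≃ₗ[A] LinearMap.ker ψ × A) ∧
      ∃ t : P →ₗ[A] LinearMap.ker ψ, t ∘ₗ (LinearMap.ker ψ).subtype = LinearMap.id := by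
  let t : P →ₗ[A] LinearMap.ker ψ :=
    (LinearMap.id - ψ.smulRight p).codRestrict _ (fun x => by simp [h])
  have htv : ∀ x, (t x : P) = x - ψ x • p := fun x => rfl
  clear_value t
  refine ⟨⟨LinearEquiv.ofLinearMap (t.prod ψ)
    ((LinearMap.ker ψ).subtype.coprod (LinearMap.toSpanSingleton A P p)) ?_ ?_⟩, t, ?_⟩
  · apply LinearMap.ext
    rintro ⟨⟨k, hk⟩, a⟩
    have hk' : ψ k = 0 := hk
    ext
    · simp [htv, hk', h]
    · simp [hk', h]
  · apply LinearMap.ext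
    intro x
    simp [htv]
  · apply LinearMap.ext
    rintro ⟨k, hk⟩
    have hk' : ψ k = 0 := hk
    ext
    simp [htv, hk']

lemma split_iter [IsNoetherianRing A] [Nontrivial A] (d : ℕ) (hdim : ringKrullDim A = d) (n : ℕ) :
    ∀ (P : Type v) [AddCommGroup P] [Module A P] [Module.Finite A P] [Module.Projective A P]
    (_ : ∀ 𝔭 : PrimeSpectrum A, rankAtStalk P 𝔭 = d + n),
    ∃ (Q : Type v) (_ : AddCommGroup Q) (_ : Module A Q), Module.Finite A Q ∧
      Module.Projective A Q ∧ (∀ 𝔭 : PrimeSpectrum A, rankAtStalk Q 𝔭 = d) ∧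
      Nonempty (P ≃ₗ[A] Q × (Fin n → A)) := by
  induction n with
  | zero =>
    intro P _ _ _ _ hP
    exact ⟨P, inferInstance, inferInstance, inferInstance, inferInstance, hP,
      ⟨(LinearEquiv.prodUnique).symm⟩⟩
  | succ n ih =>
    intro P _ _ _ _ hP
    obtain ⟨p, ψ, h⟩ := part1 d hdim (d + (n+1)) hP (by omega)
    obtain ⟨⟨e⟩, t, ht⟩ := split_one p ψ h
    have : Module.Projective A (LinearMap.ker ψ) := Module.Projective.of_split _ t ht
    obtain ⟨Q, i1, i2, i3, i4, hQ, ⟨e'⟩⟩ := ih (LinearMap.ker ψ) (fun 𝔭 => by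
      have := hP 𝔭
      rw [rankAtStalk_eq_of_equiv e, rankAtStalk_prod, Pi.add_apply, rankAtStalk_self] at this
      simp only [Pi.one_apply] at this
      omega)
    refine ⟨Q, i1, i2, i3, i4, hQ, ⟨?_⟩⟩
    exact e ≪≫ₗ (e'.prodCongr (LinearEquiv.refl A A)) ≪≫ₗ LinearEquiv.prodAssoc A Q (Fin n → A) A
      ≪≫ₗ (LinearEquiv.refl A Q).prodCongr
        (LinearEquiv.prodComm A (Fin n → A) A ≪≫ₗ Fin.consLinearEquiv A (fun _ : Fin (n+1) => A))

lemma exists_gen {L : Type*} [AddCommGroup L] [Module A L] (m : PrimeSpectrum A)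
    [Module.Finite A L] [Module.Projective A L]
    (hL : rankAtStalk L m = 1) :
    ∃ l₀ : L, ∀ l : L, ∃ s : A, s ∉ m.asIdeal ∧ ∃ a : A, s • l = a • l₀ := by
  have : Module.Free (Localization.AtPrime m.asIdeal) (LocalizedModule m.asIdeal.primeCompl L) :=
    free_of_flat_of_isLocalRing
  let b := Module.finBasisOfFinrankEq _ _ hL
  obtain ⟨⟨l₀, s₀⟩, hl₀⟩ := IsLocalizedModule.mk'_surjective m.asIdeal.primeCompl
    (LocalizedModule.mkLinearMap m.asIdeal.primeCompl L) (b 0)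
  refine ⟨l₀, fun l => ?_⟩
  have h1 := b.sum_repr (LocalizedModule.mkLinearMap m.asIdeal.primeCompl L l)
  rw [Fin.sum_univ_one] at h1
  obtain ⟨⟨a, s⟩, has⟩ := IsLocalization.mk'_surjective m.asIdeal.primeCompl
    (b.repr (LocalizedModule.mkLinearMap m.asIdeal.primeCompl L l) 0)
  simp only [Function.uncurry] at hl₀ has
  rw [← hl₀, ← has, IsLocalizedModule.mk'_smul_mk', ← IsLocalizedModule.mk'_one m.asIdeal.primeCompl,
    IsLocalizedModule.mk'_eq_mk'_iff] at h1
  obtain ⟨c, hc⟩ := h1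
  refine ⟨c * s * s₀, ?_, c * a, ?_⟩
  · exact (c * s * s₀).2
  · simp only [Submonoid.smul_def, Submonoid.coe_mul, Submonoid.coe_one, one_smul] at hc
    simp only [mul_smul] at hc ⊢
    exact hc

lemma rank_one {L : Type*} [AddCommGroup L] [Module A L] [Nontrivial A]
    [Module.Finite A L] [Module.Projective A L]
    (hL : ∀ 𝔭 : PrimeSpectrum A, rankAtStalk L 𝔭 = 1) (n : ℕ)
    (g : (L × (Fin n → A)) [⋀^Fin (n+1)]→ₗ[A] A)
    (hg : ∀ m : PrimeSpectrum A, ∃ v, g v ∉ m.asIdeal) : Nonempty (L ≃ₗ[A] A) := by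
  classical
  let w : L → Fin (n+1) → L × (Fin n → A) := fun l =>
    Fin.cons (l, 0) (fun i => (0, Pi.single i 1))
  let f : L →ₗ[A] A := g.toMultilinearMap.toLinearMap (w 0) 0 ∘ₗ LinearMap.inl A L (Fin n → A)
  have hf : ∀ l, f l = g (w l) := by
    intro l
    simp [f, w]
  have hsurj : Function.Surjective f := by
    rw [← LinearMap.range_eq_top]
    by_contra hne
    obtain ⟨m, hm, hle⟩ := Ideal.exists_le_maximal (LinearMap.range f) hne
    let 𝔪 : PrimeSpectrum A := ⟨m, hm.isPrime⟩
    obtain ⟨l₀, hl₀⟩ := exists_gen 𝔪 (hL 𝔪)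
    obtain ⟨v, hv⟩ := hg 𝔪
    choose s hs a ha using hl₀
    let F : (Fin (n+1) → A) →ₗ[A] L × (Fin n → A) := Fintype.linearCombination A (w l₀)
    have hF : ∀ u : Fin (n+1) → Fin (n+1) → A, g (fun i => F (u i)) ∈ m := by
      have h0 : g.compLinearMap F = g (w l₀) • (Pi.basisFun A (Fin (n+1))).det := by
        rw [AlternatingMap.eq_smul_basis_det (Pi.basisFun A (Fin (n+1))) (g.compLinearMap F)]
        congr 1
        simp [F]
      intro u
      have := congrArg (fun G => G u) h0
      change g (fun i => F (u i)) = _ at this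
      rw [this, AlternatingMap.smul_apply, smul_eq_mul, ← hf]
      exact Ideal.mul_mem_right _ _ (hle ⟨l₀, rfl⟩)
    have hmem : ∀ x : L × (Fin n → A), s x.1 • x = F (Fin.cons (a x.1) (s x.1 • x.2)) := by
      intro x
      simp only [F, Fintype.linearCombination_apply, Fin.sum_univ_succ, w, Fin.cons_zero, Fin.cons_succ]
      ext j
      · simp [ha, Prod.fst_sum]
      · simp [Prod.snd_sum, Pi.single_apply]
    have h1 := g.map_smul_univ (fun i => s (v i).1) v
    have h2 := hF (fun i => Fin.cons (a (v i).1) (s (v i).1 • (v i).2))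
    simp only [← hmem] at h2
    rw [h1, smul_eq_mul] at h2
    rcases hm.isPrime.mem_or_mem h2 with h3 | h3
    · rw [Ideal.IsPrime.prod_mem_iff] at h3
      obtain ⟨i, -, hi⟩ := h3
      exact hs _ hi
    · exact hv h3
  refine ⟨LinearEquiv.ofBijective f (bijective_of_surjective_of_rankAtStalk_eq hsurj ?_)⟩
  intro m hm
  rw [hL, rankAtStalk_self]
  rfl

lemma part2 [IsNoetherianRing A] (hdim : ringKrullDim A = 1)
    (P : Type v) [AddCommGroup P] [Module A P] [Module.Finite A P] [Module.Projective A P]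
    (r : ℕ) (hrank : ∀ 𝔭 : PrimeSpectrum A, rankAtStalk P 𝔭 = r)
    (φ : (⋀[A]^r P) ≃ₗ[A] A) : Module.Free A P := by
  have : Nontrivial A := by
    by_contra h
    rw [not_nontrivial_iff_subsingleton] at h
    rw [ringKrullDim_eq_bot_of_subsingleton] at hdim
    simp at hdim
  rcases r with _ | n
  · have : Subsingleton P := rankAtStalk_eq_zero_iff_subsingleton.mp (funext hrank)
    infer_instance
  · obtain ⟨L, i1, i2, i3, i4, hL, ⟨e⟩⟩ := split_iter 1 (by simpa using hdim) n P
      (fun 𝔭 => by rw [hrank]; omega)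
    obtain ⟨e'⟩ := rank_one hL n
      ((φ.toLinearMap.compAlternatingMap (exteriorPower.ιMulti A (n+1))).compLinearMap
        e.symm.toLinearMap) (by
      intro m
      by_contra! hv
      have h1 : (⊤ : Submodule A (⋀[A]^(n+1) P)) ≤ Submodule.comap φ.toLinearMap m.asIdeal := by
        rw [← exteriorPower.ιMulti_span, Submodule.span_le]
        rintro _ ⟨v, rfl⟩
        have := hv (fun i => e (v i))
        simpa [Function.comp_def] using this
      have h2 : φ.symm 1 ∈ Submodule.comap φ.toLinearMap m.asIdeal := h1 trivial
      apply m.isPrime.ne_top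
      rw [Ideal.eq_top_iff_one]
      simpa using h2)
    exact Module.Free.of_equiv (e ≪≫ₗ e'.prodCongr (LinearEquiv.refl A _)).symm

end SerreAux
/-- **Serre's theorem.** Over a commutative Noetherian ring `A` of Krull dimension `d`, any
finitely generated projective `A`-module of constant rank `r > d` has a unimodular element;
in particular if `d = 1` then any finitely generated projective `A`-module of trivial
determinant is free. -/
theorem serre_unimodular_element
    (A : Type*) [CommRing A] [IsNoetherianRing A] (d : ℕ) (hdim : ringKrullDim A = d)
    (P : Type*) [AddCommGroup P] [Module A P] [Module.Finite A P] [Module.Projective A P]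
    (r : ℕ) (hrank : ∀ 𝔭 : PrimeSpectrum A, rankAt A P 𝔭 = r) :
    (r > d → ∃ p : P, IsUnimodular A p) ∧
    (d = 1 → Nonempty ((⋀[A]^r P) ≃ₗ[A] A) → Module.Free A P) := by
  refine ⟨fun hr => ?_, fun hd => ?_⟩
  · exact SerreAux.part1 d hdim r hrank hr
  · rintro ⟨φ⟩
    subst hd
    exact SerreAux.part2 (by simpa using hdim) P r hrank φ
end

section
/- Let A be a commutative Noetherian ring of Krull dimension d and let P be a finitely generated projective A-module of constant rank > d. Then the group E(A ⊕ P) of transvections acts transitively on the set Um(A ⊕ P) of unimodular elements of A ⊕ P. -/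
/-- A *transvection* of the `R`-module `M` is an automorphism of the form `1 + φ_p` with
`φ ∈ M*`, `p ∈ M`, `φ(p) = 0` and `φ` or `p` unimodular. -/
def IsTransvection {R M : Type*} [CommRing R] [AddCommGroup M] [Module R M]
    (τ : M ≃ₗ[R] M) : Prop :=
  ∃ (φ : M →ₗ[R] R) (p : M), φ p = 0 ∧ (IsUnimodular R φ ∨ IsUnimodular R p) ∧
    ∀ x : M, τ x = x + φ x • p

/-- `E(M)`: the subgroup of `Aut_R(M)` generated by all transvections. -/
def transvectionSubgroup (R M : Type*) [CommRing R] [AddCommGroup M] [Module R M] :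
    Subgroup (M ≃ₗ[R] M) :=
  Subgroup.closure {τ : M ≃ₗ[R] M | IsTransvection τ}


noncomputable def bRed {A : Type*} [CommRing A] (n : ℕ) (p : PrimeSpectrum A) :
    (Fin n → A) →ₗ[A] (Fin n → p.asIdeal.ResidueField) :=
  (Algebra.linearMap A p.asIdeal.ResidueField).compLeft (Fin n)

noncomputable def bRk {A : Type*} [CommRing A] {n : ℕ} {ι : Type*} (v : ι → Fin n → A)
    (p : PrimeSpectrum A) : ℕ :=
  Module.finrank p.asIdeal.ResidueField
    (Submodule.span p.asIdeal.ResidueField (Set.range fun i => bRed n p (v i)))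

theorem b_field {K V : Type*} [Field K] [AddCommGroup V] [Module K V] {m : ℕ}
    (v : Fin (m+2) → V) (h : ¬ LinearIndependent K v) :
    ∃ (l : Fin (m+1) → K) (μ : K), l ≠ 0 ∧ ∀ c : Fin (m+1) → K, ∑ i, l i * c i ≠ μ →
      v (Fin.last _) ∈ Submodule.span K
        (Set.range fun i : Fin (m+1) => v i.castSucc + c i • v (Fin.last _)) := by
  rw [Fintype.linearIndependent_iff] at h
  push Not at h
  obtain ⟨g, hg, i, hi⟩ := h
  rw [Fin.sum_univ_castSucc] at hg
  by_cases hl : (fun i : Fin (m+1) => g i.castSucc) = 0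
  · have hl' : ∀ i : Fin (m+1), g i.castSucc = 0 := fun i => congrFun hl i
    have hlast : g (Fin.last _) ≠ 0 := by
      intro h0
      apply hi
      refine Fin.lastCases h0 (fun j => hl' j) i
    have hy : v (Fin.last _) = 0 := by
      simp only [hl', zero_smul, Finset.sum_const_zero, zero_add] at hg
      exact (smul_eq_zero.mp hg).resolve_left hlast
    refine ⟨fun _ => 1, 0, fun h => one_ne_zero (congrFun h 0), fun c _ => ?_⟩
    rw [hy]; exact Submodule.zero_mem _
  · refine ⟨fun i => g i.castSucc, g (Fin.last _), hl, fun c hc => ?_⟩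
    set W := Submodule.span K
        (Set.range fun i : Fin (m+1) => v i.castSucc + c i • v (Fin.last _))
    have h1 : ∑ i : Fin (m+1), g i.castSucc • (v i.castSucc + c i • v (Fin.last _)) ∈ W :=
      Submodule.sum_mem _ fun i _ => Submodule.smul_mem _ _ (Submodule.subset_span ⟨i, rfl⟩)
    have h2 : ∑ i : Fin (m+1), g i.castSucc • (v i.castSucc + c i • v (Fin.last _))
        = (∑ i : Fin (m+1), g i.castSucc * c i - g (Fin.last _)) • v (Fin.last _) := by
      simp only [smul_add, Finset.sum_add_distrib, sub_smul, Finset.sum_smul, smul_smul]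
      rw [eq_neg_of_add_eq_zero_left hg]
      abel
    rw [h2] at h1
    exact (Submodule.smul_mem_iff _ (sub_ne_zero.mpr hc)).mp h1

theorem b_avoid {A : Type*} [CommRing A] {m : ℕ} (δ : PrimeSpectrum A → ℕ)
    (hδ : ∀ p q, q < p → δ p < δ q)
    (F : Finset (PrimeSpectrum A))
    (l : ∀ p : PrimeSpectrum A, Fin m → p.asIdeal.ResidueField)
    (μ : ∀ p : PrimeSpectrum A, p.asIdeal.ResidueField)
    (hl : ∀ p ∈ F, l p ≠ 0) :
    ∃ c : Fin m → A, ∀ p ∈ F,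
      ∑ i, l p i * algebraMap A p.asIdeal.ResidueField (c i) ≠ μ p := by
  classical
  revert hl
  induction F using Finset.induction_on_max_value δ with
  | empty => intro _; exact ⟨0, by simp⟩
  | insert p s hp hmax ih =>
    intro hl
    obtain ⟨c, hc⟩ := ih fun q hq => hl q (Finset.mem_insert_of_mem hq)
    by_cases hcp : ∑ i, l p i * algebraMap A p.asIdeal.ResidueField (c i) = μ p
    · have : ¬ (s.inf fun q => q.asIdeal) ≤ p.asIdeal := by
        rw [p.isPrime.inf_le']
        rintro ⟨q, hq, hqp⟩
        have hqp' : q ≤ p := hqp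
        rcases hqp'.lt_or_eq with h | h
        · have := hδ _ _ h
          have := hmax q hq
          omega
        · exact hp (h ▸ hq)
      obtain ⟨z, hz, hzp⟩ := SetLike.not_le_iff_exists.mp this
      obtain ⟨j, hj⟩ := Function.ne_iff.mp (hl p (Finset.mem_insert_self _ _))
      refine ⟨c + Pi.single j z, fun q hq => ?_⟩
      have key : ∀ q : PrimeSpectrum A, ∑ i, l q i * algebraMap A q.asIdeal.ResidueField ((c + Pi.single j z : Fin m → A) i)
          = ∑ i, l q i * algebraMap A q.asIdeal.ResidueField (c i)
            + l q j * algebraMap A q.asIdeal.ResidueField z := by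
        intro q
        simp only [Pi.add_apply, map_add, mul_add, Finset.sum_add_distrib]
        congr 1
        rw [Finset.sum_eq_single j]
        · simp
        · intro b _ hb; simp [hb]
        · simp
      rw [key]
      rcases Finset.mem_insert.mp hq with rfl | hq
      · rw [hcp]
        intro h
        have h := add_eq_left.mp h
        rcases mul_eq_zero.mp h with h | h
        · exact hj h
        · exact hzp (Ideal.algebraMap_residueField_eq_zero.mp h)
      · have : z ∈ q.asIdeal := (Finset.inf_le hq : (s.inf fun q => q.asIdeal) ≤ q.asIdeal) hz
        rw [Ideal.algebraMap_residueField_eq_zero.mpr this, mul_zero, add_zero]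
        exact hc q hq
    · refine ⟨c, fun q hq => ?_⟩
      rcases Finset.mem_insert.mp hq with rfl | hq
      · exact hcp
      · exact hc q hq

theorem b_closed {A : Type*} [CommRing A] {n : ℕ} {ι : Type*} [Finite ι] (v : ι → Fin n → A) (k : ℕ) :
    IsClosed {p : PrimeSpectrum A | bRk v p ≤ k} := by
  rw [← isOpen_compl_iff, isOpen_iff_forall_mem_open]
  intro p hp
  have hp : k + 1 ≤ bRk v p := by simpa [Nat.succ_le_iff] using hp
  -- choose independent vectors
  have h1 : ∃ f : Fin (k+1) → ι, LinearIndependent p.asIdeal.ResidueField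
      (fun j => bRed n p (v (f j))) := by
    obtain ⟨κ, a, ha, hs, hli⟩ := exists_linearIndependent' p.asIdeal.ResidueField
      (fun i => bRed n p (v i))
    have : Finite κ := Finite.of_injective a ha
    cases nonempty_fintype κ
    have hcard := finrank_span_eq_card hli
    rw [hs] at hcard
    have : k + 1 ≤ Fintype.card κ := by rw [← hcard]; exact hp
    obtain ⟨e⟩ : Nonempty (Fin (k+1) ↪ κ) := by
      apply Function.Embedding.nonempty_of_card_le; simpa using this
    exact ⟨a ∘ e, hli.comp e e.injective⟩
  obtain ⟨f, hf⟩ := h1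
  obtain ⟨B, hB⟩ : ∃ B : (Fin n → p.asIdeal.ResidueField) →ₗ[p.asIdeal.ResidueField]
      (Fin (k+1) → p.asIdeal.ResidueField), ∀ j, B (bRed n p (v (f j))) = Pi.single j 1 := by
    obtain ⟨g, hg⟩ := LinearMap.exists_extend
      ((Module.Basis.span hf).constr p.asIdeal.ResidueField fun j => (Pi.single j 1 : Fin (k+1) → p.asIdeal.ResidueField))
    refine ⟨g, fun j => ?_⟩
    have := LinearMap.congr_fun hg (Module.Basis.span hf j)
    rw [Module.Basis.constr_basis] at this
    rw [← this]
    simp [Module.Basis.span_apply]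
  obtain ⟨s, hs⟩ := IsLocalization.exist_integer_multiples_of_finite
    (nonZeroDivisors (A ⧸ p.asIdeal)) (fun ij : Fin (k+1) × Fin n => LinearMap.toMatrix' B ij.1 ij.2)
  obtain ⟨s, hs0⟩ := s
  choose b hb using hs
  have hs0 : algebraMap _ p.asIdeal.ResidueField s ≠ 0 := by
    intro h
    rw [map_eq_zero_iff _ (Ideal.injective_algebraMap_quotient_residueField _)] at h
    exact nonZeroDivisors.ne_zero hs0 h
  choose b' hb' using fun ij => Ideal.Quotient.mk_surjective (b ij)
  let B' : Matrix (Fin (k+1)) (Fin n) A := Matrix.of fun i j => b' (i, j)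
  let W : Matrix (Fin n) (Fin (k+1)) A := Matrix.of fun i j => v (f j) i
  have hdetp : (B' * W).det ∉ p.asIdeal := by
    rw [← Ideal.algebraMap_residueField_eq_zero, RingHom.map_det]
    have : (algebraMap A p.asIdeal.ResidueField).mapMatrix (B' * W)
        = (algebraMap _ p.asIdeal.ResidueField s) • (1 : Matrix (Fin (k+1)) (Fin (k+1)) p.asIdeal.ResidueField) := by
      ext i j
      have h := congrFun (hB j) i
      rw [← LinearMap.toMatrix'_mulVec] at h
      simp only [RingHom.mapMatrix_apply, Matrix.map_apply, Matrix.mul_apply, map_sum, map_mul,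
        Matrix.smul_apply, smul_eq_mul]
      have hone : (1 : Matrix (Fin (k+1)) (Fin (k+1)) p.asIdeal.ResidueField) i j
        = (Pi.single j 1 : Fin (k+1) → p.asIdeal.ResidueField) i := by
        simp [Matrix.one_apply, Pi.single_apply]
      rw [hone, ← h, Matrix.mulVec, dotProduct, Finset.mul_sum]
      refine Finset.sum_congr rfl fun x _ => ?_
      have h3 := hb (i, x)
      rw [← hb' (i, x), Ideal.algebraMap_quotient_residueField_mk, Algebra.smul_def] at h3
      change algebraMap A _ (b' (i, x)) * algebraMap A _ (v (f j) x) = _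
      rw [h3, mul_assoc]
      rfl
    rw [this, Matrix.det_smul, Matrix.det_one, mul_one]
    exact pow_ne_zero _ hs0
  refine ⟨PrimeSpectrum.basicOpen (B' * W).det, ?_, (PrimeSpectrum.basicOpen _).isOpen, hdetp⟩
  intro q hq
  have hq : (B' * W).det ∉ q.asIdeal := hq
  rw [← Ideal.algebraMap_residueField_eq_zero, RingHom.map_det] at hq
  have hli := Matrix.linearIndependent_cols_of_det_ne_zero hq
  have hli2 : LinearIndependent q.asIdeal.ResidueField (fun j => bRed n q (v (f j))) := by
    apply LinearIndependent.of_comp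
      (Matrix.mulVecLin ((B'.map (algebraMap A q.asIdeal.ResidueField))))
    convert hli using 1
    ext j i
    simp [bRed, Matrix.mulVec, dotProduct, Matrix.mul_apply, W, Matrix.col]
  have := finrank_span_eq_card hli2
  have h4 : Submodule.span q.asIdeal.ResidueField (Set.range fun j => bRed n q (v (f j)))
      ≤ Submodule.span q.asIdeal.ResidueField (Set.range fun j => bRed n q (v j)) := by
    apply Submodule.span_mono
    rintro _ ⟨j, rfl⟩
    exact ⟨f j, rfl⟩
  have := Submodule.finrank_mono h4
  simp only [Set.mem_compl_iff, Set.mem_ofPred_eq, not_le, bRk]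
  simp at *
  omega

theorem b_finite {A : Type*} [CommRing A] [IsNoetherianRing A] {n t : ℕ} (a : A)
    (δ : PrimeSpectrum A → ℕ) (hδ : ∀ p q, q < p → δ p < δ q)
    (v : Fin (t+2) → Fin n → A)
    (hv : ∀ p : PrimeSpectrum A, a ∉ p.asIdeal → min (t+2) (δ p + 1) ≤ bRk v p) :
    {p : PrimeSpectrum A | a ∉ p.asIdeal ∧ bRk v p ≤ t + 1 ∧ bRk v p ≤ δ p + 1}.Finite := by
  have hfin : ∀ k, {p : PrimeSpectrum A | a ∉ p.asIdeal ∧ bRk v p ≤ t + 1 ∧ bRk v p = δ p + 1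
      ∧ δ p + 1 = k}.Finite := by
    intro k
    obtain ⟨I, hI⟩ := (PrimeSpectrum.isClosed_iff_zeroLocus_ideal _).mp (b_closed v k)
    refine Set.Finite.of_finite_image (f := PrimeSpectrum.asIdeal)
      ((I.finite_minimalPrimes_of_isNoetherianRing).subset ?_)
      (fun x _ y _ h => PrimeSpectrum.ext h)
    rintro _ ⟨p, ⟨hap, h1, h2, h3⟩, rfl⟩
    have hmem : ∀ q : PrimeSpectrum A, bRk v q ≤ k ↔ I ≤ q.asIdeal := fun q => by
      have := Set.ext_iff.mp hI q
      simpa using this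
    refine ⟨⟨p.isPrime, (hmem p).mp (by omega)⟩, ?_⟩
    rintro q ⟨hq, hIq⟩ hqp
    have h5 := (hmem ⟨q, hq⟩).mpr hIq
    have h6 := hv ⟨q, hq⟩ (fun h => hap (hqp h))
    by_contra hcon
    have hlt : (⟨q, hq⟩ : PrimeSpectrum A) < p := lt_of_le_not_ge hqp hcon
    have := hδ _ _ hlt
    omega
  refine ((Set.finite_Iic (t+1)).biUnion fun k _ => hfin k).subset ?_
  rintro p ⟨h1, h2, h3⟩
  have := hv p h1
  simp only [Set.mem_iUnion, Set.mem_ofPred_eq]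
  exact ⟨δ p + 1, by simp; omega, h1, h2, by omega, rfl⟩

theorem b_main {A : Type*} [CommRing A] [IsNoetherianRing A] {n : ℕ} (a : A)
    (δ : PrimeSpectrum A → ℕ) (hδ : ∀ p q, q < p → δ p < δ q) (t : ℕ) :
    ∀ (v : Fin (t+1) → Fin n → A),
    (∀ p : PrimeSpectrum A, a ∉ p.asIdeal → min (t+1) (δ p + 1) ≤ bRk v p) →
    ∃ q ∈ Submodule.span A (Set.range fun i : Fin t => v i.succ),
      ∀ p : PrimeSpectrum A, a ∉ p.asIdeal → bRed n p (v 0 + a • q) ≠ 0 := by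
  induction t with
  | zero =>
    intro v hv
    refine ⟨0, Submodule.zero_mem _, fun p hp h0 => ?_⟩
    have h1 := hv p hp
    have : bRk v p = 0 := by
      unfold bRk
      have : (Set.range fun i => bRed n p (v i)) = {0} := by
        rw [smul_zero, add_zero] at h0
        rw [← h0]
        exact Set.range_unique (ι := Fin 1)
      rw [this, Submodule.span_zero_singleton]; exact finrank_bot _ _
    omega
  | succ t ih =>
    intro v hv
    classical
    have hF := b_finite a δ hδ v hv
    have hfl : ∀ p : PrimeSpectrum A, ∃ (l : Fin (t+1) → p.asIdeal.ResidueField)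
        (μ : p.asIdeal.ResidueField), bRk v p ≤ t + 1 → (l ≠ 0 ∧
        ∀ c : Fin (t+1) → p.asIdeal.ResidueField, ∑ i, l i * c i ≠ μ →
        bRed n p (v (Fin.last _)) ∈ Submodule.span p.asIdeal.ResidueField
        (Set.range fun i : Fin (t+1) => bRed n p (v i.castSucc) + c i • bRed n p (v (Fin.last _)))) := by
      intro p
      by_cases h : bRk v p ≤ t + 1
      · have hd : ¬ LinearIndependent p.asIdeal.ResidueField (fun i => bRed n p (v i)) := by
          intro hli
          have := finrank_span_eq_card hli
          unfold bRk at h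
          simp at this
          omega
        obtain ⟨l, μ, h1, h2⟩ := b_field _ hd
        exact ⟨l, μ, fun _ => ⟨h1, h2⟩⟩
      · exact ⟨0, 0, fun h' => absurd h' h⟩
    choose l μ hl using hfl
    let α : Fin (t+1) → A := fun i => if i = 0 then a else 1
    have hα : ∀ p : PrimeSpectrum A, a ∉ p.asIdeal → ∀ i, algebraMap A p.asIdeal.ResidueField (α i) ≠ 0 := by
      intro p hp i
      simp only [α]
      split_ifs
      · rwa [Ne, Ideal.algebraMap_residueField_eq_zero]
      · simp
    obtain ⟨c, hc⟩ := b_avoid δ hδ hF.toFinset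
      (fun p i => l p i * algebraMap A p.asIdeal.ResidueField (α i)) μ (by
        intro p hp h
        obtain ⟨hp1, hp2, hp3⟩ := hF.mem_toFinset.mp hp
        apply (hl p hp2).1
        funext i
        exact (mul_eq_zero.mp (congrFun h i)).resolve_right (hα p hp1 i))
    let u : Fin (t+1) → Fin n → A := fun i => v i.castSucc + (α i * c i) • v (Fin.last _)
    have hu : ∀ p : PrimeSpectrum A, ∀ i, bRed n p (u i) = bRed n p (v i.castSucc) +
        (algebraMap A p.asIdeal.ResidueField (α i) * algebraMap A p.asIdeal.ResidueField (c i)) •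
          bRed n p (v (Fin.last _)) := by
      intro p i
      simp only [u, map_add, map_smul, ← map_mul]
      rw [algebraMap_smul]
    have hsup : ∀ p : PrimeSpectrum A,
        Submodule.span p.asIdeal.ResidueField (Set.range fun i => bRed n p (v i)) ≤
        Submodule.span p.asIdeal.ResidueField (Set.range fun i => bRed n p (u i)) ⊔
        Submodule.span p.asIdeal.ResidueField {bRed n p (v (Fin.last _))} := by
      intro p
      rw [Submodule.span_le]
      rintro _ ⟨i, rfl⟩
      have hy : bRed n p (v (Fin.last _)) ∈
        Submodule.span p.asIdeal.ResidueField (Set.range fun i => bRed n p (u i)) ⊔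
        Submodule.span p.asIdeal.ResidueField {bRed n p (v (Fin.last _))} :=
        Submodule.mem_sup_right (Submodule.mem_span_singleton_self _)
      refine Fin.lastCases hy (fun j => ?_) i
      have h1 : bRed n p (u j) ∈ Submodule.span p.asIdeal.ResidueField (Set.range fun i => bRed n p (u i)) ⊔
        Submodule.span p.asIdeal.ResidueField {bRed n p (v (Fin.last _))} :=
        Submodule.mem_sup_left (Submodule.subset_span ⟨j, rfl⟩)
      have h2 := Submodule.sub_mem _ h1 (Submodule.smul_mem _
        (algebraMap A p.asIdeal.ResidueField (α j) * algebraMap A p.asIdeal.ResidueField (c j)) hy)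
      rw [hu, add_sub_cancel_right] at h2
      exact h2
    obtain ⟨q, hq, hqp⟩ := ih u (by
      intro p hp
      have hvp := hv p hp
      by_cases hpF : bRk v p ≤ t + 1 ∧ bRk v p ≤ δ p + 1
      · have h1 := hc p (hF.mem_toFinset.mpr ⟨hp, hpF⟩)
        have h2 := (hl p hpF.1).2 (fun i => algebraMap A p.asIdeal.ResidueField (α i) *
          algebraMap A p.asIdeal.ResidueField (c i)) (by simpa only [mul_assoc] using h1)
        simp only [← hu] at h2
        have h3 := hsup p
        rw [sup_eq_left.mpr ((Submodule.span_singleton_le_iff_mem _ _).mpr h2)] at h3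
        have : bRk v p ≤ bRk u p := Submodule.finrank_mono h3
        omega
      · have h3 := Submodule.finrank_mono (hsup p)
        have h4 := Submodule.finrank_add_le_finrank_add_finrank
          (Submodule.span p.asIdeal.ResidueField (Set.range fun i => bRed n p (u i)))
          (Submodule.span p.asIdeal.ResidueField {bRed n p (v (Fin.last _))})
        have h5 := finrank_span_le_card (R := p.asIdeal.ResidueField) ({bRed n p (v (Fin.last _))} : Set _)
        simp only [Set.toFinset_singleton, Finset.card_singleton] at h5
        have : bRk v p ≤ bRk u p + 1 := by unfold bRk; omega
        omega)
    have hlast : v (Fin.last (t+1)) ∈ Submodule.span A (Set.range fun i : Fin (t+1) => v i.succ) :=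
      Submodule.subset_span ⟨Fin.last t, by simp⟩
    refine ⟨c 0 • v (Fin.last _) + q, ?_, ?_⟩
    · refine Submodule.add_mem _ (Submodule.smul_mem _ _ hlast) ?_
      refine (Submodule.span_le.mpr ?_) hq
      rintro _ ⟨i, rfl⟩
      refine Submodule.add_mem _ (Submodule.subset_span ⟨i.castSucc, by simp⟩)
        (Submodule.smul_mem _ _ hlast)
    · intro p hp
      have := hqp p hp
      simpa [u, α, smul_add, smul_smul, add_assoc] using this

theorem b_rank {A : Type*} [CommRing A] {P : Type*} [AddCommGroup P] [Module A P]
    [Module.Finite A P] [Module.Projective A P] {n : ℕ}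
    (f : (Fin n → A) →ₗ[A] P) (g : P →ₗ[A] (Fin n → A)) (hf : Function.Surjective f)
    (hfg : f ∘ₗ g = LinearMap.id) (p : PrimeSpectrum A) :
    rankAt A P p ≤ bRk (fun i : Fin n => g (f (Pi.single i 1))) p := by
  change Module.rankAtStalk P p ≤ _
  rw [Module.rankAtStalk_eq]
  let κ := p.asIdeal.ResidueField
  let G : TensorProduct A κ P →ₗ[κ] (Fin n → κ) :=
    (TensorProduct.piScalarRight A κ κ (Fin n)).toLinearMap ∘ₗ g.baseChange κ
  have hG : ∀ (k : κ) (m : P), G (k ⊗ₜ m) = k • bRed n p (g m) := by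
    intro k m
    ext i
    simp [G, bRed, Algebra.smul_def, mul_comm]
    exact Or.inl rfl
  have hinj : Function.Injective G := by
    refine (TensorProduct.piScalarRight A κ κ (Fin n)).injective.comp ?_
    have : (f.baseChange κ) ∘ₗ (g.baseChange κ) = LinearMap.id := by
      rw [← LinearMap.baseChange_comp, hfg, LinearMap.baseChange_id]
    exact Function.LeftInverse.injective (g := f.baseChange κ) fun x => LinearMap.congr_fun this x
  have hr : LinearMap.range G ≤ Submodule.span κ
      (Set.range fun i : Fin n => bRed n p (g (f (Pi.single i 1)))) := by
    rintro _ ⟨x, rfl⟩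
    induction x using TensorProduct.induction_on with
    | zero => rw [map_zero]; exact Submodule.zero_mem _
    | add x y hx hy => rw [map_add]; exact Submodule.add_mem _ hx hy
    | tmul k m =>
      rw [hG]
      refine Submodule.smul_mem _ _ ?_
      obtain ⟨w, rfl⟩ := hf m
      have hw : w = ∑ i, w i • (Pi.single i 1 : Fin n → A) := pi_eq_sum_univ' w
      rw [hw]
      simp only [map_sum, map_smul]
      refine Submodule.sum_mem _ fun i _ => ?_
      rw [← algebraMap_smul κ (w i)]
      exact Submodule.smul_mem _ _ (Submodule.subset_span ⟨i, rfl⟩)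
  have h1 := LinearMap.finrank_range_of_inj hinj
  have h2 := Submodule.finrank_mono hr
  change Module.finrank κ (TensorProduct A κ P) ≤ _
  rw [← h1]
  exact h2

theorem b_key {A : Type*} [CommRing A] [IsNoetherianRing A] (d : ℕ) (hdim : ringKrullDim A = d)
    {P : Type*} [AddCommGroup P] [Module A P] [Module.Finite A P] [Module.Projective A P]
    (r : ℕ) (hrank : ∀ 𝔭 : PrimeSpectrum A, rankAt A P 𝔭 = r) (hr : r > d)
    (a : A) (p : P) (hu : IsUnimodular A (a, p)) :
    ∃ q : P, IsUnimodular A (p + a • q) := by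
  obtain ⟨n, f, g, hf, hg, hfg⟩ := Module.Finite.exists_comp_eq_id_of_projective A P
  have hco : ∀ x : PrimeSpectrum A, Order.coheight x ≤ (d : ℕ∞) := by
    intro x
    have h := Order.coheight_le_krullDim x
    have h2 : Order.krullDim (PrimeSpectrum A) = d := hdim
    rw [h2] at h
    exact_mod_cast h
  have hlt : ∀ x : PrimeSpectrum A, Order.coheight x < ⊤ := fun x =>
    (hco x).trans_lt (ENat.coe_lt_top d)
  let δ : PrimeSpectrum A → ℕ := fun x => (Order.coheight x).toNat
  have hδ' : ∀ x, ((δ x : ℕ) : ℕ∞) = Order.coheight x := fun x => ENat.coe_toNat (hlt x).ne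
  have hδ : ∀ x y, y < x → δ x < δ y := by
    intro x y h
    have := Order.coheight_strictAnti h (hlt x)
    rw [← hδ', ← hδ'] at this
    exact_mod_cast this
  have hδd : ∀ x, δ x ≤ d := by
    intro x
    have := hco x
    rw [← hδ'] at this
    exact_mod_cast this
  let v : Fin (n+1) → Fin n → A := Fin.cons (g p) (fun i => g (f (Pi.single i 1)))
  obtain ⟨Q, hQ, hQ2⟩ := b_main a δ hδ n v (by
    intro x _
    have h1 := b_rank f g hf hfg x
    rw [hrank] at h1
    have h2 : bRk (fun i : Fin n => g (f (Pi.single i 1))) x ≤ bRk v x := by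
      apply Submodule.finrank_mono
      apply Submodule.span_mono
      rintro _ ⟨i, rfl⟩
      exact ⟨i.succ, by simp [v]⟩
    have := hδd x
    omega)
  have hQr : Q ∈ LinearMap.range g := by
    refine (Submodule.span_le.mpr ?_) hQ
    rintro _ ⟨i, rfl⟩
    exact ⟨f (Pi.single i 1), by simp [v]⟩
  obtain ⟨q, rfl⟩ := hQr
  refine ⟨q, ?_⟩
  have hv0 : v 0 + a • g q = g (p + a • q) := by simp [v]
  rw [hv0] at hQ2
  obtain ⟨Ψ, hΨ⟩ := hu
  have htop : Ideal.span (Set.range (g (p + a • q))) = ⊤ := by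
    by_contra hne
    obtain ⟨m, hm, hle⟩ := Ideal.exists_le_maximal _ hne
    have hmem : ∀ i, g (p + a • q) i ∈ m := fun i => hle (Ideal.subset_span ⟨i, rfl⟩)
    by_cases ha : a ∈ m
    · have hfun : Ψ (0, p + a • q) ∈ m := by
        have h1 : p + a • q = f (g (p + a • q)) := (LinearMap.congr_fun hfg (p + a • q)).symm
        have h2 : Ψ (0, p + a • q) = (Ψ ∘ₗ LinearMap.inr A A P ∘ₗ f) (g (p + a • q)) := by
          simp only [LinearMap.comp_apply, LinearMap.inr_apply]
          rw [← h1]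
        rw [h2, pi_eq_sum_univ' (g (p + a • q)), map_sum]
        refine Ideal.sum_mem _ fun i _ => ?_
        rw [map_smul, smul_eq_mul]
        exact Ideal.mul_mem_right _ _ (hmem i)
      apply hm.ne_top
      rw [Ideal.eq_top_iff_one, ← hΨ]
      have h3 : ((a, p) : A × P) = (0, p + a • q) + a • ((1, - q) : A × P) := by
        ext <;> simp
      rw [h3, map_add, map_smul, smul_eq_mul]
      exact Ideal.add_mem _ hfun (Ideal.mul_mem_right _ _ ha)
    · apply hQ2 ⟨m, hm.isPrime⟩ ha
      ext i
      exact Ideal.algebraMap_residueField_eq_zero.mpr (hmem i)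
  have h1 : (1 : A) ∈ Ideal.span (Set.range (g (p + a • q))) := by rw [htop]; trivial
  obtain ⟨c, hc⟩ := Ideal.mem_span_range_iff_exists_fun.mp h1
  refine ⟨(∑ i, c i • LinearMap.proj i : (Fin n → A) →ₗ[A] A) ∘ₗ g, ?_⟩
  rw [← hc]
  simp [LinearMap.sum_apply]

theorem b_trans {R M : Type*} [CommRing R] [AddCommGroup M] [Module R M] (φ : M →ₗ[R] R) (p : M)
    (h : φ p = 0) (hu : IsUnimodular R φ ∨ IsUnimodular R p) :
    ∃ g ∈ transvectionSubgroup R M, ∀ x, g x = x + φ x • p := by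
  let e : M ≃ₗ[R] M := LinearEquiv.ofLinear (LinearMap.id + φ.smulRight p)
    (LinearMap.id - φ.smulRight p) (by ext x; simp [h]) (by ext x; simp [h])
  have he : ∀ x, e x = x + φ x • p := fun x => by simp [e]
  exact ⟨e, Subgroup.subset_closure ⟨φ, p, h, hu, he⟩, he⟩

theorem b_to_one {A : Type*} [CommRing A] [IsNoetherianRing A] (d : ℕ) (hdim : ringKrullDim A = d)
    {P : Type*} [AddCommGroup P] [Module A P] [Module.Finite A P] [Module.Projective A P]
    (r : ℕ) (hrank : ∀ 𝔭 : PrimeSpectrum A, rankAt A P 𝔭 = r) (hr : r > d)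
    (u : A × P) (hu : IsUnimodular A u) :
    ∃ g ∈ transvectionSubgroup A (A × P), g u = (1, 0) := by
  obtain ⟨a, p⟩ := u
  obtain ⟨q, ψ, hψ⟩ := b_key d hdim r hrank hr a p hu
  have hfst : IsUnimodular A (LinearMap.fst A A P) :=
    ⟨LinearMap.applyₗ ((1, 0) : A × P), by simp⟩
  obtain ⟨g1, hg1, h1⟩ := b_trans (LinearMap.fst A A P) (0, q) (by simp) (Or.inl hfst)
  obtain ⟨g2, hg2, h2⟩ := b_trans ((1 - a) • ψ ∘ₗ LinearMap.snd A A P) (1, 0) (by simp)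
    (Or.inr ⟨LinearMap.fst A A P, by simp⟩)
  obtain ⟨g3, hg3, h3⟩ := b_trans (LinearMap.fst A A P) (0, -(p + a • q)) (by simp) (Or.inl hfst)
  refine ⟨g3 * (g2 * g1), mul_mem hg3 (mul_mem hg2 hg1), ?_⟩
  have e1 : g1 (a, p) = (a, p + a • q) := by rw [h1]; simp
  have e2 : g2 (a, p + a • q) = (1, p + a • q) := by
    rw [h2]; simp only [LinearMap.smul_apply, LinearMap.comp_apply, LinearMap.snd_apply, hψ]; simp
  have e3 : g3 (1, p + a • q) = (1, 0) := by rw [h3]; simp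
  rw [LinearEquiv.mul_apply, LinearEquiv.mul_apply, e1, e2, e3]

/-- **Bass' theorem.** Over a commutative Noetherian ring `A` of Krull dimension `d`, for a
finitely generated projective `A`-module `P` of constant rank `> d`, the group `E(A ⊕ P)` of
transvections acts transitively on the unimodular elements of `A ⊕ P`. -/
theorem bass_transitivity
    (A : Type*) [CommRing A] [IsNoetherianRing A] (d : ℕ) (hdim : ringKrullDim A = d)
    (P : Type*) [AddCommGroup P] [Module A P] [Module.Finite A P] [Module.Projective A P]
    (r : ℕ) (hrank : ∀ 𝔭 : PrimeSpectrum A, rankAt A P 𝔭 = r) (hr : r > d)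
    (u v : A × P) (hu : IsUnimodular A u) (hv : IsUnimodular A v) :
    ∃ g ∈ transvectionSubgroup A (A × P), g u = v := by
  obtain ⟨g, hg, h1⟩ := b_to_one d hdim r hrank hr u hu
  obtain ⟨k, hk, h2⟩ := b_to_one d hdim r hrank hr v hv
  refine ⟨k⁻¹ * g, mul_mem (inv_mem hk) hg, ?_⟩
  rw [LinearEquiv.mul_apply, h1, ← h2]
  exact k.symm_apply_apply v
end

section
/- Let A be a commutative Noetherian ring and let J be an ideal of A. Let P be a finitely generated projective A-module of rank n. Then any transvection Θ̃ of P/JP (in particular any element of E(P/JP)) can be lifted to a unipotent automorphism Θ of P. In particular, if P/JP is free of rank n, then any element Ψ̄ of E((A/J)^n) can be lifted to an automorphism Ψ ∈ Aut_A(P). If in addition the natural map Um(P) → Um(P/JP) is surjective, then the natural map E(P) → E(P/JP) is surjective. -/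
section Helpers

variable {A : Type*} [CommRing A] {J : Ideal A} {P : Type*} [AddCommGroup P] [Module A P]

theorem mk_fun_smul (a : A) (x : P) :
    (Submodule.Quotient.mk (a • x) : P ⧸ (J • ⊤ : Submodule A P)) =
      (Ideal.Quotient.mk J a) • (Submodule.Quotient.mk x : P ⧸ (J • ⊤ : Submodule A P)) := rfl

theorem exists_fun_lift [Module.Projective A P]
    (φ : (P ⧸ (J • ⊤ : Submodule A P)) →ₗ[A ⧸ J] A ⧸ J) :
    ∃ f : P →ₗ[A] A, ∀ x, Ideal.Quotient.mk J (f x) = φ (Submodule.Quotient.mk x) := by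
  let g : P →ₗ[A] A ⧸ J :=
    { toFun := fun x => φ (Submodule.Quotient.mk x)
      map_add' := fun x y => by simp
      map_smul' := fun a x => by
        rw [mk_fun_smul, map_smul]; rfl }
  obtain ⟨f, hf⟩ := Module.projective_lifting_property
    (Submodule.mkQ (J : Submodule A A)) g (Submodule.mkQ_surjective _)
  exact ⟨f, fun x => LinearMap.congr_fun hf x⟩

theorem exists_dual_vec {R M : Type*} [CommRing R] [AddCommGroup M] [Module R M]
    [Module.Finite R M] [Module.Projective R M] (φ : M →ₗ[R] R) (h : IsUnimodular R φ) :
    ∃ q, φ q = 1 := by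
  obtain ⟨ev, hev⟩ := h
  obtain ⟨q, hq⟩ := (Module.evalEquiv R M).surjective ev
  refine ⟨q, ?_⟩
  rw [← hev, ← hq]; rfl

instance projQuot [Module.Projective A P] :
    Module.Projective (A ⧸ J) (P ⧸ (J • ⊤ : Submodule A P)) := by
  let e := TensorProduct.quotTensorEquivQuotSMul P J
  let e' : TensorProduct A (A ⧸ J) P ≃ₗ[A ⧸ J] (P ⧸ (J • ⊤ : Submodule A P)) :=
    { e with
      map_smul' := fun r x => by
        obtain ⟨a, rfl⟩ := Ideal.Quotient.mk_surjective r
        exact e.map_smul a x }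
  exact Module.Projective.of_equiv e'

instance finQuot [Module.Finite A P] :
    Module.Finite (A ⧸ J) (P ⧸ (J • ⊤ : Submodule A P)) :=
  Module.Finite.of_restrictScalars_finite A _ _

theorem mk_smul_mem {a : A} (ha : a ∈ J) (x : P) :
    (Submodule.Quotient.mk (a • x) : P ⧸ (J • ⊤ : Submodule A P)) = 0 := by
  rw [mk_fun_smul, Ideal.Quotient.eq_zero_iff_mem.mpr ha, zero_smul]

/-- The automorphism `1 + φ_p`. -/
def tv (φ : P →ₗ[A] A) (p : P) (h : φ p = 0) : P ≃ₗ[A] P :=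
  { (LinearMap.id + φ.smulRight p : P →ₗ[A] P) with
    invFun := fun x => x - φ x • p
    left_inv := fun x => by simp [h]
    right_inv := fun x => by simp [h] }

theorem tv_apply (φ : P →ₗ[A] A) (p : P) (h : φ p = 0) (x : P) :
    tv φ p h x = x + φ x • p := rfl

theorem tv_nil (φ : P →ₗ[A] A) (p : P) (h : φ p = 0) :
    IsNilpotent ((tv φ p h : P →ₗ[A] P) - LinearMap.id) := by
  refine ⟨2, ?_⟩
  ext x
  simp [pow_two, tv_apply, h]

theorem lift_pair [Module.Finite A P] [Module.Projective A P]
    (φ : (P ⧸ (J • ⊤ : Submodule A P)) →ₗ[A ⧸ J] A ⧸ J) (p : P ⧸ (J • ⊤ : Submodule A P))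
    (h0 : φ p = 0) (hu : IsUnimodular (A ⧸ J) φ ∨ IsUnimodular (A ⧸ J) p) :
    ∃ (f : P →ₗ[A] A) (u : P), f u = 0 ∧ Submodule.Quotient.mk u = p ∧
      ∀ x, Ideal.Quotient.mk J (f x) = φ (Submodule.Quotient.mk x) := by
  obtain ⟨f, hf⟩ := exists_fun_lift φ
  obtain ⟨u, rfl⟩ := Submodule.Quotient.mk_surjective _ p
  have ha : f u ∈ J := by rw [← Ideal.Quotient.eq_zero_iff_mem, hf, h0]
  rcases hu with hu | ⟨ψ, hψ⟩
  · obtain ⟨q, hq⟩ := exists_dual_vec φ hu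
    obtain ⟨q, rfl⟩ := Submodule.Quotient.mk_surjective _ q
    have hj : 1 - f q ∈ J := by
      rw [← Ideal.Quotient.eq_zero_iff_mem, map_sub, hf, hq]; simp
    refine ⟨f, u - f u • q - (1 - f q) • u, ?_, ?_, hf⟩
    · simp only [map_sub, map_smul, smul_eq_mul]; ring
    · rw [Submodule.Quotient.mk_sub, Submodule.Quotient.mk_sub, mk_smul_mem ha, mk_smul_mem hj]
      simp
  · obtain ⟨g, hg⟩ := exists_fun_lift ψ
    have hj : 1 - g u ∈ J := by
      rw [← Ideal.Quotient.eq_zero_iff_mem, map_sub, hg, hψ]; simp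
    refine ⟨f - f u • g - (1 - g u) • f, u, ?_, rfl, ?_⟩
    · simp only [LinearMap.sub_apply, LinearMap.smul_apply, smul_eq_mul]; ring
    · intro x
      simp only [LinearMap.sub_apply, LinearMap.smul_apply, smul_eq_mul]
      rw [map_sub, map_sub, map_mul, map_mul, Ideal.Quotient.eq_zero_iff_mem.mpr ha,
        Ideal.Quotient.eq_zero_iff_mem.mpr hj, hf]
      simp

theorem lift_pair_um [Module.Finite A P] [Module.Projective A P]
    (hum : ∀ ubar : P ⧸ (J • ⊤ : Submodule A P), IsUnimodular (A ⧸ J) ubar →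
        ∃ u : P, IsUnimodular A u ∧ Submodule.Quotient.mk u = ubar)
    (φ : (P ⧸ (J • ⊤ : Submodule A P)) →ₗ[A ⧸ J] A ⧸ J) (p : P ⧸ (J • ⊤ : Submodule A P))
    (h0 : φ p = 0) (hu : IsUnimodular (A ⧸ J) φ ∨ IsUnimodular (A ⧸ J) p) :
    ∃ (f : P →ₗ[A] A) (u : P), f u = 0 ∧ (IsUnimodular A f ∨ IsUnimodular A u) ∧
      Submodule.Quotient.mk u = p ∧
      ∀ x, Ideal.Quotient.mk J (f x) = φ (Submodule.Quotient.mk x) := by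
  obtain ⟨f, hf⟩ := exists_fun_lift φ
  rcases hu with hu | hu
  · obtain ⟨q, hq⟩ := exists_dual_vec φ hu
    obtain ⟨Q, ⟨g, hg⟩, rfl⟩ := hum q ⟨φ, hq⟩
    obtain ⟨u, rfl⟩ := Submodule.Quotient.mk_surjective _ p
    have hj : f Q - 1 ∈ J := by
      rw [← Ideal.Quotient.eq_zero_iff_mem, map_sub, hf, hq]; simp
    have hf' : ∀ x, Ideal.Quotient.mk J ((f - (f Q - 1) • g) x) =
        φ (Submodule.Quotient.mk x) := by
      intro x
      simp only [LinearMap.sub_apply, LinearMap.smul_apply, smul_eq_mul]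
      rw [map_sub, map_mul, Ideal.Quotient.eq_zero_iff_mem.mpr hj, hf]
      simp
    have h1 : (f - (f Q - 1) • g) Q = 1 := by simp [hg]
    generalize (f - (f Q - 1) • g) = F at hf' h1
    have ha : F u ∈ J := by rw [← Ideal.Quotient.eq_zero_iff_mem, hf', h0]
    refine ⟨F, u - F u • Q, by simp [h1], Or.inl ⟨LinearMap.applyₗ Q, h1⟩, ?_, hf'⟩
    rw [Submodule.Quotient.mk_sub, mk_smul_mem ha, sub_zero]
  · obtain ⟨u, ⟨g, hg⟩, rfl⟩ := hum p hu
    have ha : f u ∈ J := by rw [← Ideal.Quotient.eq_zero_iff_mem, hf, h0]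
    refine ⟨f - f u • g, u, by simp [hg], Or.inr ⟨g, hg⟩, rfl, ?_⟩
    intro x
    simp only [LinearMap.sub_apply, LinearMap.smul_apply, smul_eq_mul]
    rw [map_sub, map_mul, Ideal.Quotient.eq_zero_iff_mem.mpr ha, hf]
    simp

theorem closure_lift (G : Subgroup (P ≃ₗ[A] P))
    (H : ∀ τ : (P ⧸ (J • ⊤ : Submodule A P)) ≃ₗ[A ⧸ J] (P ⧸ (J • ⊤ : Submodule A P)),
      IsTransvection τ →
      ∃ Θ ∈ G, ∀ x : P, τ (Submodule.Quotient.mk x) = Submodule.Quotient.mk (Θ x))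
    (τ) (hτ : τ ∈ transvectionSubgroup (A ⧸ J) (P ⧸ (J • ⊤ : Submodule A P))) :
    ∃ Θ ∈ G, ∀ x : P, τ (Submodule.Quotient.mk x) = Submodule.Quotient.mk (Θ x) := by
  unfold transvectionSubgroup at hτ
  induction hτ using Subgroup.closure_induction with
  | mem x hx => exact H x hx
  | one => exact ⟨1, G.one_mem, fun x => rfl⟩
  | mul a b _ _ ha hb =>
    obtain ⟨s, hs, hs'⟩ := ha
    obtain ⟨t, ht, ht'⟩ := hb
    refine ⟨s * t, G.mul_mem hs ht, fun x => ?_⟩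
    rw [LinearEquiv.mul_apply, LinearEquiv.mul_apply, ht', hs']
  | inv a _ ha =>
    obtain ⟨s, hs, hs'⟩ := ha
    refine ⟨s⁻¹, G.inv_mem hs, fun x => ?_⟩
    apply a.injective
    rw [hs', ← LinearEquiv.mul_apply, ← LinearEquiv.mul_apply, mul_inv_cancel, mul_inv_cancel]
    rfl

theorem conj_mem {R M N : Type*} [CommRing R] [AddCommGroup M] [Module R M]
    [AddCommGroup N] [Module R N] (e : M ≃ₗ[R] N) (τ) (hτ : τ ∈ transvectionSubgroup R N) :
    (e.trans τ).trans e.symm ∈ transvectionSubgroup R M := by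
  unfold transvectionSubgroup at hτ
  induction hτ using Subgroup.closure_induction with
  | mem x hx =>
    obtain ⟨φ, p, h0, hu, hx⟩ := hx
    refine Subgroup.subset_closure ⟨φ ∘ₗ e.toLinearMap, e.symm p, by simp [h0], ?_, ?_⟩
    · rcases hu with ⟨ψ, hψ⟩ | ⟨ψ, hψ⟩
      · left
        refine ⟨ψ ∘ₗ LinearMap.lcomp R R e.symm.toLinearMap, ?_⟩
        rw [← hψ, LinearMap.comp_apply]
        congr 1
        ext y
        simp
      · exact Or.inr ⟨ψ ∘ₗ e.toLinearMap, by simp [hψ]⟩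
    · intro y
      simp [hx]
  | one =>
    convert (transvectionSubgroup R M).one_mem
    ext y
    simp
  | mul a b _ _ ha hb =>
    convert (transvectionSubgroup R M).mul_mem ha hb
    ext y
    simp
  | inv a _ ha =>
    have h := (transvectionSubgroup R M).inv_mem ha
    exact h

end Helpers

/-- **Bhatwadekar–Roy.** Let `A` be a commutative Noetherian ring, `J` an ideal, `P` a finitely
generated projective `A`-module of rank `n`. Any transvection of `P/JP` lifts to a unipotent
automorphism of `P` (in particular any element of `E(P/JP)` lifts to an automorphism of `P`);
if `P/JP` is free of rank `n`, any element of `E((A/J)ⁿ)` lifts to `Aut(P)`; and, if moreover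
`Um(P) → Um(P/JP)` is surjective, then `E(P) → E(P/JP)` is surjective. -/
theorem bhatwadekar_roy_lifting
    (A : Type*) [CommRing A] [IsNoetherianRing A] (J : Ideal A)
    (P : Type*) [AddCommGroup P] [Module A P] [Module.Finite A P] [Module.Projective A P]
    (n : ℕ) (hrank : ∀ 𝔭 : PrimeSpectrum A, rankAt A P 𝔭 = n) :
    (∀ Θbar : (P ⧸ (J • ⊤ : Submodule A P)) ≃ₗ[A ⧸ J] (P ⧸ (J • ⊤ : Submodule A P)),
       IsTransvection Θbar →
       ∃ Θ : P ≃ₗ[A] P, IsNilpotent ((Θ : P →ₗ[A] P) - LinearMap.id) ∧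
         ∀ x : P, Θbar (Submodule.Quotient.mk x) = Submodule.Quotient.mk (Θ x)) ∧
    (∀ Θbar ∈ transvectionSubgroup (A ⧸ J) (P ⧸ (J • ⊤ : Submodule A P)),
       ∃ Θ : P ≃ₗ[A] P,
         ∀ x : P, Θbar (Submodule.Quotient.mk x) = Submodule.Quotient.mk (Θ x)) ∧
    (∀ e : (P ⧸ (J • ⊤ : Submodule A P)) ≃ₗ[A ⧸ J] (Fin n → A ⧸ J),
      ∀ Ψbar ∈ transvectionSubgroup (A ⧸ J) (Fin n → A ⧸ J),
       ∃ Ψ : P ≃ₗ[A] P,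
         ∀ x : P, Ψbar (e (Submodule.Quotient.mk x)) = e (Submodule.Quotient.mk (Ψ x))) ∧
    ((∀ ubar : P ⧸ (J • ⊤ : Submodule A P), IsUnimodular (A ⧸ J) ubar →
        ∃ u : P, IsUnimodular A u ∧ Submodule.Quotient.mk u = ubar) →
      ∀ Θbar ∈ transvectionSubgroup (A ⧸ J) (P ⧸ (J • ⊤ : Submodule A P)),
       ∃ Θ ∈ transvectionSubgroup A P,
         ∀ x : P, Θbar (Submodule.Quotient.mk x) = Submodule.Quotient.mk (Θ x)) := by
  have key : ∀ Θbar : (P ⧸ (J • ⊤ : Submodule A P)) ≃ₗ[A ⧸ J] (P ⧸ (J • ⊤ : Submodule A P)),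
       IsTransvection Θbar →
       ∃ Θ : P ≃ₗ[A] P, IsNilpotent ((Θ : P →ₗ[A] P) - LinearMap.id) ∧
         ∀ x : P, Θbar (Submodule.Quotient.mk x) = Submodule.Quotient.mk (Θ x) := by
    rintro τ ⟨φ, p, h0, hu, hx⟩
    obtain ⟨f, u, h, rfl, hf⟩ := lift_pair φ p h0 hu
    refine ⟨tv f u h, tv_nil f u h, fun x => ?_⟩
    rw [hx, tv_apply, Submodule.Quotient.mk_add, mk_fun_smul, hf]
  have key2 : ∀ Θbar ∈ transvectionSubgroup (A ⧸ J) (P ⧸ (J • ⊤ : Submodule A P)),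
       ∃ Θ : P ≃ₗ[A] P,
         ∀ x : P, Θbar (Submodule.Quotient.mk x) = Submodule.Quotient.mk (Θ x) := by
    intro τ hτ
    obtain ⟨Θ, -, h⟩ := closure_lift (⊤ : Subgroup (P ≃ₗ[A] P)) (fun σ hσ => by
      obtain ⟨Θ, -, h⟩ := key σ hσ
      exact ⟨Θ, trivial, h⟩) τ hτ
    exact ⟨Θ, h⟩
  refine ⟨key, key2, ?_, ?_⟩
  · intro e τ hτ
    obtain ⟨Θ, h⟩ := key2 _ (conj_mem e τ hτ)
    refine ⟨Θ, fun x => ?_⟩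
    rw [← h x]
    simp
  · intro hum
    refine closure_lift (transvectionSubgroup A P) ?_
    rintro τ ⟨φ, p, h0, hu, hx⟩
    obtain ⟨f, u, h, hu', rfl, hf⟩ := lift_pair_um hum φ p h0 hu
    refine ⟨tv f u h, Subgroup.subset_closure ⟨f, u, h, hu', fun x => rfl⟩, fun x => ?_⟩
    rw [hx, tv_apply, Submodule.Quotient.mk_add, mk_fun_smul, hf]
end

section
/- (Excision, van der Kallen) Let n ≥ 3. Let A be a commutative ring and let I be an ideal of A. Let B = ℤ ⊕ I with the ring structure (m, x)·(m', x') = (mm', mx' + m'x + xx'). Then the canonical maps MSE_n(ℤ ⊕ I, I) → MSE_n(A, I) and MSE_n(ℤ ⊕ I, I) → MSE_n(ℤ ⊕ I) are bijective. -/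
/-- `Um_n(A)`: unimodular rows of length `n` over `A`. -/
def IsUmRow {A : Type*} [CommRing A] {n : ℕ} (v : Fin n → A) : Prop :=
  Ideal.span (Set.range v) = ⊤

/-- `Um_n(A, I)`: unimodular rows `[a₁, …, a_n]` with `1 - a₁ ∈ I` and `a_i ∈ I` for `i ≥ 2`. -/
def IsRelUmRow {A : Type*} [CommRing A] (I : Ideal A) {n : ℕ} [NeZero n] (v : Fin n → A) : Prop :=
  IsUmRow v ∧ 1 - v 0 ∈ I ∧ ∀ i : Fin n, i ≠ 0 → v i ∈ I

/-- `E_n(A)`: the subgroup (here: submonoid, the generating set being closed under inverses) of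
`SL_n(A)` generated by the elementary matrices `E_ij(c)`, `i ≠ j`. -/
def elementarySubmonoid (n : ℕ) (A : Type*) [CommRing A] :
    Submonoid (Matrix (Fin n) (Fin n) A) :=
  Submonoid.closure {E | ∃ (i j : Fin n) (c : A), i ≠ j ∧ E = Matrix.transvection i j c}

/-- `E¹_n(A, I)`: generated by the `E_{1i}(a)`, `a ∈ A`, and the `E_{j1}(x)`, `x ∈ I`
(`0`-based indices). -/
def relElementarySubmonoid1 (n : ℕ) [NeZero n] (A : Type*) [CommRing A] (I : Ideal A) :
    Submonoid (Matrix (Fin n) (Fin n) A) :=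
  Submonoid.closure
    ({E | ∃ (i : Fin n) (a : A), i ≠ 0 ∧ E = Matrix.transvection 0 i a} ∪
     {E | ∃ (j : Fin n) (x : A), j ≠ 0 ∧ x ∈ I ∧ E = Matrix.transvection j 0 x})

/-- Membership in `E_n(A, I) = E¹_n(A, I) ∩ GL_n(A, I)`, where `GL_n(A, I)` is the kernel of
`GL_n(A) → GL_n(A/I)`. -/
def MemRelElementary {A : Type*} [CommRing A] (I : Ideal A) {n : ℕ} [NeZero n]
    (E : Matrix (Fin n) (Fin n) A) : Prop :=
  E ∈ relElementarySubmonoid1 n A I ∧ E.map (Ideal.Quotient.mk I) = 1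

/-- Two rows are in the same orbit for the action of `E_n(A, I)`. -/
def RelERel {A : Type*} [CommRing A] (I : Ideal A) {n : ℕ} [NeZero n] (v w : Fin n → A) : Prop :=
  ∃ E : Matrix (Fin n) (Fin n) A, MemRelElementary I E ∧ w = Matrix.vecMul v E

/-- Two rows are in the same orbit for the action of `E_n(A)`. -/
def AbsERel {A : Type*} [CommRing A] {n : ℕ} (v w : Fin n → A) : Prop :=
  ∃ E ∈ elementarySubmonoid n A, w = Matrix.vecMul v E


open Matrix in
/-- rank one perturbation -/
def vkT {R : Type*} [CommRing R] {n : ℕ} (x : R) (α β : Fin n → R) : Matrix (Fin n) (Fin n) R :=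
  1 + x • Matrix.vecMulVec α β

open Matrix in
theorem vkT_mul {R : Type*} [CommRing R] {n : ℕ} (x y : R) (α β α' β' : Fin n → R)
    (h : β ⬝ᵥ α' = 0) : vkT x α β * vkT y α' β' =
      1 + (x • Matrix.vecMulVec α β + y • Matrix.vecMulVec α' β') := by
  simp only [vkT, add_mul, mul_add, one_mul, mul_one, smul_mul_assoc, mul_smul_comm,
    Matrix.vecMulVec_mul_vecMulVec, h]
  simp
  abel

open Matrix in
theorem vkT_add_left {R : Type*} [CommRing R] {n : ℕ} (x : R) (α α' β : Fin n → R)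
    (h : β ⬝ᵥ α' = 0) : vkT x (α + α') β = vkT x α β * vkT x α' β := by
  rw [vkT_mul _ _ _ _ _ _ h, vkT, Matrix.add_vecMulVec, smul_add]

open Matrix in
theorem vkT_add_right {R : Type*} [CommRing R] {n : ℕ} (x : R) (α β β' : Fin n → R)
    (h : β ⬝ᵥ α = 0) : vkT x α (β + β') = vkT x α β * vkT x α β' := by
  rw [vkT_mul _ _ _ _ _ _ h, vkT, Matrix.vecMulVec_add, smul_add]

theorem vk_transvection {R : Type*} [CommRing R] {n : ℕ} (i j : Fin n) (c : R) :
    Matrix.transvection i j c = vkT c (Pi.single i 1) (Pi.single j 1) := by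
  ext a b
  simp [Matrix.transvection, vkT, Matrix.vecMulVec_apply, Matrix.single_apply, Pi.single_apply]
  grind

open Matrix in
/-- row of elementary matrices -/
theorem vkT_row_mem {R : Type*} [CommRing R] {n : ℕ} (k : Fin n) (x : R)
    (C : Submonoid (Matrix (Fin n) (Fin n) R))
    (β : Fin n → R) (hk : β k = 0)
    (hC : ∀ j, j ≠ k → Matrix.transvection k j (x * β j) ∈ C) :
    vkT x (Pi.single k 1) β ∈ C := by
  have key : ∀ s : Finset (Fin n), k ∉ s →
      vkT x (Pi.single k 1) (∑ j ∈ s, Pi.single j (β j)) ∈ C := by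
    intro s
    induction s using Finset.induction_on with
    | empty => intro _; simp [vkT, Matrix.vecMulVec_zero, C.one_mem]
    | insert a s ha ih =>
      intro hks
      rw [Finset.sum_insert ha, vkT_add_right]
      · refine C.mul_mem ?_ (ih (by grind))
        have := hC a (by grind)
        rw [vk_transvection] at this
        convert this using 1
        ext p q
        simp [vkT, Matrix.vecMulVec_apply, Pi.single_apply]
      · simp; grind
  have := key (Finset.univ.erase k) (by simp)
  convert this using 2
  rw [← Finset.univ_sum_single β, ← Finset.add_sum_erase _ _ (Finset.mem_univ k)]
  simp [hk]

open Matrix in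
theorem vkT_col_mem {R : Type*} [CommRing R] {n : ℕ} (k : Fin n) (x : R)
    (C : Submonoid (Matrix (Fin n) (Fin n) R))
    (α : Fin n → R) (hk : α k = 0)
    (hC : ∀ j, j ≠ k → Matrix.transvection j k (x * α j) ∈ C) :
    vkT x α (Pi.single k 1) ∈ C := by
  have key : ∀ s : Finset (Fin n), k ∉ s →
      vkT x (∑ j ∈ s, Pi.single j (α j)) (Pi.single k 1) ∈ C := by
    intro s
    induction s using Finset.induction_on with
    | empty => intro _; simp [vkT, Matrix.zero_vecMulVec, C.one_mem]
    | insert a s ha ih =>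
      intro hks
      rw [Finset.sum_insert ha, vkT_add_left]
      · refine C.mul_mem ?_ (ih (by grind))
        have := hC a (by grind)
        rw [vk_transvection] at this
        convert this using 1
        ext p q
        simp [vkT, Matrix.vecMulVec_apply, Pi.single_apply]
      · simp [Finset.sum_apply, Pi.single_apply]; grind
  have := key (Finset.univ.erase k) (by simp)
  convert this using 2
  rw [← Finset.univ_sum_single α, ← Finset.add_sum_erase _ _ (Finset.mem_univ k)]
  simp [hk]

section
variable {R : Type*} [CommRing R] {n : ℕ} [NeZero n] (I : Ideal R)

open Matrix in
theorem vkT_M1 (x : R) (β : Fin n → R) (h0 : β 0 = 0) :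
    vkT x (Pi.single 0 1) β ∈ relElementarySubmonoid1 n R I := by
  apply vkT_row_mem _ _ _ _ h0
  intro j hj
  exact Submonoid.subset_closure (Or.inl ⟨j, _, hj, rfl⟩)

open Matrix in
theorem vkT_M2 (x : R) (hx : x ∈ I) (α : Fin n → R) (h0 : α 0 = 0) :
    vkT x α (Pi.single 0 1) ∈ relElementarySubmonoid1 n R I := by
  apply vkT_col_mem _ _ _ _ h0
  intro j hj
  exact Submonoid.subset_closure (Or.inr ⟨j, _, hj, I.mul_mem_right _ hx, rfl⟩)

open Matrix in
theorem vkT_M3 (x : R) (hx : x ∈ I) (α β : Fin n → R) (hβ : β 0 = 1) (h : β ⬝ᵥ α = 0) :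
    vkT x α β ∈ relElementarySubmonoid1 n R I := by
  set b : Fin n → R := β - Pi.single 0 1 with hb
  set a : Fin n → R := α - Pi.single 0 (α 0) with ha
  have hb0 : b 0 = 0 := by simp [hb, hβ]
  have ha0 : a 0 = 0 := by simp [ha]
  have hba : b ⬝ᵥ a = - α 0 := by
    have : b ⬝ᵥ a = β ⬝ᵥ α - β ⬝ᵥ Pi.single 0 (α 0) - Pi.single 0 1 ⬝ᵥ a := by
      rw [hb, ha]; simp only [sub_dotProduct, dotProduct_sub]; ring
    rw [this, h]; simp [hβ, ha0]
  have e : vkT x α β = vkT (-1) (Pi.single 0 1) b * vkT x a (Pi.single 0 1) *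
      vkT 1 (Pi.single 0 1) b := by
    have h1 : α = a + α 0 • Pi.single 0 1 := by
      rw [ha]; ext i; simp [Pi.single_apply]
    have h2 : β = b + Pi.single 0 1 := by simp [hb]
    have h3 : vkT x α β = 1 + x • (vecMulVec a b + vecMulVec a (Pi.single 0 1) +
       α 0 • vecMulVec (Pi.single 0 1) b + α 0 • vecMulVec (Pi.single 0 1) (Pi.single 0 1)) := by
      rw [vkT, h2]
      conv_lhs => rw [h1]
      simp only [add_vecMulVec, vecMulVec_add, smul_vecMulVec, smul_add]
      congr 1; abel
    rw [h3]
    simp only [vkT, add_mul, mul_add, one_mul, mul_one, smul_mul_assoc, mul_smul_comm,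
      Matrix.vecMulVec_mul_vecMulVec, hba]
    simp [hb0, vecMulVec_smul]
    module
  rw [e]
  exact mul_mem (mul_mem (vkT_M1 I _ _ hb0) (vkT_M2 I _ hx _ ha0)) (vkT_M1 I _ _ hb0)

open Matrix in
theorem vkT_M4 (x : R) (hx : x ∈ I) (α β : Fin n → R) (hβ : β 0 = 0) (hα : α 0 = 0)
    (h : β ⬝ᵥ α = 0) :
    vkT x α β ∈ relElementarySubmonoid1 n R I := by
  have : vkT x α β = vkT x α (β + Pi.single 0 1) * vkT (-x) α (Pi.single 0 1) := by
    rw [vkT_mul _ _ _ _ _ _ (by simp [add_dotProduct, h, hα]), vkT, vecMulVec_add]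
    module
  rw [this]
  exact mul_mem (vkT_M3 I _ hx _ _ (by simp [hβ]) (by simp [add_dotProduct, h, hα]))
    (vkT_M2 I _ (neg_mem hx) _ hα)

open Matrix in
theorem vkT_M5 (x : R) (hx : x ∈ I) (α β : Fin n → R) (hβ : β 0 = 0)
    (h : β ⬝ᵥ α = 0) :
    vkT x α β ∈ relElementarySubmonoid1 n R I := by
  have h1 : α = (α - α 0 • Pi.single 0 1) + α 0 • Pi.single 0 1 := by abel
  rw [h1, vkT_add_left _ _ _ _ (by simp [hβ])]
  refine mul_mem (vkT_M4 I _ hx _ _ hβ (by simp) (by simp [dotProduct_sub, h, hβ])) ?_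
  have : vkT x (α 0 • Pi.single 0 1) β = vkT (x * α 0) (Pi.single 0 1) β := by
    simp only [vkT, smul_vecMulVec, smul_smul]
  rw [this]
  exact vkT_M1 I _ _ hβ

open Matrix in
theorem vkT_M6 (x : R) (hx : x ∈ I) (α β γ : Fin n → R) (hγ : γ 0 = 1) (hγα : γ ⬝ᵥ α = 0)
    (h : β ⬝ᵥ α = 0) :
    vkT x α β ∈ relElementarySubmonoid1 n R I := by
  have h1 : vkT x α β = vkT (x * β 0) α γ * vkT x α (β - β 0 • γ) := by
    rw [vkT_mul _ _ _ _ _ _ hγα, vkT, sub_eq_add_neg, vecMulVec_add, vecMulVec_neg, vecMulVec_smul]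
    module
  rw [h1]
  exact mul_mem (vkT_M3 I _ (I.mul_mem_right _ hx) _ _ hγ hγα)
    (vkT_M5 I _ hx _ _ (by simp [hγ]) (by simp [sub_dotProduct, h, hγα]))

open Matrix in
theorem vkT_M7 (x : R) (hx : x ∈ I) (α β : Fin n → R) (k : Fin n) (hk : k ≠ 0) (hβ : β k = 0)
    (h : β ⬝ᵥ α = 0) :
    vkT x α β ∈ relElementarySubmonoid1 n R I := by
  have h1 : α = (α + (1 - α k) • Pi.single k 1) + (α k - 1) • Pi.single k 1 := by module
  rw [h1, vkT_add_left _ _ _ _ (by simp [hβ])]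
  refine mul_mem (vkT_M6 I _ hx _ _ (Pi.single 0 1 - α 0 • Pi.single k 1) ?_ ?_ ?_)
     (vkT_M6 I _ hx _ _ (Pi.single 0 1) ?_ ?_ ?_)
  · simp [hk.symm]
  · simp [sub_dotProduct, hk]; ring
  · simp [h, hβ]
  · simp
  · simp [hk.symm]
  · simp [hβ]

open Matrix in
theorem vkT_M8 (hn : 3 ≤ n) (x : R) (hx : x ∈ I) (β : Fin n → R) (i j : Fin n) :
    vkT x (β i • Pi.single j 1 - β j • Pi.single i 1) β ∈ relElementarySubmonoid1 n R I := by
  by_cases hij : i ≠ 0 ∧ j ≠ 0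
  · refine vkT_M6 I _ hx _ _ (Pi.single 0 1) (by simp) ?_ ?_
    · simp [dotProduct_sub, hij.1, hij.2]
    · simp [dotProduct_sub, mul_comm]
  · obtain ⟨k, hk0, hki, hkj⟩ : ∃ k : Fin n, k ≠ 0 ∧ k ≠ i ∧ k ≠ j := by
      have : ({0, i, j} : Finset (Fin n)).card < Fintype.card (Fin n) := by
        have : ({0, i, j} : Finset (Fin n)).card ≤ 2 := by
          by_cases hi : i = 0
          · subst hi; simp; exact Finset.card_le_two
          · have : j = 0 := by tauto
            subst this
            rw [Finset.insert_comm]; simp; exact Finset.card_le_two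
        simp; omega
      obtain ⟨k, hk⟩ := Finset.exists_mem_notMem_of_card_lt_card
        (s := {0, i, j}) (t := Finset.univ) (by simpa using this)
      refine ⟨k, ?_⟩
      simpa using hk
    have h1 : β = (β - β k • Pi.single k 1) + β k • Pi.single k 1 := by abel
    have h2 : (β i • Pi.single j 1 - β j • Pi.single i 1 : Fin n → R) k = 0 := by
      simp [hki, hkj]
    have h3 : β ⬝ᵥ (β i • Pi.single j 1 - β j • Pi.single i 1) = 0 := by
      simp [dotProduct_sub, mul_comm]
    have h4 : Pi.single k 1 ⬝ᵥ (β i • Pi.single j 1 - β j • Pi.single i 1) = 0 := by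
      rw [single_dotProduct, h2, mul_zero]
    generalize (β i • Pi.single j 1 - β j • Pi.single i 1 : Fin n → R) = α at *
    have h5 : (β - β k • Pi.single k 1) ⬝ᵥ α = 0 := by
      rw [sub_dotProduct, smul_dotProduct, h3, h4]; simp
    rw [h1, vkT_add_right _ _ _ _ h5]
    refine mul_mem (vkT_M7 I _ hx _ _ k hk0 (by simp) h5)
      (vkT_M5 I _ hx _ _ (by simp [hk0.symm]) ?_)
    rw [smul_dotProduct, h4]; simp

open Matrix in
theorem vkT_mem (hn : 3 ≤ n) (α β c : Fin n → R) (hα : ∀ i, α i ∈ I) (hβ : β ⬝ᵥ c = 1)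
    (h : β ⬝ᵥ α = 0) : vkT 1 α β ∈ relElementarySubmonoid1 n R I := by
  have h3 : ∀ i j, β ⬝ᵥ (β i • Pi.single j 1 - β j • Pi.single i 1) = 0 := by
    intro i j
    simp [dotProduct_sub, mul_comm]
  have key : ∀ s : Finset (Fin n × Fin n),
      vkT 1 (∑ p ∈ s, (c p.1 * α p.2) • (β p.1 • Pi.single p.2 1 - β p.2 • Pi.single p.1 1)) β
        ∈ relElementarySubmonoid1 n R I := by
    intro s
    induction s using Finset.induction_on with
    | empty => simp [vkT, zero_vecMulVec]
    | insert p s hp ih =>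
      rw [Finset.sum_insert hp, vkT_add_left]
      · refine mul_mem ?_ ih
        have := vkT_M8 I hn (c p.1 * α p.2) (I.mul_mem_left _ (hα _)) β p.1 p.2
        convert this using 1
        simp only [vkT, smul_vecMulVec, one_smul]
      · rw [dotProduct_sum]
        apply Finset.sum_eq_zero
        intro q _
        rw [dotProduct_smul, h3, smul_zero]
  have := key Finset.univ
  convert this using 2
  ext k
  rw [Finset.sum_apply, Fintype.sum_prod_type]
  simp only [Pi.smul_apply, Pi.sub_apply, smul_eq_mul, mul_sub, Finset.sum_sub_distrib]
  have e1 : ∑ i, ∑ j, c i * α j * (β i * (Pi.single j 1 : Fin n → R) k) = (β ⬝ᵥ c) * α k := by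
    rw [dotProduct, Finset.sum_mul]
    refine Finset.sum_congr rfl fun i _ => ?_
    simp [Pi.single_apply]; ring
  have e2 : ∑ i, ∑ j, c i * α j * (β j * (Pi.single i 1 : Fin n → R) k) = c k * (β ⬝ᵥ α) := by
    rw [Finset.sum_comm, dotProduct, Finset.mul_sum]
    refine Finset.sum_congr rfl fun i _ => ?_
    simp [Pi.single_apply]; ring
  rw [e1, e2, h, hβ]; simp
end

section
variable {R : Type*} [CommRing R] {n : ℕ}

open Matrix in
theorem vk_vecMul_transvection (v : Fin n → R) (i j : Fin n) (c : R) :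
    v ᵥ* Matrix.transvection i j c = v + Pi.single j (c * v i) := by
  rw [vk_transvection, vkT, vecMul_add, vecMul_one, vecMul_smul, vecMul_vecMulVec]
  congr 1
  ext k
  simp [Pi.single_apply]

/-- the normal subgroup -/
def vkN (I : Ideal R) (n : ℕ) : Submonoid (Matrix (Fin n) (Fin n) R) :=
  Submonoid.closure {M | ∃ α β c : Fin n → R, (∀ i, α i ∈ I) ∧ β ⬝ᵥ c = 1 ∧ β ⬝ᵥ α = 0 ∧
    M = vkT 1 α β}

theorem vkN_le [NeZero n] (I : Ideal R) (hn : 3 ≤ n) :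
    vkN I n ≤ relElementarySubmonoid1 n R I := by
  rw [vkN, Submonoid.closure_le]
  rintro M ⟨α, β, c, hα, hβ, h, rfl⟩
  exact vkT_mem I hn α β c hα hβ h

theorem vkN_map (I : Ideal R) (M : Matrix (Fin n) (Fin n) R) (hM : M ∈ vkN I n) :
    M.map (Ideal.Quotient.mk I) = 1 := by
  suffices vkN I n ≤ MonoidHom.mker (RingHom.mapMatrix (m := Fin n) (Ideal.Quotient.mk I)).toMonoidHom from
    this hM
  rw [vkN, Submonoid.closure_le]
  rintro M ⟨α, β, c, hα, hβ, h, rfl⟩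
  simp only [SetLike.mem_coe, MonoidHom.mem_mker]
  ext i j
  have := Ideal.Quotient.eq_zero_iff_mem.2 (hα i)
  simp [vkT, Matrix.vecMulVec_apply, this, Matrix.one_apply, apply_ite]
  split_ifs <;> simp_all

open Matrix in
theorem vkN_conj (I : Ideal R) (g g' : Matrix (Fin n) (Fin n) R) (h1 : g * g' = 1) (h2 : g' * g = 1)
    (M : Matrix (Fin n) (Fin n) R) (hM : M ∈ vkN I n) : g' * M * g ∈ vkN I n := by
  induction hM using Submonoid.closure_induction with
  | mem M h =>
    obtain ⟨α, β, c, hα, hβ, h, rfl⟩ := h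
    apply Submonoid.subset_closure
    refine ⟨g' *ᵥ α, β ᵥ* g, g' *ᵥ c, ?_, ?_, ?_, ?_⟩
    · intro i
      simp only [mulVec, dotProduct]
      exact I.sum_mem fun j _ => I.mul_mem_left _ (hα j)
    · rw [← dotProduct_mulVec, mulVec_mulVec, h1, one_mulVec, hβ]
    · rw [← dotProduct_mulVec, mulVec_mulVec, h1, one_mulVec, h]
    · simp only [vkT, one_smul, mul_add, add_mul, mul_one, h2, mul_vecMulVec, vecMulVec_mul]
  | one => simp [h2, one_mem]
  | mul x y _ _ hx hy =>
    have : g' * (x * y) * g = (g' * x * g) * (g' * y * g) := by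
      calc g' * (x * y) * g = g' * x * 1 * y * g := by simp [mul_assoc]
        _ = _ := by rw [← h1]; simp only [mul_assoc]
    rw [this]; exact mul_mem hx hy

theorem vkN_transvection (I : Ideal R) (i j : Fin n) (hij : i ≠ j) (x : R) (hx : x ∈ I) :
    Matrix.transvection i j x ∈ vkN I n := by
  apply Submonoid.subset_closure
  refine ⟨Pi.single i x, Pi.single j 1, Pi.single j 1, ?_, by simp, by simp [hij], ?_⟩
  · intro k
    by_cases h : k = i
    · subst h; simpa using hx
    · simp [h]
  · rw [vk_transvection]
    ext a b
    simp [vkT, Matrix.vecMulVec_apply, Pi.single_apply]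

open Matrix in
def vkNRel (I : Ideal R) (v w : Fin n → R) : Prop := ∃ M ∈ vkN I n, w = v ᵥ* M

open Matrix in
theorem vkNRel.trans {I : Ideal R} {u v w : Fin n → R} (h : vkNRel I u v) (h' : vkNRel I v w) :
    vkNRel I u w := by
  obtain ⟨M, hM, rfl⟩ := h
  obtain ⟨N, hN, rfl⟩ := h'
  exact ⟨M * N, mul_mem hM hN, by simp⟩

open Matrix in
theorem vkNRel.conj {I : Ideal R} {v w : Fin n → R} (h : vkNRel I v w)
    (g g' : Matrix (Fin n) (Fin n) R) (h1 : g * g' = 1) (h2 : g' * g = 1) :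
    vkNRel I (v ᵥ* g) (w ᵥ* g) := by
  obtain ⟨M, hM, rfl⟩ := h
  refine ⟨g' * M * g, vkN_conj I g g' h1 h2 M hM, ?_⟩
  simp [← mul_assoc, h1]

theorem vkNRel.toRel [NeZero n] {I : Ideal R} (hn : 3 ≤ n) {v w : Fin n → R} (h : vkNRel I v w) :
    RelERel I v w := by
  obtain ⟨M, hM, rfl⟩ := h
  exact ⟨M, ⟨vkN_le I hn hM, vkN_map I M hM⟩, rfl⟩

/-- the relative condition without unimodularity -/
def vkRel [NeZero n] (I : Ideal R) (v : Fin n → R) : Prop := 1 - v 0 ∈ I ∧ ∀ i, i ≠ 0 → v i ∈ I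

open Matrix in
theorem vk_rel_iff [NeZero n] (I : Ideal R) (v : Fin n → R) :
    vkRel I v ↔ (fun i => Ideal.Quotient.mk I (v i)) = Pi.single 0 1 := by
  constructor
  · intro h
    ext i
    by_cases hi : i = 0
    · subst hi
      simp only [Pi.single_eq_same]
      rw [← map_one (Ideal.Quotient.mk I), eq_comm, Ideal.Quotient.eq]
      exact h.1
    · rw [Pi.single_eq_of_ne hi]
      exact Ideal.Quotient.eq_zero_iff_mem.2 (h.2 i hi)
  · intro h
    constructor
    · have := congrFun h 0
      simp only [Pi.single_eq_same] at this
      rwa [← map_one (Ideal.Quotient.mk I), eq_comm, Ideal.Quotient.eq] at this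
    · intro i hi
      have := congrFun h i
      rw [Pi.single_eq_of_ne hi] at this
      exact Ideal.Quotient.eq_zero_iff_mem.1 this

open Matrix in
theorem vk_map_vecMul {S : Type*} [CommRing S] (f : R →+* S) (v : Fin n → R)
    (M : Matrix (Fin n) (Fin n) R) :
    (fun i => f ((v ᵥ* M) i)) = (fun i => f (v i)) ᵥ* M.map f := by
  ext i
  simp [Matrix.vecMul, dotProduct]

open Matrix in
theorem vkNRel.rel [NeZero n] {I : Ideal R} {v w : Fin n → R} (h : vkNRel I v w)
    (hv : vkRel I v) : vkRel I w := by
  obtain ⟨M, hM, rfl⟩ := h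
  rw [vk_rel_iff] at *
  rw [vk_map_vecMul, hv, vkN_map I M hM, vecMul_one]

theorem vk_trans_mul_neg (i j : Fin n) (h : i ≠ j) (c : R) :
    Matrix.transvection i j c * Matrix.transvection i j (-c) = 1 := by
  simp [Matrix.transvection_mul_transvection_same, h]

theorem vk_trans_neg_mul (i j : Fin n) (h : i ≠ j) (c : R) :
    Matrix.transvection i j (-c) * Matrix.transvection i j c = 1 := by
  simp [Matrix.transvection_mul_transvection_same, h]

theorem vkRel.transvection [NeZero n] {I : Ideal R} {v : Fin n → R} (hv : vkRel I v) (i j : Fin n)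
    (hi : i ≠ 0) (b : R) : vkRel I (Matrix.vecMul v (Matrix.transvection i j b)) := by
  rw [vk_vecMul_transvection]
  constructor
  · by_cases h : j = 0
    · subst h
      have : 1 - (v + Pi.single 0 (b * v i) : Fin n → R) 0 = (1 - v 0) - b * v i := by simp; ring
      rw [this]
      exact I.sub_mem hv.1 (I.mul_mem_left _ (hv.2 i hi))
    · simpa [Ne.symm h] using hv.1
  · intro k hk
    by_cases h : k = j
    · subst h; simpa using I.add_mem (hv.2 k hk) (I.mul_mem_left _ (hv.2 i hi))
    · simpa [h] using hv.2 k hk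

open Matrix in
theorem vk_orbit1 [NeZero n] {I : Ideal R} {v : Fin n → R} (hv : vkRel I v) (i j : Fin n)
    (hi : i ≠ 0) (hj : j ≠ 0) (hij : i ≠ j) (b : R) : vkNRel I v (v ᵥ* Matrix.transvection i j b) := by
  refine ⟨transvection 0 j (b * v i) * transvection i j (b * (1 - v 0)), mul_mem
    (vkN_transvection I _ _ (Ne.symm hj) _ (I.mul_mem_left _ (hv.2 i hi)))
    (vkN_transvection I _ _ hij _ (I.mul_mem_left _ hv.1)), ?_⟩
  rw [← vecMul_vecMul, vk_vecMul_transvection, vk_vecMul_transvection, vk_vecMul_transvection]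
  ext k
  by_cases h : k = j
  · subst h; simp [hij]; ring
  · simp [h]

open Matrix in
theorem vk_orbit2 [NeZero n] (hn : 3 ≤ n) {I : Ideal R} {v : Fin n → R} (hv : vkRel I v) (i : Fin n)
    (hi : i ≠ 0) (b : R) : vkNRel I v (v ᵥ* Matrix.transvection i 0 b) := by
  obtain ⟨k, hk0, hki⟩ : ∃ k : Fin n, k ≠ 0 ∧ k ≠ i := by
    obtain ⟨k, hk⟩ := Finset.exists_mem_notMem_of_card_lt_card
      (s := {0, i}) (t := (Finset.univ : Finset (Fin n))) (by
        have : ({0, i} : Finset (Fin n)).card ≤ 2 := Finset.card_le_two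
        simp; omega)
    exact ⟨k, by simpa using hk⟩
  have a1 := vk_trans_mul_neg k 0 hk0 (1 : R)
  have a2 := vk_trans_neg_mul k 0 hk0 (1 : R)
  have b1 := vk_trans_mul_neg i k (Ne.symm hki) b
  have b2 := vk_trans_neg_mul i k (Ne.symm hki) b
  have c1 := vkNRel.conj (vk_orbit1 hv i k hi hk0 (Ne.symm hki) b)
    (transvection k 0 1 * transvection i k (-b) * transvection k 0 (-1))
    (transvection k 0 1 * transvection i k b * transvection k 0 (-1)) (by
      calc _ = transvection k 0 1 * transvection i k (-b) * (transvection k 0 (-1) * transvection k 0 1)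
             * transvection i k b * transvection k 0 (-1) := by simp only [mul_assoc]
        _ = transvection k 0 1 * (transvection i k (-b) * transvection i k b) * transvection k 0 (-1) := by
          rw [a2, mul_one]; simp only [mul_assoc]
        _ = 1 := by rw [b2, mul_one, a1]) (by
      calc _ = transvection k 0 1 * transvection i k b * (transvection k 0 (-1) * transvection k 0 1)
             * transvection i k (-b) * transvection k 0 (-1) := by simp only [mul_assoc]
        _ = transvection k 0 1 * (transvection i k b * transvection i k (-b)) * transvection k 0 (-1) := by
          rw [a2, mul_one]; simp only [mul_assoc]
        _ = 1 := by rw [b1, mul_one, a1])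
  have c2 := vkNRel.conj (vk_orbit1 (hv.transvection k 0 hk0 1) i k hi hk0 (Ne.symm hki) (-b))
    _ _ a2 a1
  rw [vecMul_vecMul, a1, vecMul_one, vecMul_vecMul, vecMul_vecMul] at c2
  have c3 := c2.trans (by simpa only [mul_assoc] using c1)
  convert c3 using 1
  simp only [← vecMul_vecMul, vk_vecMul_transvection]
  ext l
  by_cases h : l = 0
  · subst h; simp [hi, hk0, Ne.symm hki, Ne.symm hk0]; ring
  · by_cases h' : l = k
    · subst h'; simp [hi, hk0, Ne.symm hki]
    · simp [h, h']

/-- submonoids generated by some transvections -/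
def vkC (R : Type*) [CommRing R] (n : ℕ) (P : Fin n → Prop) : Submonoid (Matrix (Fin n) (Fin n) R) :=
  Submonoid.closure {E | ∃ (i j : Fin n) (c : R), i ≠ j ∧ P i ∧ E = Matrix.transvection i j c}

open Matrix in
theorem vk_orbit [NeZero n] (hn : 3 ≤ n) {I : Ideal R} (M : Matrix (Fin n) (Fin n) R)
    (hM : M ∈ vkC R n (fun i => i ≠ 0)) :
    ∀ v : Fin n → R, vkRel I v → vkNRel I v (v ᵥ* M) := by
  induction hM using Submonoid.closure_induction with
  | mem M h =>
    obtain ⟨i, j, c, hij, hi, rfl⟩ := h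
    intro v hv
    by_cases h : j = 0
    · subst h; exact vk_orbit2 hn hv i hi c
    · exact vk_orbit1 hv i j hi h hij c
  | one => intro v hv; exact ⟨1, one_mem _, rfl⟩
  | mul x y _ _ hx hy =>
    intro v hv
    rw [← vecMul_vecMul]
    have := hx v hv
    exact this.trans (hy _ (this.rel hv))
end

section
variable {R : Type*} [CommRing R] {n : ℕ}

theorem vkC_inv (P : Fin n → Prop) (M : Matrix (Fin n) (Fin n) R) (hM : M ∈ vkC R n P) :
    ∃ M' ∈ vkC R n P, M * M' = 1 ∧ M' * M = 1 := by
  induction hM using Submonoid.closure_induction with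
  | mem M h =>
    obtain ⟨i, j, c, hij, hi, rfl⟩ := h
    exact ⟨_, Submonoid.subset_closure ⟨i, j, -c, hij, hi, rfl⟩, vk_trans_mul_neg i j hij c,
      vk_trans_neg_mul i j hij c⟩
  | one => exact ⟨1, one_mem _, by simp, by simp⟩
  | mul x y _ _ hx hy =>
    obtain ⟨x', hx', h1, h2⟩ := hx
    obtain ⟨y', hy', h3, h4⟩ := hy
    refine ⟨y' * x', mul_mem hy' hx', ?_, ?_⟩
    · calc _ = x * (y * y') * x' := by simp only [mul_assoc]
        _ = 1 := by rw [h3, mul_one, h1]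
    · calc _ = y' * (x' * x) * y := by simp only [mul_assoc]
        _ = 1 := by rw [h2, mul_one, h4]

theorem vkC_det (P : Fin n → Prop) (M : Matrix (Fin n) (Fin n) R) (hM : M ∈ vkC R n P) :
    M.det = 1 := by
  induction hM using Submonoid.closure_induction with
  | mem M h =>
    obtain ⟨i, j, c, hij, hi, rfl⟩ := h
    exact Matrix.det_transvection_of_ne i j hij c
  | one => simp
  | mul x y _ _ hx hy => simp [hx, hy]

open Matrix in
theorem vkC_row (P : Fin n → Prop) (M : Matrix (Fin n) (Fin n) R) (hM : M ∈ vkC R n P) (i : Fin n)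
    (hi : ¬ P i) : Pi.single i 1 ᵥ* M = Pi.single i 1 := by
  induction hM using Submonoid.closure_induction with
  | mem M h =>
    obtain ⟨k, j, c, hij, hk, rfl⟩ := h
    rw [vk_vecMul_transvection]
    have : k ≠ i := by rintro rfl; exact hi hk
    simp [this]
  | one => simp
  | mul x y _ _ hx hy => rw [← vecMul_vecMul, hx, hy]

theorem vkC_mono {P Q : Fin n → Prop} (h : ∀ i, P i → Q i) : vkC R n P ≤ vkC R n Q := by
  apply Submonoid.closure_mono
  rintro E ⟨i, j, c, hij, hi, rfl⟩
  exact ⟨i, j, c, hij, h i hi, rfl⟩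

theorem vkC_top : vkC R n (fun _ => True) = elementarySubmonoid n R := by
  simp [vkC, elementarySubmonoid]

open Matrix in
def vkCRel (P : Fin n → Prop) (v w : Fin n → R) : Prop := ∃ M ∈ vkC R n P, w = v ᵥ* M

open Matrix in
theorem vkCRel.trans {P : Fin n → Prop} {u v w : Fin n → R} (h : vkCRel P u v) (h' : vkCRel P v w) :
    vkCRel P u w := by
  obtain ⟨M, hM, rfl⟩ := h
  obtain ⟨N, hN, rfl⟩ := h'
  exact ⟨M * N, mul_mem hM hN, by simp⟩

open Matrix in
theorem vkCRel.symm {P : Fin n → Prop} {v w : Fin n → R} (h : vkCRel P v w) : vkCRel P w v := by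
  obtain ⟨M, hM, rfl⟩ := h
  obtain ⟨N, hN, h1, h2⟩ := vkC_inv P M hM
  exact ⟨N, hN, by simp [h1]⟩

theorem vkCRel.refl (P : Fin n → Prop) (v : Fin n → R) : vkCRel P v v := ⟨1, one_mem _, by simp⟩

theorem vkCRel.step {P : Fin n → Prop} (v : Fin n → R) (i j : Fin n) (hij : i ≠ j) (hi : P i) (c : R) :
    vkCRel P v (v + Pi.single j (c * v i)) :=
  ⟨_, Submonoid.subset_closure ⟨i, j, c, hij, hi, rfl⟩, (vk_vecMul_transvection v i j c).symm⟩
end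

/-- Euclid -/
theorem vk_euclid {n : ℕ} (S : Finset (Fin n)) (k k' : Fin n) (hk : k ∈ S) (hk' : k' ∈ S)
    (hkk : k ≠ k') : ∀ (N : ℕ) (r : Fin n → ℤ), ∑ j ∈ S, (r j).natAbs = N →
    ∃ r' : Fin n → ℤ, vkCRel (fun i => i ∈ S) r r' ∧ 0 ≤ r' k ∧ ∀ j ∈ S, j ≠ k → r' j = 0 := by
  have fin1 : ∀ (r : Fin n → ℤ) (l : Fin n) (hl : l ∈ S) (hlk : l ≠ k) (h : ∀ j ∈ S, j ≠ l → r j = 0),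
     ∃ r' : Fin n → ℤ, vkCRel (fun i => i ∈ S) r r' ∧ 0 ≤ r' k ∧ ∀ j ∈ S, j ≠ k → r' j = 0 := by
    intro r l hl hlk h
    have hrk := h k hk (Ne.symm hlk)
    obtain ⟨e, he, hee⟩ : ∃ e : ℤ, 0 ≤ e * r l ∧ e * e = 1 := by
      rcases le_total 0 (r l) with h | h
      · exact ⟨1, by simpa using h, by simp⟩
      · exact ⟨-1, by simpa using h, by simp⟩
    have s1 := vkCRel.step (P := fun i => i ∈ S) r l k hlk hl e
    have s2 := vkCRel.step (P := fun i => i ∈ S) (r + Pi.single k (e * r l)) k l (Ne.symm hlk) hk (-e)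
    refine ⟨_, s1.trans s2, ?_, ?_⟩
    · simpa [hrk, Ne.symm hlk] using he
    · intro j hj hjk
      by_cases hjl : j = l
      · subst hjl
        simp [hjk, hrk, ← mul_assoc, hee]
      · simp [hjk, hjl, h j hj hjl]
  intro N
  induction N using Nat.strong_induction_on with
  | _ N ih =>
    intro r hr
    by_cases hex : ∃ i ∈ S, ∃ j ∈ S, i ≠ j ∧ r i ≠ 0 ∧ r j ≠ 0
    · obtain ⟨i, hi, j, hj, hij, hri, hrj⟩ := hex
      wlog hle : (r i).natAbs ≤ (r j).natAbs generalizing i j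
      · exact this j hj i hi (Ne.symm hij) hrj hri (by omega)
      have s1 := vkCRel.step (P := fun i => i ∈ S) r i j hij hi (-(r j / r i))
      have hlt : ∑ l ∈ S, ((r + Pi.single j (-(r j / r i) * r i) : Fin n → ℤ) l).natAbs < N := by
        rw [← hr]
        apply Finset.sum_lt_sum
        · intro l _
          by_cases hl : l = j
          · subst hl
            have : (r + Pi.single l (-(r l / r i) * r i) : Fin n → ℤ) l = r l % r i := by
              simp [Int.emod_def]; ring
            rw [this]
            have h1 := Int.emod_lt_abs (r l) hri
            have h2 := Int.emod_nonneg (r l) hri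
            rw [Int.abs_eq_natAbs] at h1
            omega
          · simp [hl]
        · refine ⟨j, hj, ?_⟩
          have : (r + Pi.single j (-(r j / r i) * r i) : Fin n → ℤ) j = r j % r i := by
              simp [Int.emod_def]; ring
          rw [this]
          have h1 := Int.emod_lt_abs (r j) hri
          have h2 := Int.emod_nonneg (r j) hri
          rw [Int.abs_eq_natAbs] at h1
          omega
      obtain ⟨r', h1, h2⟩ := ih _ hlt _ rfl
      exact ⟨r', s1.trans h1, h2⟩
    · push Not at hex
      by_cases hz : ∃ l ∈ S, l ≠ k ∧ r l ≠ 0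
      · obtain ⟨l, hl, hlk, hrl⟩ := hz
        exact fin1 r l hl hlk fun j hj hjl => hex l hl j hj (Ne.symm hjl) hrl
      · push Not at hz
        have s1 := vkCRel.step (P := fun i => i ∈ S) r k k' hkk hk 1
        have s2 := vkCRel.step (P := fun i => i ∈ S) (r + Pi.single k' (1 * r k)) k' k (Ne.symm hkk) hk' (-1)
        obtain ⟨r', h1, h2⟩ := fin1 (l := k') (hl := hk') (hlk := Ne.symm hkk) (r := (r + Pi.single k' (1 * r k)) +
           Pi.single k (-1 * (r + Pi.single k' (1 * r k) : Fin n → ℤ) k')) (h := by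
            intro j hj hjk
            by_cases hjk' : j = k
            · subst hjk'
              simp [hjk, hz k' hk' (Ne.symm hkk)]
            · simp [hjk, hjk', hz j hj hjk'])
        exact ⟨r', (s1.trans s2).trans h1, h2⟩

open Matrix in
theorem vk_SLZ {n : ℕ} (Q : Fin n → Prop) : ∀ (N : ℕ) (S : Finset (Fin n)), S.card = N →
    (∀ i ∈ S, Q i) → ∀ h : Matrix (Fin n) (Fin n) ℤ, h.det = 1 →
    (∀ i, i ∉ S → Pi.single i 1 ᵥ* h = Pi.single i 1) → h ∈ vkC ℤ n Q := by
  intro N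
  induction N with
  | zero =>
    intro S hS _ h _ hh
    have : h = 1 := by
      rw [Finset.card_eq_zero] at hS
      subst hS
      ext i j
      have := congrFun (hh i (by simp)) j
      rw [single_one_vecMul] at this
      simpa [Matrix.one_apply, Pi.single_apply, eq_comm] using this
    rw [this]; exact one_mem _
  | succ N ih =>
    intro S hS hQ h hdet hh
    obtain ⟨k, hk⟩ : S.Nonempty := Finset.card_pos.1 (by omega)
    -- it is enough to get an entry one
    have main : ∀ h : Matrix (Fin n) (Fin n) ℤ, h.det = 1 →
      (∀ i, i ∉ S → Pi.single i 1 ᵥ* h = Pi.single i 1) → h k k = 1 → (∀ j ∈ S, j ≠ k → h k j = 0)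
        → h ∈ vkC ℤ n Q := by
      intro h hdet hh hkk hkj
      have hM : vkT 1 (Pi.single k 1) (Pi.single k 1 - h k) ∈ vkC ℤ n Q :=
        vkT_row_mem k 1 _ _ (by simp [hkk]) fun j hj =>
          Submonoid.subset_closure ⟨k, j, _, Ne.symm hj, hQ k hk, rfl⟩
      have hrow : ∀ v : Fin n → ℤ, v ᵥ* vkT 1 (Pi.single k 1) (Pi.single k 1 - h k) =
          v + v k • (Pi.single k 1 - h k) := by
        intro v
        rw [vkT, vecMul_add, vecMul_one, vecMul_smul, vecMul_vecMulVec]; simp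
      have := ih (S.erase k) (by rw [Finset.card_erase_of_mem hk]; omega)
        (fun i hi => hQ i (Finset.mem_of_mem_erase hi))
        (h * vkT 1 (Pi.single k 1) (Pi.single k 1 - h k))
        (by rw [det_mul, hdet, vkC_det _ _ hM, one_mul]) (by
          intro i hi
          rw [← vecMul_vecMul]
          by_cases hik : i = k
          · subst hik
            rw [single_one_vecMul, hrow]
            simp [Matrix.row, hkk]
          · rw [hh i (by simpa [hik] using hi), hrow]
            simp [Ne.symm hik])
      obtain ⟨M', hM', h1, h2⟩ := vkC_inv Q _ hM
      have := mul_mem this hM'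
      rwa [mul_assoc, h1, mul_one] at this
    by_cases hex : ∃ k' ∈ S, k' ≠ k
    · obtain ⟨k', hk', hkk'⟩ := hex
      obtain ⟨r', ⟨M, hM, hr'⟩, hpos, hz⟩ := vk_euclid S k k' hk hk' (Ne.symm hkk') _ (h k) rfl
      have hM1 : M ∈ vkC ℤ n Q := vkC_mono hQ hM
      obtain ⟨M', hM', h1, h2⟩ := vkC_inv Q _ hM1
      have hrk : (h * M) k = r' := by rw [hr']; rfl
      have hdet' : (h * M).det = 1 := by rw [det_mul, hdet, vkC_det _ _ hM, one_mul]
      have hh' : ∀ i, i ∉ S → Pi.single i 1 ᵥ* (h * M) = Pi.single i 1 := by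
        intro i hi
        rw [← vecMul_vecMul, hh i hi, vkC_row _ M hM i hi]
      have : h * M ∈ vkC ℤ n Q := by
        refine main (h * M) hdet' hh' ?_ ?_
        · have ha : (h * M) * (h * M).adjugate = 1 := by rw [mul_adjugate, hdet', one_smul]
          have hrow : ∀ i, i ∉ S → (h * M).adjugate i k = 0 := by
            intro i hi
            have e : Pi.single i 1 ᵥ* (h * M).adjugate = Pi.single i 1 := by
              conv_lhs => rw [← hh' i hi]
              rw [vecMul_vecMul, ha, vecMul_one]
            have := congrFun e k
            rw [single_one_vecMul] at this
            have hik : k ≠ i := by rintro rfl; exact hi hk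
            simpa [hik] using this
          have e := congrFun (congrFun ha k) k
          rw [Matrix.mul_apply, Finset.sum_eq_single k] at e
          · rw [hrk] at e ⊢
            simp only [Matrix.one_apply_eq] at e
            exact Int.eq_one_of_mul_eq_one_right hpos e
          · intro j _ hj
            by_cases hjS : j ∈ S
            · rw [hrk, hz j hjS hj, zero_mul]
            · rw [hrow j hjS, mul_zero]
          · simp
        · intro j hj hjk
          rw [hrk]; exact hz j hj hjk
      have := mul_mem this hM'
      rwa [mul_assoc, h1, mul_one] at this
    · push Not at hex
      refine main h hdet hh ?_ (fun j hj hjk => absurd (hex j hj) hjk)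
      have e : h = 1 + Matrix.replicateCol Unit (Pi.single k 1 : Fin n → ℤ) *
          Matrix.replicateRow Unit (h.row k - Pi.single k 1) := by
        ext i j
        by_cases hik : i = k
        · subst hik
          simp [Matrix.mul_apply, Matrix.one_apply, Pi.single_apply, eq_comm]
        · have := congrFun (hh i (fun hi => hik (hex i hi))) j
          rw [single_one_vecMul] at this
          simp only [Matrix.row] at this
          simp [Matrix.mul_apply, hik, this, Matrix.one_apply, Pi.single_apply, eq_comm]
      rw [e, Matrix.det_one_add_replicateCol_mul_replicateRow] at hdet
      simp [Matrix.row] at hdet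
      linarith

section
variable {R : Type*} [CommRing R] {n : ℕ}

def vk3 (v : Fin n → R) (a b c : Fin n) (p q r : R) : Fin n → R :=
  fun l => if l = a then p else if l = b then q else if l = c then r else v l

def vkAbs (v w : Fin n → R) : Prop := vkCRel (fun _ => True) v w

theorem vkAbs.trans {u v w : Fin n → R} (h : vkAbs u v) (h' : vkAbs v w) : vkAbs u w :=
  vkCRel.trans h h'

theorem vkAbs.symm {v w : Fin n → R} (h : vkAbs v w) : vkAbs w v := vkCRel.symm h

theorem vkAbs_step2 (v w : Fin n → R) (i j k : Fin n) (hi : i ≠ k) (hj : j ≠ k) (x y : R)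
    (h : w = v + Pi.single k (x * v i + y * v j)) : vkAbs v w := by
  have s1 := vkCRel.step (P := fun _ => True) v i k hi trivial x
  have s2 := vkCRel.step (P := fun _ => True) (v + Pi.single k (x * v i)) j k hj trivial y
  have := s1.trans s2
  rw [h]
  unfold vkAbs
  convert this using 1
  ext l
  by_cases hl : l = k
  · subst hl; simp [hj]; ring
  · simp [hl]

theorem vk_chA (v : Fin n → R) {a b c : Fin n} (hab : a ≠ b) (hac : a ≠ c) (hbc : b ≠ c)
    {p q r p' : R} (x y : R) (h : p' = p + x * q + y * r) :
    vkAbs (vk3 v a b c p q r) (vk3 v a b c p' q r) := by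
  apply vkAbs_step2 _ _ b c a hab.symm hac.symm x y
  ext l
  by_cases hl : l = a
  · subst hl; simp [vk3, hab.symm, hac.symm, hbc.symm, h]; ring
  · simp [vk3, hl]

theorem vk_chB (v : Fin n → R) {a b c : Fin n} (hab : a ≠ b) (hac : a ≠ c) (hbc : b ≠ c)
    {p q r q' : R} (x y : R) (h : q' = q + x * p + y * r) :
    vkAbs (vk3 v a b c p q r) (vk3 v a b c p q' r) := by
  apply vkAbs_step2 _ _ a c b hab hbc.symm x y
  ext l
  by_cases hl : l = b
  · subst hl; simp [vk3, hab.symm, hac.symm, hbc.symm, h]; ring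
  · simp [vk3, hl]

theorem vk_chC (v : Fin n → R) {a b c : Fin n} (hab : a ≠ b) (hac : a ≠ c) (hbc : b ≠ c)
    {p q r r' : R} (x y : R) (h : r' = r + x * p + y * q) :
    vkAbs (vk3 v a b c p q r) (vk3 v a b c p q r') := by
  apply vkAbs_step2 _ _ a b c hac hbc x y
  ext l
  by_cases hl : l = c
  · subst hl; simp [vk3, hab.symm, hac.symm, hbc.symm, h]; ring
  · simp [vk3, hl]

theorem vk_Y (v : Fin n → R) {a b c : Fin n} (hab : a ≠ b) (hac : a ≠ c) (hbc : b ≠ c)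
    (p q r y y1 y2 : R) (hy : y1 * y1 = y * y2) :
    vkAbs (vk3 v a b c p q r)
      (vk3 v a b c (p + y1 * p * p + y * p * q) (q - y2 * p * p - y1 * p * q) r) := by
  apply vkAbs.symm
  set g := 1 + y1 * p + y * q with hg
  set h := 1 - y1 * p with hh
  set s := q - y2 * p * p - y1 * p * q with hs
  have hgh : g * h = 1 + y * s := by
    rw [hg, hh, hs]; linear_combination (-p*p) * hy
  have e : p + y1 * p * p + y * p * q = g * p := by rw [hg]; ring
  rw [e]
  have m1 := vk_chC v hab hac hbc (p := g * p) (q := s) (r := r) (r' := r + p) h (-(y * p))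
    (by linear_combination (-p) * hgh)
  have m2 := vk_chA v hab hac hbc (p := g * p) (q := s) (r := r + p) (p' := - (g * r)) 0 (-g) (by ring)
  have m3 := vk_chC v hab hac hbc (p := - (g * r)) (q := s) (r := r + p) (r' := p) h (y * r)
    (by linear_combination (r) * hgh)
  have m4 := vk_chA v hab hac hbc (p := - (g * r)) (q := s) (r := p) (p' := p - g * r) 0 1 (by ring)
  have m5 := vk_chC v hab hac hbc (p := p - g * r) (q := s) (r := p) (r' := g * r) (-1) 0 (by ring)
  have m6 := vk_chA v hab hac hbc (p := p - g * r) (q := s) (r := g * r) (p' := p) 0 1 (by ring)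
  have m7 := vk_chB v hab hac hbc (p := p) (q := s) (r := g * r) (q' := q) (y2 * p + y1 * q) 0
    (by rw [hs]; ring)
  have m8 := vk_chC v hab hac hbc (p := p) (q := q) (r := g * r) (r' := r) (-(y1 * r)) (-(y * r))
    (by rw [hg]; ring)
  exact ((((((m1.trans m2).trans m3).trans m4).trans m5).trans m6).trans m7).trans m8

theorem vk_PQ (v : Fin n → R) {a b c : Fin n} (hab : a ≠ b) (hac : a ≠ c) (hbc : b ≠ c)
    (p q r x x1 z z1 : R) (h1 : x * z1 = x1 * z) :
    vkAbs (vk3 v a b c p q r)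
      (vk3 v a b c (p + z * (x * q + x1 * p)) (q - z1 * (x * q + x1 * p)) r) := by
  set w := x * q + x1 * p with hw
  have m1 := vk_chC v hab hac hbc (p := p) (q := q) (r := r) (r' := r + w) x1 x (by rw [hw]; ring)
  have m2 := vk_chA v hab hac hbc (p := p) (q := q) (r := r + w) (p' := p + z * (r + w)) 0 z (by ring)
  have m3 := vk_chB v hab hac hbc (p := p + z * (r + w)) (q := q) (r := r + w)
    (q' := q - z1 * (r + w)) 0 (-z1) (by ring)
  have m4 := vk_chC v hab hac hbc (p := p + z * (r + w)) (q := q - z1 * (r + w)) (r := r + w)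
    (r' := r) (-x1) (-x) (by linear_combination (-(r + w)) * h1 + hw)
  have m5 := vk_chA v hab hac hbc (p := p + z * (r + w)) (q := q - z1 * (r + w)) (r := r)
    (p' := p + z * w) 0 (-z) (by ring)
  have m6 := vk_chB v hab hac hbc (p := p + z * w) (q := q - z1 * (r + w)) (r := r)
    (q' := q - z1 * w) 0 z1 (by ring)
  exact ((((m1.trans m2).trans m3).trans m4).trans m5).trans m6

/-- the action of a conjugate of an elementary matrix -/
theorem vk_Z (v : Fin n → R) {a b c : Fin n} (hab : a ≠ b) (hac : a ≠ c) (hbc : b ≠ c)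
    (p q r x x1 x2 z1 : R) (h : x1 * x1 = x * x2) (h1 : x * z1 = x1 * (1 - p))
    (h2 : x1 * z1 = x2 * (1 - p)) :
    vkAbs (vk3 v a b c p q r)
      (vk3 v a b c (p + x1 * p + x * q) (q - x2 * p - x1 * q) r) := by
  have m1 := vk_Y v hab hac hbc p q r x x1 x2 h
  have m2 := vk_PQ v hab hac hbc (p + x1 * p * p + x * p * q) (q - x2 * p * p - x1 * p * q) r
    x x1 (1 - p) z1 h1
  have := m1.trans m2
  convert this using 2
  · linear_combination (-(1 - p) * p * p) * h
  · linear_combination (q - x2 * p * p - x1 * p * q) * h1 + (p + x1 * p * p + x * p * q) * h2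
     + (- (1 - p) * p * q) * h
end

theorem vk_map_transvection {R S : Type*} [CommRing R] [CommRing S] {n : ℕ} (f : R →+* S)
    (i j : Fin n) (c : R) :
    f.mapMatrix (Matrix.transvection i j c) = Matrix.transvection i j (f c) := by
  ext a b
  simp only [RingHom.mapMatrix_apply, Matrix.map_apply, Matrix.transvection, Matrix.add_apply,
    Matrix.one_apply, Matrix.single_apply, map_add]
  split_ifs <;> simp

theorem vk_um_iff {R : Type*} [CommRing R] {n : ℕ} (v : Fin n → R) :
    IsUmRow v ↔ ∃ c : Fin n → R, ∑ i, c i * v i = 1 := by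
  rw [IsUmRow, Ideal.eq_top_iff_one, Ideal.mem_span_range_iff_exists_fun]

section
variable {B : Type*} [CommRing B] {n : ℕ} (π : B →+* ℤ)

theorem vk_ker (b : B) : b - ((π b : ℤ) : B) ∈ RingHom.ker π := by
  rw [RingHom.mem_ker, map_sub, map_intCast]; simp

theorem vk_decomp (E : Matrix (Fin n) (Fin n) B) (hE : E ∈ vkC B n (fun _ => True)) :
    ∃ N ∈ vkN (RingHom.ker π) n, ∃ h ∈ vkC ℤ n (fun _ => True),
      E = N * (Int.castRingHom B).mapMatrix h := by
  induction hE using Submonoid.closure_induction with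
  | mem M hM =>
    obtain ⟨i, j, c, hij, -, rfl⟩ := hM
    refine ⟨_, vkN_transvection _ i j hij _ (vk_ker π c), Matrix.transvection i j (π c),
      Submonoid.subset_closure ⟨i, j, _, hij, trivial, rfl⟩, ?_⟩
    rw [vk_map_transvection, Matrix.transvection_mul_transvection_same _ _ hij]
    simp
  | one => exact ⟨1, one_mem _, 1, one_mem _, by simp⟩
  | mul x y _ _ hx hy =>
    obtain ⟨N1, hN1, h1, hh1, rfl⟩ := hx
    obtain ⟨N2, hN2, h2, hh2, rfl⟩ := hy
    obtain ⟨k, hk, e1, e2⟩ := vkC_inv _ _ hh1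
    have f1 := congrArg (Int.castRingHom B).mapMatrix e1
    have f2 := congrArg (Int.castRingHom B).mapMatrix e2
    rw [map_mul, map_one] at f1 f2
    refine ⟨N1 * ((Int.castRingHom B).mapMatrix h1 * N2 * (Int.castRingHom B).mapMatrix k),
      mul_mem hN1 (vkN_conj _ _ _ f2 f1 _ hN2), h1 * h2, mul_mem hh1 hh2, ?_⟩
    rw [map_mul]
    calc _ = N1 * (Int.castRingHom B).mapMatrix h1 * N2 * 1 * (Int.castRingHom B).mapMatrix h2 := by
            simp only [mul_assoc, one_mul]
      _ = _ := by rw [← f2]; simp only [mul_assoc]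

theorem vk_rel_pi [NeZero n] (v : Fin n → B) (hv : vkRel (RingHom.ker π) v) :
    (fun i => π (v i)) = Pi.single 0 1 := by
  ext i
  by_cases hi : i = 0
  · subst hi
    have := hv.1
    rw [RingHom.mem_ker, map_sub, map_one] at this
    simp; linarith
  · rw [Pi.single_eq_of_ne hi]; exact hv.2 i hi

open Matrix in
theorem vk_map_cast (h : Matrix (Fin n) (Fin n) ℤ) :
    ((Int.castRingHom B).mapMatrix h).map π = h := by
  ext i j; simp

open Matrix in
/-- absolute orbits meet the relative rows in relative orbits -/
theorem vk_abs_to_rel [NeZero n] (hn : 3 ≤ n) (v w : Fin n → B) (hv : vkRel (RingHom.ker π) v)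
    (hw : vkRel (RingHom.ker π) w) (h : vkAbs v w) : RelERel (RingHom.ker π) v w := by
  obtain ⟨E, hE, rfl⟩ := h
  obtain ⟨N, hN, h, hh, rfl⟩ := vk_decomp π E hE
  rw [← vecMul_vecMul] at hw ⊢
  have r1 : vkNRel (RingHom.ker π) v (v ᵥ* N) := ⟨N, hN, rfl⟩
  have hv' := r1.rel hv
  have e := vk_map_vecMul π (v ᵥ* N) ((Int.castRingHom B).mapMatrix h)
  rw [vk_rel_pi π _ hw, vk_rel_pi π _ hv', vk_map_cast] at e
  have hC : h ∈ vkC ℤ n (fun i => i ≠ 0) := by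
    refine vk_SLZ _ _ (Finset.univ.erase 0) rfl (by simp) h (vkC_det _ _ hh) ?_
    intro i hi
    have : i = 0 := by simpa using hi
    subst this; exact e.symm
  have hC' : (Int.castRingHom B).mapMatrix h ∈ vkC B n (fun i => i ≠ 0) := by
    have : vkC ℤ n (fun i => i ≠ 0) ≤
        (vkC B n (fun i => i ≠ 0)).comap (Int.castRingHom B).mapMatrix.toMonoidHom := by
      rw [vkC, Submonoid.closure_le]
      rintro E ⟨i, j, c, hij, hi, rfl⟩
      refine Submonoid.subset_closure ⟨i, j, (c : B), hij, hi, ?_⟩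
      exact vk_map_transvection _ i j c
    exact this hC
  exact (r1.trans (vk_orbit hn _ hC' _ hv')).toRel hn

open Matrix in
theorem vk_um_vecMul {R : Type*} [CommRing R] (v : Fin n → R) (hv : IsUmRow v)
    (M M' : Matrix (Fin n) (Fin n) R) (h : M * M' = 1) : IsUmRow (v ᵥ* M) := by
  rw [vk_um_iff] at *
  obtain ⟨c, hc⟩ := hv
  refine ⟨M' *ᵥ c, ?_⟩
  have : (v ᵥ* M) ⬝ᵥ (M' *ᵥ c) = 1 := by
    rw [dotProduct_mulVec, vecMul_vecMul, h, vecMul_one, ← hc]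
    simp [dotProduct, mul_comm]
  rw [← this]; simp [dotProduct, mul_comm]

theorem vk_um_map {R S : Type*} [CommRing R] [CommRing S] (f : R →+* S) (v : Fin n → R)
    (hv : IsUmRow v) : IsUmRow (fun i => f (v i)) := by
  rw [vk_um_iff] at *
  obtain ⟨c, hc⟩ := hv
  refine ⟨fun i => f (c i), ?_⟩
  rw [← map_one f, ← hc]; simp

open Matrix in
theorem vk_surj_abs [NeZero n] (hn : 3 ≤ n) (u : Fin n → B) (hu : IsUmRow u) :
    ∃ v, IsRelUmRow (RingHom.ker π) v ∧ vkAbs v u := by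
  have hπ := vk_um_map π u hu
  have h01 : (0 : Fin n) ≠ ⟨1, by omega⟩ := by
    intro h; have := congrArg Fin.val h; simp at this
  obtain ⟨r', ⟨h, hh, hr'⟩, hpos, hz⟩ := vk_euclid (Finset.univ : Finset (Fin n)) 0
    ⟨1, by omega⟩ (by simp) (by simp) h01 _ (fun i => π (u i)) rfl
  have hh' : h ∈ vkC ℤ n (fun _ => True) := vkC_mono (by simp) hh
  obtain ⟨k, hk, e1, e2⟩ := vkC_inv _ _ hh'
  have hr'um := vk_um_vecMul _ hπ h k e1
  rw [← hr', vk_um_iff] at hr'um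
  obtain ⟨c, hc⟩ := hr'um
  rw [Finset.sum_eq_single 0 (fun j _ hj => by rw [hz j (by simp) hj, mul_zero]) (by simp)] at hc
  have hr0 : r' 0 = 1 := Int.eq_one_of_mul_eq_one_right hpos (by rw [mul_comm]; exact hc)
  have f1 := congrArg (Int.castRingHom B).mapMatrix e1
  rw [map_mul, map_one] at f1
  have hC' : (Int.castRingHom B).mapMatrix h ∈ vkC B n (fun _ => True) := by
    have : vkC ℤ n (fun _ => True) ≤
        (vkC B n (fun _ => True)).comap (Int.castRingHom B).mapMatrix.toMonoidHom := by
      rw [vkC, Submonoid.closure_le]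
      rintro E ⟨i, j, c, hij, hi, rfl⟩
      refine Submonoid.subset_closure ⟨i, j, (c : B), hij, hi, ?_⟩
      exact vk_map_transvection _ i j c
    exact this hh'
  have e := vk_map_vecMul π u ((Int.castRingHom B).mapMatrix h)
  rw [vk_map_cast, ← hr'] at e
  refine ⟨u ᵥ* (Int.castRingHom B).mapMatrix h, ⟨vk_um_vecMul _ hu _ _ f1, ?_, ?_⟩, ?_⟩
  · have := congrFun e 0
    rw [RingHom.mem_ker, map_sub, map_one, this, hr0]; simp
  · intro i hi
    have := congrFun e i
    rw [RingHom.mem_ker, this, hz i (by simp) hi]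
  · apply vkAbs.symm
    exact ⟨_, hC', rfl⟩

variable {A : Type*} [CommRing A] (φ : B →+* A) (I : Ideal A)

theorem vk_others (v : Fin n → B) (a b : Fin n) (d e : Fin n → B) (s : Finset (Fin n))
    (ha : a ∉ s) (hb : b ∉ s) :
    vkAbs v (fun l => if l ∈ s then v l + d l * v a + e l * v b else v l) := by
  induction s using Finset.induction_on with
  | empty => simp only [Finset.notMem_empty, if_false]; exact vkCRel.refl _ v
  | insert k s hk ih =>
    refine (ih (by grind) (by grind)).trans ?_
    refine vkAbs_step2 _ _ a b k (by grind) (by grind) (d k) (e k) ?_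
    ext l
    by_cases hl : l = k
    · subst hl
      have h1 : a ∉ s := by grind
      have h2 : b ∉ s := by grind
      simp [hk, h1, h2]; ring
    · simp [hl]

theorem vk_lift_step [NeZero n] (hn : 3 ≤ n)
    (hmap : ∀ b ∈ RingHom.ker π, φ b ∈ I)
    (hinj : ∀ b ∈ RingHom.ker π, φ b = 0 → b = 0)
    (hsurj : ∀ x ∈ I, ∃ b ∈ RingHom.ker π, φ b = x)
    (v : Fin n → B) (hv : vkRel (RingHom.ker π) v) (j : Fin n) (hj : j ≠ 0) (x : A) (hx : x ∈ I)
    (a : Fin n → A) (ha : a 0 = 0) :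
    ∃ v', vkRel (RingHom.ker π) v' ∧ vkAbs v v' ∧
      ∀ k, φ (v' k) = φ (v k) + x * (φ (v j) + φ (v 0) * a j) * ((Pi.single 0 1 : Fin n → A) k - a k) := by
  obtain ⟨c, hc0, hcj⟩ : ∃ k : Fin n, k ≠ 0 ∧ k ≠ j := by
    obtain ⟨k, hk⟩ := Finset.exists_mem_notMem_of_card_lt_card
      (s := {0, j}) (t := (Finset.univ : Finset (Fin n))) (by
        have : ({0, j} : Finset (Fin n)).card ≤ 2 := Finset.card_le_two
        simp; omega)
    exact ⟨k, by simpa using hk⟩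
  set J := RingHom.ker π with hJ
  have hinj' : ∀ b b' : B, b ∈ J → b' ∈ J → φ b = φ b' → b = b' := fun b b' h h' e =>
    sub_eq_zero.1 (hinj _ (J.sub_mem h h') (by rw [map_sub, e, sub_self]))
  obtain ⟨y, hyJ, hy⟩ := hsurj x hx
  obtain ⟨y1, hy1J, hy1⟩ := hsurj (x * a j) (I.mul_mem_right _ hx)
  obtain ⟨y2, hy2J, hy2⟩ := hsurj (x * (a j * a j)) (I.mul_mem_right _ hx)
  obtain ⟨z1, hz1J, hz1⟩ := hsurj (a j * φ (1 - v 0)) (I.mul_mem_left _ (hmap _ hv.1))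
  choose d hdJ hd using fun k => hsurj (-(x * a k)) (I.neg_mem (I.mul_mem_right _ hx))
  choose e heJ he using fun k => hsurj (-(x * (a j * a k))) (I.neg_mem (I.mul_mem_right _ hx))
  set s : Finset (Fin n) := (Finset.univ.erase 0).erase j with hs
  have m1 := vk_others v j 0 d e s (by simp [hs]) (by simp [hs])
  set v1 : Fin n → B := fun l => if l ∈ s then v l + d l * v j + e l * v 0 else v l with hv1
  have m2 := vk_Z v1 (Ne.symm hj) (Ne.symm hc0) (Ne.symm hcj) (v 0) (v j) (v1 c) y y1 y2 z1
    (hinj' _ _ (J.mul_mem_left _ hy1J) (J.mul_mem_left _ hy2J) (by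
      rw [map_mul, map_mul, hy1, hy, hy2]; ring))
    (hinj' _ _ (J.mul_mem_left _ hz1J) (J.mul_mem_left _ hv.1) (by
      rw [map_mul, map_mul, hy1, hy, hz1]; ring))
    (hinj' _ _ (J.mul_mem_left _ hz1J) (J.mul_mem_left _ hv.1) (by
      rw [map_mul, map_mul, hy1, hy2, hz1]; ring))
  have e1 : vk3 v1 0 j c (v 0) (v j) (v1 c) = v1 := by
    ext l
    simp only [vk3]
    split_ifs with h1 h2 h3
    · subst h1; simp [hv1, hs]
    · subst h2; simp [hv1, hs]
    · subst h3; rfl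
    · rfl
  rw [e1] at m2
  refine ⟨_, ?_, m1.trans m2, ?_⟩
  · constructor
    · have : 1 - vk3 v1 0 j c (v 0 + y1 * v 0 + y * v j) (v j - y2 * v 0 - y1 * v j) (v1 c) 0 =
        (1 - v 0) - v 0 * y1 - v j * y := by
        simp [vk3]; ring
      rw [this]
      exact J.sub_mem (J.sub_mem hv.1 (J.mul_mem_left _ hy1J)) (J.mul_mem_left _ hyJ)
    · have hv1J : ∀ k, k ≠ 0 → v1 k ∈ J := by
        intro k hk
        simp only [hv1]
        split_ifs
        · exact J.add_mem (J.add_mem (hv.2 k hk) (J.mul_mem_right _ (hdJ k)))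
            (J.mul_mem_right _ (heJ k))
        · exact hv.2 k hk
      intro k hk
      simp only [vk3, if_neg hk]
      split_ifs with h2 h3
      · exact J.sub_mem (J.sub_mem (hv.2 j hj) (J.mul_mem_right _ hy2J)) (J.mul_mem_right _ hy1J)
      · exact hv1J c hc0
      · exact hv1J k hk
  · intro k
    by_cases hk0 : k = 0
    · subst hk0
      simp [vk3, hy, hy1, ha]; ring
    · by_cases hkj : k = j
      · subst hkj
        simp [vk3, hk0, hy1, hy2]; ring
      · have : vk3 v1 0 j c (v 0 + y1 * v 0 + y * v j) (v j - y2 * v 0 - y1 * v j) (v1 c) k = v1 k := by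
          simp only [vk3, if_neg hk0, if_neg hkj]
          split_ifs with h
          · rw [h]
          · rfl
        rw [this]
        simp [hv1, hs, hk0, hkj, hd, he]; ring

open Matrix in
theorem vk_lift_word [NeZero n] (hn : 3 ≤ n)
    (hmap : ∀ b ∈ RingHom.ker π, φ b ∈ I)
    (hinj : ∀ b ∈ RingHom.ker π, φ b = 0 → b = 0)
    (hsurj : ∀ x ∈ I, ∃ b ∈ RingHom.ker π, φ b = x)
    (v : Fin n → B) (hv : vkRel (RingHom.ker π) v) (M : Matrix (Fin n) (Fin n) A)
    (hM : M ∈ relElementarySubmonoid1 n A I) :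
    ∃ (v' : Fin n → B) (a : Fin n → A), vkRel (RingHom.ker π) v' ∧ vkAbs v v' ∧ a 0 = 0 ∧
      (fun i => φ (v i)) ᵥ* M = fun k => φ (v' k) + φ (v' 0) * a k := by
  induction hM using Submonoid.closure_induction_right with
  | one => exact ⟨v, 0, hv, vkCRel.refl _ v, rfl, by simp⟩
  | mul_right M _ y hy ih =>
    obtain ⟨v', a, hv', hvv', ha, h⟩ := ih
    rw [← vecMul_vecMul, h]
    rcases hy with ⟨i, b, hi, rfl⟩ | ⟨j, x, hj, hx, rfl⟩
    · refine ⟨v', a + Pi.single i b, hv', hvv', by simp [ha, Ne.symm hi], ?_⟩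
      rw [vk_vecMul_transvection]
      ext k
      by_cases hk : k = i
      · subst hk; simp [ha]; ring
      · simp [hk]
    · obtain ⟨w, hw, hvw, e⟩ := vk_lift_step π φ I hn hmap hinj hsurj v' hv' j hj x hx a ha
      refine ⟨w, a, hw, hvv'.trans hvw, ha, ?_⟩
      rw [vk_vecMul_transvection]
      ext k
      rw [e k, e 0, ha]
      by_cases hk : k = 0
      · subst hk; simp [ha]
      · simp [hk]; ring

open Matrix in
theorem vk_inj [NeZero n] (hn : 3 ≤ n)
    (hmap : ∀ b ∈ RingHom.ker π, φ b ∈ I)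
    (hinj : ∀ b ∈ RingHom.ker π, φ b = 0 → b = 0)
    (hsurj : ∀ x ∈ I, ∃ b ∈ RingHom.ker π, φ b = x)
    (v w : Fin n → B) (hv : vkRel (RingHom.ker π) v) (hw : vkRel (RingHom.ker π) w)
    (h : RelERel I (fun i => φ (v i)) (fun i => φ (w i))) : RelERel (RingHom.ker π) v w := by
  apply vk_abs_to_rel π hn v w hv hw
  obtain ⟨M, ⟨hM, hM1⟩, e⟩ := h
  obtain ⟨v', a, hv', hvv', ha, h⟩ := vk_lift_word π φ I hn hmap hinj hsurj v hv M hM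
  rw [h] at e
  refine hvv'.trans ?_
  have haI : ∀ k, a k ∈ I := by
    intro k
    by_cases hk : k = 0
    · subst hk; rw [ha]; exact I.zero_mem
    · have e1 := congrFun e k
      have h1 := hmap _ (hw.2 k hk)
      have h2 := hmap _ (hv'.2 k hk)
      have h3 := hmap _ hv'.1
      rw [map_sub, map_one] at h3
      have : a k = φ (w k) - φ (v' k) + (1 - φ (v' 0)) * a k := by rw [e1]; ring
      rw [this]
      exact I.add_mem (I.sub_mem h1 h2) (I.mul_mem_right _ h3)
  choose d hdJ hd using fun k => hsurj (a k) (haI k)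
  have hw' : w = fun l => if l ∈ Finset.univ.erase (0 : Fin n) then v' l + d l * v' 0 + 0 * v' 0 else v' l := by
    ext k
    have e1 := congrFun e k
    by_cases hk : k = 0
    · subst hk
      simp only [Finset.mem_erase, ne_eq, not_true_eq_false, false_and, if_false]
      rw [← sub_eq_zero]
      apply hinj
      · have := (RingHom.ker π).sub_mem hv'.1 hw.1
        convert this using 1; ring
      · rw [map_sub, e1, ha]; ring
    · simp only [Finset.mem_erase, ne_eq, hk, not_false_eq_true, Finset.mem_univ, and_self, if_true]
      rw [← sub_eq_zero]
      apply hinj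
      · exact (RingHom.ker π).sub_mem (hw.2 k hk) ((RingHom.ker π).add_mem ((RingHom.ker π).add_mem (hv'.2 k hk)
          ((RingHom.ker π).mul_mem_right _ (hdJ k))) (by simp))
      · rw [map_sub, e1]; simp [hd]; ring
  rw [hw']
  exact vk_others v' 0 0 d 0 _ (by simp) (by simp)

open Matrix in
theorem vk_welldef [NeZero n] (hmap : ∀ b ∈ RingHom.ker π, φ b ∈ I)
    (v w : Fin n → B) (h : RelERel (RingHom.ker π) v w) :
    RelERel I (fun i => φ (v i)) (fun i => φ (w i)) := by
  obtain ⟨M, ⟨hM, hM1⟩, rfl⟩ := h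
  refine ⟨M.map φ, ⟨?_, ?_⟩, vk_map_vecMul φ v M⟩
  · have : relElementarySubmonoid1 n B (RingHom.ker π) ≤
        (relElementarySubmonoid1 n A I).comap φ.mapMatrix.toMonoidHom := by
      conv_lhs => rw [relElementarySubmonoid1]
      rw [Submonoid.closure_le]
      rintro E (⟨i, b, hi, rfl⟩ | ⟨j, x, hj, hx, rfl⟩)
      · exact Submonoid.subset_closure (Or.inl ⟨i, φ b, hi, vk_map_transvection _ _ _ _⟩)
      · exact Submonoid.subset_closure (Or.inr ⟨j, φ x, hj, hmap x hx, vk_map_transvection _ _ _ _⟩)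
    exact this hM
  · ext i j
    have e := congrFun (congrFun hM1 i) j
    have e1 : M i j - (1 : Matrix (Fin n) (Fin n) B) i j ∈ RingHom.ker π := by
      rw [← Ideal.Quotient.eq_zero_iff_mem, map_sub, sub_eq_zero]
      simp only [Matrix.map_apply] at e
      rw [e, Matrix.one_apply, Matrix.one_apply]; split_ifs <;> simp
    have e2 := Ideal.Quotient.eq_zero_iff_mem.2 (hmap _ e1)
    rw [map_sub, map_sub, sub_eq_zero] at e2
    simp only [Matrix.map_apply]
    rw [e2, Matrix.one_apply, Matrix.one_apply]; split_ifs <;> simp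

theorem vk_surj [NeZero n] 
    (hinj : ∀ b ∈ RingHom.ker π, φ b = 0 → b = 0)
    (hsurj : ∀ x ∈ I, ∃ b ∈ RingHom.ker π, φ b = x)
    (u : Fin n → A) (hu : IsRelUmRow I u) :
    ∃ v : Fin n → B, IsRelUmRow (RingHom.ker π) v ∧ RelERel I (fun i => φ (v i)) u := by
  obtain ⟨hum, h0, hi⟩ := hu
  rw [vk_um_iff] at hum
  obtain ⟨c, hc⟩ := hum
  have hI : ∀ k, u k - (Pi.single 0 1 : Fin n → A) k ∈ I := by
    intro k
    by_cases hk : k = 0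
    · subst hk
      have := I.neg_mem h0
      convert this using 1; simp
    · simpa [hk] using hi k hk
  choose d hdJ hd using fun k => hsurj _ (hI k)
  choose e heJ he using fun k => hsurj ((1 - u 0) * c k) (I.mul_mem_right _ h0)
  have hv : ∀ k, φ (d k + (Pi.single 0 1 : Fin n → B) k) = u k := by
    intro k
    rw [map_add, hd]
    by_cases hk : k = 0
    · subst hk; simp
    · simp [hk]
  refine ⟨fun k => d k + (Pi.single 0 1 : Fin n → B) k, ⟨?_, ?_, ?_⟩, 1, ⟨one_mem _, ?_⟩, ?_⟩
  · rw [vk_um_iff]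
    refine ⟨fun k => e k + (Pi.single 0 1 : Fin n → B) k, ?_⟩
    have e1 : ∑ i, (e i + (Pi.single 0 1 : Fin n → B) i) * (d i + (Pi.single 0 1 : Fin n → B) i) =
       ∑ i, e i * (d i + (Pi.single 0 1 : Fin n → B) i) + (d 0 + 1) := by
      simp only [add_mul _ _ (_ + _), Finset.sum_add_distrib]
      congr 1
      rw [Finset.sum_eq_single 0] <;> simp +contextual
    rw [e1, ← sub_eq_zero]
    apply hinj
    · have : ∑ i, e i * (d i + (Pi.single 0 1 : Fin n → B) i) + (d 0 + 1) - 1 =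
        ∑ i, e i * (d i + (Pi.single 0 1 : Fin n → B) i) + d 0 := by ring
      rw [this]
      exact (RingHom.ker π).add_mem ((RingHom.ker π).sum_mem fun i _ =>
        (RingHom.ker π).mul_mem_right _ (heJ i)) (hdJ 0)
    · have h2 : φ (d 0 + 1) = u 0 := by simpa using hv 0
      rw [map_sub, map_add, h2, map_sum]
      simp only [map_mul, hv, he, mul_assoc]
      rw [← Finset.mul_sum, hc]; simp
  · have := (RingHom.ker π).neg_mem (hdJ 0)
    convert this using 1; simp
  · intro i hi
    simpa [hi] using hdJ i
  · ext i j; simp [Matrix.one_apply]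
  · ext k; simp only [Matrix.vecMul_one, hv]
end

/-- The canonical map. -/
def vkPhi (A : Type*) [CommRing A] (I : Ideal A) : Unitization ℤ I →+* A where
  toFun x := (Int.cast x.fst : A) + (x.snd : A)
  map_one' := by simp
  map_zero' := by simp
  map_add' x y := by simp; ring
  map_mul' x y := by simp; ring

theorem vk_abs_iff {R : Type*} [CommRing R] {n : ℕ} (v w : Fin n → R) :
    vkAbs v w ↔ AbsERel v w := by
  unfold vkAbs vkCRel AbsERel
  rw [vkC_top]


/-- **Excision (van der Kallen).** Let `n ≥ 3`, `A` a commutative ring, `I` an ideal of `A` and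
`B = ℤ ⊕ I` the unitization.  The canonical ring homomorphism `B → A` induces a bijection
`MSE_n(ℤ ⊕ I, I) → MSE_n(A, I)`, and the identity induces a bijection
`MSE_n(ℤ ⊕ I, I) → MSE_n(ℤ ⊕ I)`; below these bijectivity statements are unfolded in terms of
rows and orbits (well-definedness, injectivity and surjectivity on orbit sets). -/
theorem vanderKallen_excision (A : Type*) [CommRing A] (I : Ideal A) (m : ℕ) :
    letI n : ℕ := m + 3
    letI B := Unitization ℤ I
    letI IB : Ideal B := RingHom.ker (Unitization.fstHom ℤ I).toRingHom
    letI φ : B → A := fun x => (Int.cast x.fst : A) + (x.snd : A)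
    -- the map `MSE_n(ℤ ⊕ I, I) → MSE_n(A, I)` is well defined …
    ((∀ v : Fin n → B, IsRelUmRow IB v → IsRelUmRow I (fun i => φ (v i))) ∧
     (∀ v w : Fin n → B, IsRelUmRow IB v → IsRelUmRow IB w → RelERel IB v w →
        RelERel I (fun i => φ (v i)) (fun i => φ (w i))) ∧
    -- … injective …
     (∀ v w : Fin n → B, IsRelUmRow IB v → IsRelUmRow IB w →
        RelERel I (fun i => φ (v i)) (fun i => φ (w i)) → RelERel IB v w) ∧
    -- … and surjective;
     (∀ u : Fin n → A, IsRelUmRow I u →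
        ∃ v : Fin n → B, IsRelUmRow IB v ∧ RelERel I (fun i => φ (v i)) u)) ∧
    -- the map `MSE_n(ℤ ⊕ I, I) → MSE_n(ℤ ⊕ I)` is injective …
    ((∀ v w : Fin n → B, IsRelUmRow IB v → IsRelUmRow IB w → AbsERel v w → RelERel IB v w) ∧
    -- … and surjective.
     (∀ u : Fin n → B, IsUmRow u → ∃ v : Fin n → B, IsRelUmRow IB v ∧ AbsERel v u)) := by
  have hn : 3 ≤ m + 3 := by omega
  have hmap : ∀ b ∈ RingHom.ker (Unitization.fstHom ℤ I).toRingHom, vkPhi A I b ∈ I := by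
    intro b hb
    have hb' : b.fst = 0 := hb
    change (Int.cast b.fst : A) + (b.snd : A) ∈ I
    rw [hb']; simp
  have hinj : ∀ b ∈ RingHom.ker (Unitization.fstHom ℤ I).toRingHom, vkPhi A I b = 0 → b = 0 := by
    intro b hb h
    have hb' : b.fst = 0 := hb
    change (Int.cast b.fst : A) + (b.snd : A) = 0 at h
    rw [hb'] at h
    refine Unitization.ext hb' (Subtype.ext ?_)
    simpa using h
  have hsurj : ∀ x ∈ I, ∃ b ∈ RingHom.ker (Unitization.fstHom ℤ I).toRingHom,
      vkPhi A I b = x := by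
    intro x hx
    refine ⟨Unitization.inr ⟨x, hx⟩, ?_, ?_⟩
    · change (Unitization.inr (⟨x, hx⟩ : I) : Unitization ℤ I).fst = 0
      simp
    · change (Int.cast (Unitization.inr (⟨x, hx⟩ : I) : Unitization ℤ I).fst : A) + _ = x
      simp
  refine ⟨⟨?_, ?_, ?_, ?_⟩, ?_, ?_⟩
  · intro v hv
    refine ⟨vk_um_map (vkPhi A I) v hv.1, ?_, fun i hi => hmap _ (hv.2.2 i hi)⟩
    have := hmap _ hv.2.1
    rw [map_sub, map_one] at this
    exact this
  · intro v w _ _ h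
    exact vk_welldef _ (vkPhi A I) I hmap v w h
  · intro v w hv hw h
    exact vk_inj _ (vkPhi A I) I hn hmap hinj hsurj v w hv.2 hw.2 h
  · intro u hu
    exact vk_surj _ (vkPhi A I) I hinj hsurj u hu
  · intro v w hv hw h
    exact vk_abs_to_rel _ hn v w hv.2 hw.2 ((vk_abs_iff v w).2 h)
  · intro u hu
    obtain ⟨v, hv, h⟩ := vk_surj_abs (Unitization.fstHom ℤ I).toRingHom hn u hu
    exact ⟨v, hv, (vk_abs_iff v u).1 h⟩
end

section
/- Let A be a commutative ring and I an ideal of A. Let [a₁, …, a_n] ∈ Um_n(A, I), n ≥ 3, and let d be a positive integer. Then [a₁^d, a₂, …, a_n] and [a₁, a₂^d, …, a_n] lie in the same orbit under the action of the relative elementary group E_n(A, I). -/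
set_option linter.all false

open Matrix in
theorem vecMul_tv {A : Type*} [CommRing A] {n : ℕ} (v : Fin n → A) (i j : Fin n) (c : A) :
    Matrix.vecMul v (Matrix.transvection i j c) = v + Pi.single j (v i * c) := by
  ext k
  simp only [Matrix.transvection, Matrix.vecMul_add, Matrix.vecMul_one, Pi.add_apply]
  congr 1
  simp only [Matrix.vecMul, dotProduct, Matrix.single_apply, Pi.single_apply]
  by_cases h : k = j
  · subst h; simp
  · simp [h, Ne.symm h]

/-- same orbit under `E¹` -/
def R1 {A : Type*} [CommRing A] (I : Ideal A) {n : ℕ} [NeZero n] (v w : Fin n → A) : Prop :=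
  ∃ E ∈ relElementarySubmonoid1 n A I, w = Matrix.vecMul v E

section
variable {A : Type*} [CommRing A] {I : Ideal A} {n : ℕ} [NeZero n]

theorem R1.refl (v : Fin n → A) : R1 I v v := ⟨1, one_mem _, by simp⟩

theorem R1.of_eq {v w : Fin n → A} (h : v = w) : R1 I v w := h ▸ R1.refl v

theorem R1.trans {u v w : Fin n → A} (h1 : R1 I u v) (h2 : R1 I v w) : R1 I u w := by
  obtain ⟨E, hE, rfl⟩ := h1
  obtain ⟨F, hF, rfl⟩ := h2
  exact ⟨E * F, mul_mem hE hF, by simp⟩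

theorem tv_mem1 (i : Fin n) (hi : i ≠ 0) (a : A) :
    Matrix.transvection 0 i a ∈ relElementarySubmonoid1 n A I :=
  Submonoid.subset_closure (Or.inl ⟨i, a, hi, rfl⟩)

theorem tv_mem2 (i : Fin n) (hi : i ≠ 0) (a : A) (ha : a ∈ I) :
    Matrix.transvection i 0 a ∈ relElementarySubmonoid1 n A I :=
  Submonoid.subset_closure (Or.inr ⟨i, a, hi, ha, rfl⟩)

theorem m1 (v : Fin n → A) (i : Fin n) (hi : i ≠ 0) (r : A) :
    R1 I v (v + Pi.single i (v 0 * r)) :=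
  ⟨_, tv_mem1 i hi r, (vecMul_tv _ _ _ _).symm⟩

theorem m2 (v : Fin n → A) (j : Fin n) (hj : j ≠ 0) (x : A) (hx : x ∈ I) :
    R1 I v (v + Pi.single 0 (v j * x)) :=
  ⟨_, tv_mem2 j hj x hx, (vecMul_tv _ _ _ _).symm⟩

theorem m3 (v : Fin n → A) (i j : Fin n) (hi : i ≠ 0) (hj : j ≠ 0) (hij : i ≠ j) (x : A)
    (hx : x ∈ I) : R1 I v (v + Pi.single i (v j * x)) := by
  refine (m2 v j hj x hx).trans ((m1 _ i hi 1).trans ((m2 _ j hj (-x) (neg_mem hx)).trans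
    ((m1 _ i hi (-1)).trans (R1.of_eq ?_))))
  ext k
  simp only [Pi.add_apply, Pi.single_apply]
  by_cases h0 : k = 0
  · subst h0; simp [hi, hj, hij, hi.symm, hj.symm, hij.symm]
  · by_cases h1 : k = i
    · subst h1; simp [hi, hj, hij, hi.symm, hj.symm, hij.symm]; ring
    · simp [h0, h1]

/-- adding `I`-multiples of another coordinate -/
theorem m4 (v : Fin n → A) (i j : Fin n) (hij : i ≠ j) (x : A)
    (hx : x ∈ I) : R1 I v (v + Pi.single i (v j * x)) := by
  by_cases hi : i = 0
  · subst hi; exact m2 v j hij.symm x hx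
  · by_cases hj : j = 0
    · subst hj; exact m1 v i hi x
    · exact m3 v i j hi hj hij x hx

theorem m5 (v : Fin n → A) (S : Set (Fin n)) (p : Fin n) (hp : p ∉ S) (δ : A)
    (hδ : δ ∈ I * Ideal.span (v '' S)) :
    ∀ w : Fin n → A, (∀ i ∈ S, w i = v i) → R1 I w (w + Pi.single p δ) := by
  have hadd : ∀ x y : A, (∀ w : Fin n → A, (∀ i ∈ S, w i = v i) → R1 I w (w + Pi.single p x)) →
      (∀ w : Fin n → A, (∀ i ∈ S, w i = v i) → R1 I w (w + Pi.single p y)) →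
      (∀ w : Fin n → A, (∀ i ∈ S, w i = v i) → R1 I w (w + Pi.single p (x + y))) := by
    intro x y hx hy w hw
    refine (hx w hw).trans ((hy _ ?_).trans (R1.of_eq ?_))
    · intro i hi
      have : i ≠ p := fun h => hp (h ▸ hi)
      simp [this, hw i hi]
    · rw [add_assoc, Pi.single_add]
  refine Submodule.mul_induction_on hδ ?_ (fun x y hx hy => hadd x y hx hy)
  intro x hx y hy
  revert x
  refine Submodule.span_induction ?_ ?_ ?_ ?_ hy
  · rintro _ ⟨i, hi, rfl⟩ x hx w hw
    have : p ≠ i := fun h => hp (h ▸ hi)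
    have := m4 w p i this x hx
    rwa [hw i hi, mul_comm] at this
  · intro x hx w hw
    simpa using R1.refl w
  · intro y z _ _ h1 h2 x hx
    rw [mul_add]
    exact hadd _ _ (h1 x hx) (h2 x hx)
  · intro r y _ h x hx
    have := h (x * r) (Ideal.mul_mem_right _ _ hx)
    rwa [mul_assoc] at this

theorem tv_mul_comm_form (i j : Fin n) (s : A) (hij : i ≠ j) (hi : i ≠ 0) (hj : j ≠ 0)
    (E : Matrix (Fin n) (Fin n) A) (hE : E ∈ relElementarySubmonoid1 n A I) :
    Matrix.transvection i j s * E * Matrix.transvection i j (-s)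
      ∈ relElementarySubmonoid1 n A I := by
  have hneg : ∀ (i j : Fin n) (s : A), Matrix.single i j (-s) = -Matrix.single i j s := by
    intro i j s; ext a b; simp only [Matrix.single_apply, Matrix.neg_apply]; split_ifs <;> simp
  have hinv : Matrix.transvection i j (-s) * Matrix.transvection i j s = 1 := by
    rw [Matrix.transvection_mul_transvection_same _ _ hij]; simp
  have hinv' : Matrix.transvection i j s * Matrix.transvection i j (-s) = 1 := by
    rw [Matrix.transvection_mul_transvection_same _ _ hij]; simp
  refine Submonoid.closure_induction (motive := fun E _ => Matrix.transvection i j s * E *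
    Matrix.transvection i j (-s) ∈ relElementarySubmonoid1 n A I) ?_ ?_ ?_ hE
  · rintro E (⟨l, a, hl, rfl⟩ | ⟨l, x, hl, hx, rfl⟩)
    · by_cases h : l = i
      · subst h
        have : Matrix.transvection l j s * Matrix.transvection 0 l a *
            Matrix.transvection l j (-s) =
            Matrix.transvection 0 l a * Matrix.transvection 0 j (-(a * s)) := by
          simp only [Matrix.transvection, add_mul, mul_add, one_mul, mul_one]
          simp [Matrix.single_mul_single_of_ne, hj, hl, hij, hij.symm,
            ← add_assoc, hneg]
          try abel
        rw [this]
        exact mul_mem (tv_mem1 _ hl _) (tv_mem1 _ hj _)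
      · have : Matrix.transvection i j s * Matrix.transvection 0 l a *
            Matrix.transvection i j (-s) = Matrix.transvection 0 l a := by
          simp only [Matrix.transvection, add_mul, mul_add, one_mul, mul_one]
          simp [Matrix.single_mul_single_of_ne, hj, hl, h, hij, hij.symm,
            ← add_assoc, hneg]
          try abel
        rw [this]
        exact tv_mem1 _ hl _
    · by_cases h : l = j
      · subst h
        have : Matrix.transvection i l s * Matrix.transvection l 0 x *
            Matrix.transvection i l (-s) =
            Matrix.transvection l 0 x * Matrix.transvection i 0 (s * x) := by
          simp only [Matrix.transvection, add_mul, mul_add, one_mul, mul_one]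
          simp [Matrix.single_mul_single_of_ne, hi, hi.symm, hl, hij, hij.symm,
            ← add_assoc, hneg]
          try abel
        rw [this]
        exact mul_mem (tv_mem2 _ hl _ hx) (tv_mem2 _ hi _ (Ideal.mul_mem_left _ _ hx))
      · have : Matrix.transvection i j s * Matrix.transvection l 0 x *
            Matrix.transvection i j (-s) = Matrix.transvection l 0 x := by
          simp only [Matrix.transvection, add_mul, mul_add, one_mul, mul_one]
          simp [Matrix.single_mul_single_of_ne, hi, hi.symm, hl, h, Ne.symm h, hij, hij.symm,
            ← add_assoc, hneg]
          try abel
        rw [this]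
        exact tv_mem2 _ hl _ hx
  · simp [hinv', one_mem]
  · intro x y _ _ hx hy
    have := mul_mem hx hy
    have e : Matrix.transvection i j s * (x * y) * Matrix.transvection i j (-s) =
      (Matrix.transvection i j s * x * Matrix.transvection i j (-s)) *
      (Matrix.transvection i j s * y * Matrix.transvection i j (-s)) := by
      calc _ = Matrix.transvection i j s * x * 1 * y * Matrix.transvection i j (-s) := by
            simp [mul_assoc]
        _ = _ := by rw [← hinv]; simp only [mul_assoc]
    rw [e]; exact this

/-- conjugation invariance of the relation -/
theorem R1.conj {v w : Fin n → A} (i j : Fin n) (s : A) (hij : i ≠ j) (hi : i ≠ 0) (hj : j ≠ 0)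
    (h : R1 I (v + Pi.single j (v i * s)) w) : R1 I v (w + Pi.single j (w i * (-s))) := by
  obtain ⟨E, hE, rfl⟩ := h
  refine ⟨_, tv_mul_comm_form i j s hij hi hj E hE, ?_⟩
  rw [← vecMul_tv, ← vecMul_tv, Matrix.vecMul_vecMul, Matrix.vecMul_vecMul, mul_assoc]

theorem t1 (v : Fin n → A) (p q : Fin n) (hp : p ≠ 0) (hq : q ≠ 0) (hpq : p ≠ q)
    (k y c : A) (hk : k ∈ I) :
    R1 I v (v + Pi.single p (k * (v p * y + v q * c) * (-c))
      + Pi.single q (k * (v p * y + v q * c) * y)) := by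
  refine (m2 v p hp (k * y) (Ideal.mul_mem_right _ _ hk)).trans
    ((m2 _ q hq (k * c) (Ideal.mul_mem_right _ _ hk)).trans
    ((m1 _ p hp (-c)).trans ((m1 _ q hq y).trans
    ((m2 _ p hp (-(k * y)) (neg_mem (Ideal.mul_mem_right _ _ hk))).trans
    ((m2 _ q hq (-(k * c)) (neg_mem (Ideal.mul_mem_right _ _ hk))).trans
    ((m1 _ p hp c).trans ((m1 _ q hq (-y)).trans (R1.of_eq ?_))))))))
  ext l
  simp only [Pi.add_apply, Pi.single_apply]
  by_cases h0 : l = 0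
  · subst h0; simp [hp, hq, hpq, hp.symm, hq.symm, hpq.symm]; ring
  · by_cases h1 : l = p
    · subst h1; simp [hp, hq, hpq, hp.symm, hq.symm, hpq.symm]; ring
    · by_cases h2 : l = q
      · subst h2; simp [hp, hq, hpq, hp.symm, hq.symm, hpq.symm]; ring
      · simp [h0, h1, h2]

theorem t2 (v : Fin n → A) (o q : Fin n) (ho : o ≠ 0) (hq : q ≠ 0) (hpq : o ≠ q)
    (k y c : A) (hc : c ∈ I) :
    R1 I v (v + Pi.single 0 (k * (v 0 * y + v q * c) * (-c))
      + Pi.single q (k * (v 0 * y + v q * c) * y)) := by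
  have hkc : k * c ∈ I := Ideal.mul_mem_left _ _ hc
  refine (m1 v o ho (k * y)).trans ((m3 _ o q ho hq hpq (k * c) hkc).trans
    ((m2 _ o ho (-c) (neg_mem hc)).trans ((R1.conj o q y hpq ho hq
      ((m1 _ o ho (-(k * y))).trans (m3 _ o q ho hq hpq (-(k * c)) (neg_mem hkc)))).trans
      ((m2 _ o ho c hc).trans (R1.of_eq ?_)))))
  ext l
  simp only [Pi.add_apply, Pi.single_apply]
  by_cases h0 : l = 0
  · subst h0; simp [ho, hq, hpq, ho.symm, hq.symm, hpq.symm]; ring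
  · by_cases h1 : l = o
    · subst h1; simp [ho, hq, hpq, ho.symm, hq.symm, hpq.symm]; ring
    · by_cases h2 : l = q
      · subst h2; simp [ho, hq, hpq, ho.symm, hq.symm, hpq.symm]; ring
      · simp [h0, h1, h2]

theorem core (v : Fin n → A) (p q : Fin n) (hpq : p ≠ q) (D : Ideal A)
    (Pk : A → Prop) (Pc : A → Prop)
    (hT : ∀ (w : Fin n → A) (k y c : A), Pk k → Pc c →
      R1 I w (w + Pi.single p (k * (w p * y + w q * c) * (-c))
        + Pi.single q (k * (w p * y + w q * c) * y)))
    (hD : ∀ w : Fin n → A, (∀ i, i ≠ p → i ≠ q → w i = v i) → ∀ δ₁ ∈ D, ∀ δ₂ ∈ D,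
      R1 I w (w + Pi.single p δ₁ + Pi.single q δ₂))
    (t y' c' κ κ' U k l m : A) (hdual : v p * y' + v q * c' = 1 - κ)
    (hU : (1 + t * y') * U = 1 + κ') (hkl : k * l = t * y') (hm : m = -(t * v q + k) * U)
    (hPk : Pk k) (hPm : Pk m) (hPc : Pc c') (hPc' : Pc (c' - l * (v p - m * c')))
    (hmκ : m * κ ∈ D) (hkκ : k * κ ∈ D) (htκ : t * κ ∈ D) (hκ' : (t * v q + k) * κ' ∈ D) :
    R1 I v (v + Pi.single p t) := by
  have s1 := hT v m y' c' hPm hPc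
  rw [hdual] at s1
  have s2 := hD (v + Pi.single p (m * (1 - κ) * (-c')) + Pi.single q (m * (1 - κ) * y'))
    (by intro i hi hj; simp [hi, hj]) (-(m * κ * c')) (neg_mem (D.mul_mem_right _ hmκ))
    (m * κ * y') (D.mul_mem_right _ hmκ)
  have e1 : v + Pi.single p (m * (1 - κ) * (-c')) + Pi.single q (m * (1 - κ) * y')
      + Pi.single p (-(m * κ * c')) + Pi.single q (m * κ * y')
      = v + Pi.single p (-(m * c')) + Pi.single q (m * y') := by
    ext i
    simp only [Pi.add_apply, Pi.single_apply]
    split_ifs <;> ring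
  rw [e1] at s2
  have s3 := hT (v + Pi.single p (-(m * c')) + Pi.single q (m * y')) k
    (y' + l * (v q + m * y')) (c' - l * (v p - m * c')) hPk hPc'
  have hwp : (v + Pi.single p (-(m * c')) + Pi.single q (m * y') : Fin n → A) p = v p - m * c' := by
    simp [hpq, hpq.symm]; ring
  have hwq : (v + Pi.single p (-(m * c')) + Pi.single q (m * y') : Fin n → A) q = v q + m * y' := by
    simp [hpq, hpq.symm]
  have hd2 : (v p - m * c') * (y' + l * (v q + m * y')) +
      (v q + m * y') * (c' - l * (v p - m * c')) = 1 - κ := by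
    rw [← hdual]; ring
  rw [hwp, hwq, hd2] at s3
  refine s1.trans (s2.trans (s3.trans ((hD _ ?_
    (k * κ * -(c' - l * (v p - m * c')) + t * κ - c' * ((t * v q + k) * κ')) ?_
    (k * κ * (y' + l * (v q + m * y')) + y' * ((t * v q + k) * κ')) ?_).trans (R1.of_eq ?_))))
  · intro i hi hj; simp [hi, hj]
  · exact sub_mem (add_mem (D.mul_mem_right _ hkκ) htκ) (D.mul_mem_left _ hκ')
  · exact add_mem (D.mul_mem_right _ hkκ) (D.mul_mem_left _ hκ')
  · have hmm : (1 + t * y') * m = -(t * v q + k) * (1 + κ') := by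
      rw [hm, ← hU]; ring
    ext i
    simp only [Pi.add_apply, Pi.single_apply]
    by_cases h1 : i = p
    · subst h1
      simp only [if_true, hpq, if_false]
      linear_combination (v i - m * c') * hkl - c' * hmm + t * hdual
    · by_cases h2 : i = q
      · subst h2
        simp only [if_true, h1, if_false]
        linear_combination (v i + m * y') * hkl + y' * hmm
      · simp [h1, h2]

theorem hDlem (v : Fin n → A) (p q : Fin n) :
    ∀ w : Fin n → A, (∀ i, i ≠ p → i ≠ q → w i = v i) →
      ∀ δ₁ ∈ I * Ideal.span (v '' {i | i ≠ p ∧ i ≠ q}),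
      ∀ δ₂ ∈ I * Ideal.span (v '' {i | i ≠ p ∧ i ≠ q}),
      R1 I w (w + Pi.single p δ₁ + Pi.single q δ₂) := by
  intro w hw δ₁ h₁ δ₂ h₂
  refine (m5 v _ p (by simp) δ₁ h₁ w (fun i hi => hw i hi.1 hi.2)).trans
    (m5 v _ q (by simp) δ₂ h₂ _ (fun i hi => ?_))
  simp [hi.1, hw i hi.1 hi.2]

theorem exists_dual (v : Fin n → A) (hv : IsUmRow v) (p q : Fin n) :
    ∃ y c κ : A, κ ∈ Ideal.span (v '' {i | i ≠ p ∧ i ≠ q}) ∧ v p * y + v q * c = 1 - κ := by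
  have h1 : (1 : A) ∈ Ideal.span {v p} ⊔ (Ideal.span {v q} ⊔
      Ideal.span (v '' {i | i ≠ p ∧ i ≠ q})) := by
    have : Ideal.span (Set.range v) ≤ Ideal.span {v p} ⊔ (Ideal.span {v q} ⊔
      Ideal.span (v '' {i | i ≠ p ∧ i ≠ q})) := by
      rw [Ideal.span_le]
      rintro _ ⟨i, rfl⟩
      by_cases h1 : i = p
      · subst h1
        exact Ideal.mem_sup_left (Ideal.subset_span rfl)
      · refine Ideal.mem_sup_right ?_
        by_cases h2 : i = q
        · subst h2
          exact Ideal.mem_sup_left (Ideal.subset_span rfl)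
        · exact Ideal.mem_sup_right (Ideal.subset_span ⟨i, ⟨h1, h2⟩, rfl⟩)
    rw [show Ideal.span (Set.range v) = ⊤ from hv] at this
    exact this trivial
  obtain ⟨x, hx, z, hz, e⟩ := Submodule.mem_sup.1 h1
  obtain ⟨x2, hx2, κ, hκ, e2⟩ := Submodule.mem_sup.1 hz
  obtain ⟨y, rfl⟩ := Ideal.mem_span_singleton'.1 hx
  obtain ⟨c, rfl⟩ := Ideal.mem_span_singleton'.1 hx2
  exact ⟨y, c, κ, hκ, by linear_combination e + e2⟩

theorem exists_U (K : Ideal A) (t y : A) (d : ℕ) (ht : t ∈ I) (htd : t ^ d ∈ K) :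
    ∃ U κ' : A, κ' ∈ I * K ∧ (1 + t * y) * U = 1 + κ' := by
  refine ⟨∑ i ∈ Finset.range (d + 1), (-(t * y)) ^ i, -(-(t * y)) ^ (d + 1), ?_, ?_⟩
  · have : -(-(t * y)) ^ (d + 1) = (t * t ^ d) * (-(-1) ^ (d + 1) * y ^ (d + 1)) := by
      rw [neg_pow (t * y), mul_pow, pow_succ t]; ring
    rw [this]
    exact Ideal.mul_mem_right _ _ (Ideal.mul_mem_mul ht htd)
  · have := mul_neg_geom_sum (-(t * y)) (d + 1)
    rw [sub_neg_eq_add] at this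
    rw [this]; ring

theorem l1 (v : Fin n → A) (hv : IsUmRow v) (p q : Fin n) (hp : p ≠ 0) (hq : q ≠ 0)
    (hpq : p ≠ q) (t : A) (ht : t ∈ I) (d : ℕ)
    (htd : t ^ d ∈ Ideal.span (v '' {i | i ≠ p ∧ i ≠ q})) : R1 I v (v + Pi.single p t) := by
  obtain ⟨y, c, κ, hκ, hd⟩ := exists_dual v hv p q
  obtain ⟨U, κ', hκ', hU⟩ := exists_U (I := I) _ t y d ht htd
  have hmI : -(t * v q + t) * U ∈ I :=
    I.mul_mem_right _ (neg_mem (add_mem (I.mul_mem_right _ ht) ht))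
  exact core v p q hpq _ (fun k => k ∈ I) (fun _ => True)
    (fun w k y c hk _ => t1 w p q hp hq hpq k y c hk) (hDlem v p q) t y c κ κ' U t y _ hd hU rfl rfl
    ht hmI trivial trivial (Ideal.mul_mem_mul hmI hκ) (Ideal.mul_mem_mul ht hκ)
    (Ideal.mul_mem_mul ht hκ) (Ideal.mul_mem_left _ _ hκ')

theorem l2 (v : Fin n → A) (hv : IsRelUmRow I v) (o q : Fin n) (ho : o ≠ 0) (hq : q ≠ 0)
    (hoq : o ≠ q) (t : A) (ht : t ∈ I) (d : ℕ)
    (htd : t ^ d ∈ Ideal.span (v '' {i | i ≠ 0 ∧ i ≠ q})) : R1 I v (v + Pi.single 0 t) := by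
  obtain ⟨y₀, c₀, κ₀, hκ₀, hd₀⟩ := exists_dual v hv.1 0 q
  obtain ⟨y, c, κ, hc, hκ, hd⟩ : ∃ y c κ : A, c ∈ I ∧
      κ ∈ I * Ideal.span (v '' {i | i ≠ 0 ∧ i ≠ q}) ∧ v 0 * y + v q * c = 1 - κ :=
    ⟨1 + (1 - v 0) * y₀, (1 - v 0) * c₀, (1 - v 0) * κ₀, I.mul_mem_right _ hv.2.1,
      Ideal.mul_mem_mul hv.2.1 hκ₀, by linear_combination (1 - v 0) * hd₀⟩
  obtain ⟨U, κ', hκ', hU⟩ := exists_U (I := I) _ t y d ht htd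
  exact core v 0 q hq.symm _ (fun _ => True) (fun c => c ∈ I)
    (fun w k y c _ hc => t2 w o q ho hq hoq k y c hc) (hDlem v 0 q) t y c κ κ' U y t _ hd hU
    (mul_comm _ _) rfl
    trivial trivial hc (sub_mem hc (I.mul_mem_right _ ht)) (Ideal.mul_mem_left _ _ hκ)
    (Ideal.mul_mem_left _ _ hκ) (Ideal.mul_mem_left _ _ hκ) (Ideal.mul_mem_left _ _ hκ')

theorem mod_lower (E : Matrix (Fin n) (Fin n) A) (hE : E ∈ relElementarySubmonoid1 n A I) :
    ∀ i, i ≠ 0 → ∀ j, (E.map (Ideal.Quotient.mk I)) i j = (1 : Matrix (Fin n) (Fin n) (A ⧸ I)) i j := by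
  refine Submonoid.closure_induction (motive := fun E _ => ∀ i, i ≠ 0 → ∀ j,
    (E.map (Ideal.Quotient.mk I)) i j = (1 : Matrix (Fin n) (Fin n) (A ⧸ I)) i j) ?_ ?_ ?_ hE
  · rintro E (⟨l, a, hl, rfl⟩ | ⟨l, x, hl, hx, rfl⟩) i hi j
    · simp only [Matrix.transvection, Matrix.map_apply, Matrix.add_apply, map_add,
        Matrix.single_apply, Matrix.one_apply]
      rw [if_neg (show ¬ (0 = i ∧ l = j) from fun h => hi h.1.symm)]
      by_cases hij : i = j <;> simp [hij]
    · have hx' : Ideal.Quotient.mk I x = 0 := Ideal.Quotient.eq_zero_iff_mem.2 hx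
      simp only [Matrix.transvection, Matrix.map_apply, Matrix.add_apply, map_add,
        Matrix.single_apply, Matrix.one_apply]
      have h3 : Ideal.Quotient.mk I (if l = i ∧ 0 = j then x else 0) = 0 := by
        split_ifs
        · exact hx'
        · exact map_zero _
      rw [h3]
      by_cases hij : i = j <;> simp [hij]
  · intro i _ j
    by_cases hij : i = j <;> simp [Matrix.one_apply, hij]
  · intro x y _ _ hx hy i hi j
    rw [Matrix.map_mul, Matrix.mul_apply]
    simp_rw [hx i hi]
    simp [Matrix.one_apply] 
    have := hy i hi j
    simpa [Matrix.one_apply] using this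

theorem rel_of_R1 (v w : Fin n → A) (h : R1 I v w) (hv0 : 1 - v 0 ∈ I)
    (hv : ∀ i, i ≠ 0 → v i ∈ I) (hw0 : 1 - w 0 ∈ I) (hw : ∀ i, i ≠ 0 → w i ∈ I) :
    RelERel I v w := by
  obtain ⟨E, hE, e⟩ := h
  refine ⟨E, ⟨hE, ?_⟩, e⟩
  have key : ∀ u : Fin n → A, 1 - u 0 ∈ I → (∀ i, i ≠ 0 → u i ∈ I) → ∀ i,
      Ideal.Quotient.mk I (u i) = if i = 0 then 1 else 0 := by
    intro u h0 h1 i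
    split_ifs with h
    · subst h
      exact (Ideal.Quotient.eq.2 (by simpa using h0)).symm
    · exact Ideal.Quotient.eq_zero_iff_mem.2 (h1 i h)
  ext i j
  by_cases hi : i = 0
  · subst hi
    have h1 := congrArg (Ideal.Quotient.mk I) (congrFun e j)
    rw [key w hw0 hw] at h1
    simp only [Matrix.vecMul, dotProduct, map_sum, map_mul, key v hv0 hv] at h1
    simp at h1
    rw [Matrix.map_apply, ← h1, Matrix.one_apply]
    simp [eq_comm]
  · exact mod_lower E hE i hi j

end

/-- For a commutative ring `A` with ideal `I`, a relative unimodular row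
`[a₁, …, a_n] ∈ Um_n(A, I)`, `n ≥ 3` (written `n = m + 3`), and a positive integer `d`, the
rows `[a₁^d, a₂, …, a_n]` and `[a₁, a₂^d, …, a_n]` lie in the same orbit under `E_n(A, I)`. -/
theorem vaserstein_power_swap_rel (A : Type*) [CommRing A] (I : Ideal A) (m : ℕ)
    (v : Fin (m + 3) → A) (hv : IsRelUmRow I v) (d : ℕ) (hd : 0 < d) :
    RelERel I (Function.update v 0 (v 0 ^ d)) (Function.update v 1 (v 1 ^ d)) := by
  obtain ⟨hu, h0, h1⟩ := hv
  have hb : v 1 ∈ I := h1 1 (by simp)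
  have e10 : (1 : Fin (m + 3)) ≠ 0 := by simp
  have e20 : (2 : Fin (m + 3)) ≠ 0 := by
    intro h; have := congrArg Fin.val h
    simp [Fin.val_ofNat, Nat.mod_eq_of_lt (show 2 < m + 3 by omega)] at this
  have e12 : (1 : Fin (m + 3)) ≠ 2 := by
    intro h; have := congrArg Fin.val h
    simp [Fin.val_ofNat, Nat.mod_eq_of_lt (show 2 < m + 3 by omega),
      Nat.mod_eq_of_lt (show 1 < m + 3 by omega)] at this
  set a := v 0 with ha
  set b := v 1 with hbd
  obtain ⟨W, hW⟩ : ∃ W : A → A → Fin (m + 3) → A,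
      W = fun x y => Function.update (Function.update v 0 x) 1 y := ⟨_, rfl⟩
  have W0 : ∀ x y, W x y 0 = x := by intro x y; simp [hW, e10.symm]
  have W1 : ∀ x y, W x y 1 = y := by intro x y; simp [hW]
  have Wi : ∀ x y i, i ≠ 0 → i ≠ 1 → W x y i = v i := by
    intro x y i hi hj; simp [hW, hi, hj]
  have A1 : ∀ x y r, W x y + Pi.single 1 r = W x (y + r) := by
    intro x y r; ext i
    by_cases hi : i = 1
    · subst hi; simp [W1]
    · by_cases hj : i = 0
      · subst hj; simp [W0, hi]
      · simp [Wi, hi, hj]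
  have A0 : ∀ x y r, W x y + Pi.single 0 r = W (x + r) y := by
    intro x y r; ext i
    by_cases hi : i = 1
    · subst hi; simp [W1, e10]
    · by_cases hj : i = 0
      · subst hj; simp [W0]
      · simp [Wi, hi, hj]
  have hum : ∀ x y, (∀ P : Ideal A, P.IsPrime → x ∈ P → y ∈ P → a ∈ P ∧ b ∈ P) →
      IsUmRow (W x y) := by
    intro x y H
    by_contra hne
    obtain ⟨P, hP, hle⟩ := Ideal.exists_le_maximal _ hne
    have hm : ∀ i, W x y i ∈ P := fun i => hle (Ideal.subset_span ⟨i, rfl⟩)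
    have hx := hm 0
    have hy := hm 1
    rw [W0] at hx
    rw [W1] at hy
    obtain ⟨h2, h3⟩ := H P hP.isPrime hx hy
    apply hP.ne_top
    rw [eq_top_iff, ← hu, Ideal.span_le]
    rintro _ ⟨i, rfl⟩
    by_cases hi : i = 0
    · subst hi; exact h2
    by_cases hj : i = 1
    · subst hj; exact h3
    have := hm i
    rwa [Wi x y i hi hj] at this
  have mk1 : Ideal.Quotient.mk I a = 1 := by
    have := Ideal.Quotient.eq_zero_iff_mem.2 h0
    rw [map_sub, map_one, sub_eq_zero] at this
    exact this.symm
  have mk0 : Ideal.Quotient.mk I b = 0 := Ideal.Quotient.eq_zero_iff_mem.2 hb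
  have hd' : d ≠ 0 := hd.ne'
  have start : Function.update v 0 (a ^ d) = W (a ^ d) b := by
    ext i
    by_cases hi : i = 1
    · subst hi; rw [W1]; simp [e10, hbd]
    · by_cases hj : i = 0
      · subst hj; simp [W0]
      · simp [Wi, hi, hj]
  have fin : Function.update v 1 (b ^ d) = W a (b ^ d) := by
    ext i
    by_cases hi : i = 1
    · subst hi; simp [W1]
    · by_cases hj : i = 0
      · subst hj; rw [W0]; simp [hi, ha]
      · simp [Wi, hi, hj]
  obtain ⟨G, hG⟩ := sub_dvd_pow_sub_pow b a d
  have hGI : G - 1 ∈ I := by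
    have := congrArg (Ideal.Quotient.mk I) hG
    simp only [map_sub, map_pow, map_mul, mk1, mk0, one_pow, zero_pow hd'] at this
    apply Ideal.Quotient.eq_zero_iff_mem.1
    rw [map_sub, map_one]
    linear_combination this
  have htI : a ^ d - a ∈ I := by
    apply Ideal.Quotient.eq_zero_iff_mem.1
    simp [mk1]
  have hbI : b ^ d ∈ I := Ideal.pow_mem_of_mem I hb d hd
  have s1 := m1 (I := I) (W (a ^ d) b) 1 e10 (-1)
  rw [A1, W0] at s1
  have s2 := l1 (I := I) (W (a ^ d) (b + a ^ d * -1)) (hum _ _ (by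
    intro P hP hx hy
    refine ⟨hP.mem_of_pow_mem _ hx, ?_⟩
    have := add_mem hy hx
    have e : b + a ^ d * -1 + a ^ d = b := by ring
    rwa [e] at this)) 1 2 e10 e20 e12 (a ^ d - a) htI d (by
      have hmem : a ^ d ∈ Ideal.span (W (a ^ d) (b + a ^ d * -1) '' {i | i ≠ 1 ∧ i ≠ 2}) :=
        Ideal.subset_span ⟨0, ⟨e10.symm, e20.symm⟩, W0 _ _⟩
      have hdv : a ∣ a ^ d - a := dvd_sub (dvd_pow_self a hd') dvd_rfl
      exact Ideal.mem_of_dvd _ (pow_dvd_pow_of_dvd hdv d) hmem)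
  rw [A1] at s2
  have s3 := m2 (I := I) (W (a ^ d) (b + a ^ d * -1 + (a ^ d - a))) 1 e10 (G - 1) hGI
  rw [A0, W1] at s3
  have eb : b + a ^ d * -1 + (a ^ d - a) = b - a := by ring
  rw [eb] at s2 s3
  have ea : a ^ d + (b - a) * (G - 1) = a + b ^ d - b := by linear_combination -hG
  rw [ea] at s3
  have s4 := m1 (I := I) (W (a + b ^ d - b) (b - a)) 1 e10 1
  rw [A1, W0] at s4
  have ec : b - a + (a + b ^ d - b) * 1 = b ^ d := by ring
  rw [ec] at s4
  have s5 := l2 (I := I) (W (a + b ^ d - b) (b ^ d)) ⟨hum _ _ (by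
      intro P hP hx hy
      have hbP := hP.mem_of_pow_mem _ hy
      refine ⟨?_, hbP⟩
      have := add_mem (sub_mem hx hy) hbP
      have e : a + b ^ d - b - b ^ d + b = a := by ring
      rwa [e] at this), by
        rw [W0]
        have e : 1 - (a + b ^ d - b) = (1 - a) - b ^ d + b := by ring
        rw [e]; exact add_mem (sub_mem h0 hbI) hb, by
        intro i hi
        by_cases hj : i = 1
        · subst hj; rw [W1]; exact hbI
        · rw [Wi _ _ i hi hj]; exact h1 i hi⟩ 1 2 e10 e20 e12 (b - b ^ d) (sub_mem hb hbI) d (by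
      have hmem : b ^ d ∈ Ideal.span (W (a + b ^ d - b) (b ^ d) '' {i | i ≠ 0 ∧ i ≠ 2}) :=
        Ideal.subset_span ⟨1, ⟨e10, e12⟩, W1 _ _⟩
      have hdv : b ∣ b - b ^ d := dvd_sub dvd_rfl (dvd_pow_self b hd')
      exact Ideal.mem_of_dvd _ (pow_dvd_pow_of_dvd hdv d) hmem)
  rw [A0] at s5
  have ef : a + b ^ d - b + (b - b ^ d) = a := by ring
  rw [ef] at s5
  rw [start, fin]
  refine rel_of_R1 _ _ (s1.trans (s2.trans (s3.trans (s4.trans s5)))) ?_ ?_ ?_ ?_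
  · rw [W0]
    apply Ideal.Quotient.eq_zero_iff_mem.1
    simp [mk1]
  · intro i hi
    by_cases hj : i = 1
    · subst hj; rw [W1]; exact hb
    · rw [Wi _ _ i hi hj]; exact h1 i hi
  · rw [W0]; exact h0
  · intro i hi
    by_cases hj : i = 1
    · subst hj; rw [W1]; exact hbI
    · rw [Wi _ _ i hi hj]; exact h1 i hi
end
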